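/- Let k > 2 be a fixed real number and let q be a large integer such that every Dirichlet L-function modulo q satisfies the Riemann Hypothesis. Then there is a constant C depending only on k such that for every integer n with 0 ≤ n ≤ q, one has ∑_{χ ∈ X_q^*} (∫_n^{n+1} |L(1/2 + it, χ)| dt)^{2k} ≤ C · φ(q) · (log q)^{(k−1)²}. -/

import Mathlib

open Complex Real Finset

def dirichletRH {q : ℕ} [NeZero q] (χ : DirichletCharacter ℂ q) : Prop :=
  ∀ s : ℂ, 0 < s.re → s.re < 1 → DirichletCharacter.LFunction χ s = 0 → s.re = 1 / 2


namespace S18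

lemma sum_range_char_shift {q : ℕ} [NeZero q] {χ : DirichletCharacter ℂ q} (hχ : χ ≠ 1) (n : ℕ) :
    ∑ k ∈ Finset.range q, χ ((n + k : ℕ) : ZMod q) = 0 := by
  have h1 : ∑ k ∈ Finset.range q, χ ((n + k : ℕ) : ZMod q) = ∑ x : ZMod q, χ ((n : ZMod q) + x) := by
    refine Finset.sum_bij (fun k _ => (k : ZMod q)) (by simp) ?_ ?_ (by simp)
    · intro a ha b hb hab
      have := (ZMod.natCast_eq_natCast_iff a b q).1 hab
      exact Nat.ModEq.eq_of_lt_of_lt this (Finset.mem_range.1 ha) (Finset.mem_range.1 hb)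
    · intro b _
      exact ⟨b.val, Finset.mem_range.2 (ZMod.val_lt b), by simp⟩
  rw [h1, Fintype.sum_equiv (Equiv.addLeft (n : ZMod q)) (fun x => χ ((n : ZMod q) + x)) (fun x => χ x) (fun x => rfl)]
  exact MulChar.sum_eq_zero_of_ne_one hχ

lemma norm_sum_range_char_le {q : ℕ} [NeZero q] {χ : DirichletCharacter ℂ q} (hχ : χ ≠ 1) (n : ℕ) :
    ‖∑ k ∈ Finset.range n, χ (k : ZMod q)‖ ≤ q := by
  induction n using Nat.strong_induction_on with
  | _ n ih =>
    by_cases hn : n < q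
    · refine (norm_sum_le _ _).trans ?_
      refine (Finset.sum_le_sum (fun k _ => χ.norm_le_one _)).trans ?_
      simp only [Finset.sum_const, Finset.card_range, nsmul_eq_mul, mul_one]
      exact_mod_cast hn.le
    · obtain ⟨m, rfl⟩ := Nat.exists_eq_add_of_le' (not_lt.1 hn)
      rw [Finset.sum_range_add, sum_range_char_shift hχ, add_zero]
      exact ih m (by have := NeZero.pos q; omega)

lemma norm_sum_Icc_char_le {q : ℕ} [NeZero q] {χ : DirichletCharacter ℂ q} (hχ : χ ≠ 1) (n : ℕ) :
    ‖∑ k ∈ Finset.Icc 1 n, χ (k : ZMod q)‖ ≤ q + 1 := by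
  have h : ∑ k ∈ Finset.range (n + 1), χ (k : ZMod q) = χ ((0:ℕ) : ZMod q) + ∑ k ∈ Finset.Icc 1 n, χ (k : ZMod q) := by
    rw [Finset.range_eq_Ico, Finset.sum_eq_sum_Ico_succ_bot (by omega)]
    rfl
  have h2 : ∑ k ∈ Finset.Icc 1 n, χ (k : ZMod q) = ∑ k ∈ Finset.range (n + 1), χ (k : ZMod q) - χ ((0:ℕ) : ZMod q) := by
    rw [h]; ring
  rw [h2]
  refine (norm_sub_le _ _).trans (add_le_add (norm_sum_range_char_le hχ _) (χ.norm_le_one _))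

/-- The polynomial bound for a nontrivial Dirichlet L-function in the right half plane. -/
lemma norm_LFunction_le {q : ℕ} [NeZero q] {χ : DirichletCharacter ℂ q} (hχ : χ ≠ 1) {s : ℂ}
    (hs : 0 < s.re) : ‖DirichletCharacter.LFunction χ s‖ ≤ ‖s‖ * ((q + 1) / s.re) := by
  set S : ℝ → ℂ := fun t => ∑ k ∈ Finset.Icc 1 ⌊t⌋₊, χ (k : ZMod q) with hS
  have hSb : ∀ t, ‖S t‖ ≤ q + 1 := fun t => norm_sum_Icc_char_le hχ _
  have hSm : Measurable S := by
    have : Measurable (fun n : ℕ => ∑ k ∈ Finset.Icc 1 n, χ (k : ZMod q)) := measurable_from_nat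
    exact this.comp Nat.measurable_floor
  set g : ℝ → ℂ := (Set.Ioi (1:ℝ)).indicator S with hg
  have hgm : Measurable g := hSm.indicator measurableSet_Ioi
  have hgb : ∀ t, ‖g t‖ ≤ q + 1 := by
    intro t
    by_cases ht : t ∈ Set.Ioi (1:ℝ)
    · rw [hg, Set.indicator_of_mem ht]; exact hSb t
    · rw [hg, Set.indicator_of_notMem ht]; simp; positivity
  have hInteg : ∀ z : ℂ, mellin g (-z) = ∫ t in Set.Ioi (1:ℝ), S t * (t:ℂ) ^ (-(z+1)) := by
    intro z
    rw [mellin]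
    have : (fun t : ℝ => (t:ℂ) ^ (-z - 1) • g t) = (Set.Ioi (1:ℝ)).indicator (fun t => S t * (t:ℂ) ^ (-(z+1))) := by
      ext t
      by_cases ht : t ∈ Set.Ioi (1:ℝ)
      · rw [hg, Set.indicator_of_mem ht, Set.indicator_of_mem ht, smul_eq_mul, mul_comm]
        congr 2; ring
      · rw [hg, Set.indicator_of_notMem ht, Set.indicator_of_notMem ht, smul_zero]
    rw [this, MeasureTheory.setIntegral_indicator measurableSet_Ioi]
    congr 2
    ext t; simp only [Set.mem_inter_iff, Set.mem_Ioi]; constructor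
    · exact fun h => h.2
    · exact fun h => ⟨by linarith, h⟩
  have hdiff : ∀ z : ℂ, 0 < z.re → DifferentiableAt ℂ (fun z => z * mellin g (-z)) z := by
    intro z hz
    refine differentiableAt_id.mul ?_
    refine DifferentiableAt.comp z (g := mellin g) (f := fun z => -z) ?_ differentiableAt_id.neg
    refine mellin_differentiableAt_of_isBigO_rpow (a := 0) (b := (-z).re - 1) ?_ ?_ (by simpa using hz) ?_ (by linarith)
    · refine MeasureTheory.LocallyIntegrable.locallyIntegrableOn ?_ _
      exact (MeasureTheory.locallyIntegrable_const ((q:ℝ) + 1)).mono hgm.aestronglyMeasurable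
        (Filter.Eventually.of_forall fun t => (hgb t).trans (le_abs_self _))
    · refine Asymptotics.IsBigO.of_bound (q + 1) ?_
      filter_upwards with t
      simpa using hgb t
    · refine Asymptotics.IsBigO.of_bound 1 ?_
      filter_upwards [mem_nhdsWithin_of_mem_nhds (Iio_mem_nhds (zero_lt_one' ℝ))] with t ht
      rw [hg, Set.indicator_of_notMem (by simpa using (le_of_lt ht))]
      simp
  have key : Set.EqOn (DirichletCharacter.LFunction χ) (fun z => z * mellin g (-z)) {z : ℂ | 0 < z.re} := by
    have hopen : IsOpen {z : ℂ | 0 < z.re} := isOpen_lt continuous_const Complex.continuous_re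
    refine AnalyticOnNhd.eqOn_of_preconnected_of_eventuallyEq (𝕜 := ℂ) (z₀ := 2) ?_ ?_ ?_ (by simp) ?_
    · exact (DirichletCharacter.differentiable_LFunction hχ).differentiableOn.analyticOnNhd hopen
    · exact DifferentiableOn.analyticOnNhd (fun z hz => (hdiff z hz).differentiableWithinAt) hopen
    · exact (convex_halfSpace_re_gt 0).isPreconnected
    · have : {z : ℂ | 1 < z.re} ∈ nhds (2:ℂ) :=
        (isOpen_lt continuous_const Complex.continuous_re).mem_nhds (by simp)
      filter_upwards [this] with z hz
      replace hz : 1 < z.re := hz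
      rw [DirichletCharacter.LFunction_eq_LSeries χ hz, hInteg z]
      rw [LSeries_eq_mul_integral _ (r := 0) le_rfl (by linarith)
        (DirichletCharacter.LSeriesSummable_of_one_lt_re χ hz)]
      refine Asymptotics.IsBigO.of_bound (q + 1) ?_
      filter_upwards with n
      simpa using norm_sum_Icc_char_le hχ n
  rw [key hs]
  simp only
  rw [norm_mul, hInteg]
  refine mul_le_mul_of_nonneg_left ?_ (norm_nonneg _)
  refine (MeasureTheory.norm_integral_le_integral_norm _).trans ?_
  have : ∫ t in Set.Ioi (1:ℝ), (q + 1) * t ^ (-(s.re + 1)) = (q + 1) / s.re := by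
    rw [MeasureTheory.integral_const_mul, integral_Ioi_rpow_of_lt (by linarith) one_pos]
    simp; field_simp
  rw [← this]
  refine MeasureTheory.integral_mono_of_nonneg (Filter.Eventually.of_forall fun t => norm_nonneg _) ?_ ?_
  · exact (integrableOn_Ioi_rpow_of_lt (by linarith) one_pos).const_mul _
  · filter_upwards [MeasureTheory.ae_restrict_mem measurableSet_Ioi] with t ht
    have ht0 : (0:ℝ) < t := lt_trans one_pos ht
    rw [norm_mul, Complex.norm_cpow_eq_rpow_re_of_pos ht0]
    refine mul_le_mul (hSb t) (le_of_eq (by simp)) (by positivity) (by positivity)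

end S18


namespace S18

/-- coefficients of `log L` -/
noncomputable def lam (n : ℕ) : ℝ := ArithmeticFunction.vonMangoldt n / Real.log n

lemma lam_nonneg (n : ℕ) : 0 ≤ lam n :=
  div_nonneg ArithmeticFunction.vonMangoldt_nonneg (Real.log_natCast_nonneg n)

lemma lam_le_one (n : ℕ) : lam n ≤ 1 := by
  refine div_le_one_of_le₀ ArithmeticFunction.vonMangoldt_le_log (Real.log_natCast_nonneg n)

noncomputable def acoef {q : ℕ} (χ : DirichletCharacter ℂ q) (n : ℕ) : ℂ := χ (n : ZMod q) * (lam n : ℂ)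

lemma norm_acoef_le {q : ℕ} (χ : DirichletCharacter ℂ q) (n : ℕ) : ‖acoef χ n‖ ≤ 1 := by
  rw [acoef, norm_mul, Complex.norm_real, Real.norm_of_nonneg (lam_nonneg n)]
  exact mul_le_one₀ (χ.norm_le_one _) (lam_nonneg n) (lam_le_one n)

lemma absc_acoef {q : ℕ} (χ : DirichletCharacter ℂ q) : LSeries.abscissaOfAbsConv (acoef χ) ≤ 1 :=
  LSeries.abscissaOfAbsConv_le_of_le_const ⟨1, fun n _ => norm_acoef_le χ n⟩

lemma absc_acoef_lt {q : ℕ} (χ : DirichletCharacter ℂ q) {s : ℂ} (hs : 1 < s.re) :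
    LSeries.abscissaOfAbsConv (acoef χ) < s.re :=
  lt_of_le_of_lt (absc_acoef χ) (by exact_mod_cast hs)

lemma isSimplyConnected_halfplane : IsSimplyConnected {s : ℂ | 1/2 < s.re} := by
  have hc : Convex ℝ {s : ℂ | 1/2 < s.re} := convex_halfSpace_re_gt _
  have : ContractibleSpace {s : ℂ | 1/2 < s.re} := hc.contractibleSpace ⟨1, by show (1/2:ℝ) < (1:ℂ).re; norm_num⟩
  rw [IsSimplyConnected]
  infer_instance

lemma LFunction_ne_zero_of_RH {q : ℕ} [NeZero q] {χ : DirichletCharacter ℂ q} (hχ : χ ≠ 1)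
    (hRH : dirichletRH χ) {s : ℂ} (hs : 1/2 < s.re) : DirichletCharacter.LFunction χ s ≠ 0 := by
  rcases lt_or_ge s.re 1 with h | h
  · intro h0
    have := hRH s (by linarith) h h0
    linarith
  · exact DirichletCharacter.LFunction_ne_zero_of_one_le_re χ (Or.inl hχ) h

lemma hasDerivAt_acoef {q : ℕ} [NeZero q] (χ : DirichletCharacter ℂ q) {s : ℂ} (hs : 1 < s.re) :
    HasDerivAt (LSeries (acoef χ)) (deriv (DirichletCharacter.LFunction χ) s / DirichletCharacter.LFunction χ s) s := by
  have h := LSeries_hasDerivAt (absc_acoef_lt χ hs)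
  have h2 := DirichletCharacter.LSeries_twist_vonMangoldt_eq χ hs
  have h3 : LSeries (LSeries.logMul (acoef χ)) s = LSeries (fun n => χ n * (ArithmeticFunction.vonMangoldt n : ℂ)) s := by
    refine LSeries_congr ?_ s
    intro n hn
    rw [LSeries.logMul, acoef, lam]
    rcases eq_or_ne n 1 with rfl | h1
    · simp
    · have : Real.log n ≠ 0 := by
        apply Real.log_ne_zero_of_pos_of_ne_one
        · positivity
        · exact_mod_cast h1
      have h5 : Complex.log n = ((Real.log n : ℝ) : ℂ) := by simp [Complex.ofReal_log]
      have h6 : ((Real.log n : ℝ):ℂ) ≠ 0 := by exact_mod_cast this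
      rw [h5]; push_cast at h6 ⊢; field_simp
  rw [h3] at h
  have h7 : LSeries (fun n => χ n * (ArithmeticFunction.vonMangoldt n : ℂ)) s = - deriv (LSeries (fun n => χ n)) s / LSeries (fun n => χ n) s := h2
  rw [h7] at h
  rw [DirichletCharacter.deriv_LFunction_eq_deriv_LSeries χ hs, DirichletCharacter.LFunction_eq_LSeries χ hs]
  convert h using 1
  ring

/-- A holomorphic branch of `log L`. -/
theorem exists_logL {q : ℕ} [NeZero q] {χ : DirichletCharacter ℂ q} (hχ : χ ≠ 1)
    (hRH : dirichletRH χ) : ∃ f : ℂ → ℂ, DifferentiableOn ℂ f {s : ℂ | 1/2 < s.re} ∧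
      (∀ s : ℂ, 1/2 < s.re → Complex.exp (f s) = DirichletCharacter.LFunction χ s) ∧
      ∀ s : ℂ, 1 < s.re → f s = LSeries (acoef χ) s := by
  have hdiffL := DirichletCharacter.differentiable_LFunction hχ
  have hopen : IsOpen {s : ℂ | 1/2 < s.re} := isOpen_lt continuous_const Complex.continuous_re
  obtain ⟨f0, hf0c, hf0⟩ := Complex.exists_continuousOn_eqOn_exp_comp isSimplyConnected_halfplane hopen
    (g := DirichletCharacter.LFunction χ) hdiffL.continuous.continuousOn (by
      rintro ⟨s, hs, h0⟩
      exact LFunction_ne_zero_of_RH hχ hRH hs h0)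
  have hexp : ∀ s : ℂ, 1/2 < s.re → Complex.exp (f0 s) = DirichletCharacter.LFunction χ s := fun s hs => hf0 hs
  have hder : ∀ s : ℂ, 1/2 < s.re → HasDerivAt f0
      (deriv (DirichletCharacter.LFunction χ) s / DirichletCharacter.LFunction χ s) s := by
    intro s hs
    have hca : ContinuousAt f0 s := hf0c.continuousAt (hopen.mem_nhds hs)
    have hL : HasDerivAt (DirichletCharacter.LFunction χ) (deriv (DirichletCharacter.LFunction χ) s) s :=
      (hdiffL s).hasDerivAt
    rw [← hexp s hs]
    -- local expression through log
    have hne : DirichletCharacter.LFunction χ s ≠ 0 := LFunction_ne_zero_of_RH hχ hRH hs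
    have hev : (fun z => f0 s + Complex.log (DirichletCharacter.LFunction χ z / DirichletCharacter.LFunction χ s)) =ᶠ[nhds s] f0 := by
      have h1 : ∀ᶠ z in nhds s, ‖f0 z - f0 s‖ < Real.pi := by
        have : Filter.Tendsto (fun z => ‖f0 z - f0 s‖) (nhds s) (nhds 0) := by
          have h : ContinuousAt (fun z => ‖f0 z - f0 s‖) s := (hca.sub continuousAt_const).norm
          simpa [ContinuousAt] using h
        exact this.eventually (gt_mem_nhds Real.pi_pos)
      filter_upwards [h1, hopen.mem_nhds hs] with z hz hz2
      rw [← hexp z hz2, ← hexp s hs, ← Complex.exp_sub, Complex.log_exp]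
      · ring
      · have := Complex.abs_im_le_norm (f0 z - f0 s)
        have := neg_abs_le (f0 z - f0 s).im
        linarith
      · have := Complex.abs_im_le_norm (f0 z - f0 s)
        have := le_abs_self (f0 z - f0 s).im
        linarith
    refine HasDerivAt.congr_of_eventuallyEq ?_ hev.symm
    have h2 : HasDerivAt (fun z => DirichletCharacter.LFunction χ z / DirichletCharacter.LFunction χ s)
        (deriv (DirichletCharacter.LFunction χ) s / DirichletCharacter.LFunction χ s) s := hL.div_const _
    have h3 := (h2.clog (by simp [div_self hne])).const_add (f0 s)
    convert h3 using 1
    rw [div_self hne, div_one, hexp s hs]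
  -- the constant
  set c : ℂ := f0 2 - LSeries (acoef χ) 2 with hc
  have hconst : ∀ s : ℂ, 1 < s.re → f0 s - LSeries (acoef χ) s = c := by
    have hcv : Convex ℝ {s : ℂ | 1 < s.re} := convex_halfSpace_re_gt _
    have ho : IsOpen {s : ℂ | 1 < s.re} := isOpen_lt continuous_const Complex.continuous_re
    intro s hs
    refine ho.is_const_of_deriv_eq_zero (𝕜 := ℂ) (f := fun s => f0 s - LSeries (acoef χ) s) hcv.isPreconnected ?_ ?_ hs (by show (1:ℝ) < (2:ℂ).re; norm_num)
    · intro z hz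
      replace hz : 1 < z.re := hz
      exact ((hder z (by linarith)).sub (hasDerivAt_acoef χ hz)).differentiableAt.differentiableWithinAt
    · intro z hz
      replace hz : 1 < z.re := hz
      have := ((hder z (by linarith)).sub (hasDerivAt_acoef χ hz)).deriv
      rw [sub_self] at this
      exact this
  have hec : Complex.exp c = 1 := by
    have h1 : Filter.Tendsto (fun x : ℝ => LSeries (acoef χ) x) Filter.atTop (nhds (acoef χ 1)) :=
      LSeries.tendsto_atTop (lt_of_le_of_lt (absc_acoef χ) (by exact_mod_cast EReal.coe_lt_top 1))
    have h2 : Filter.Tendsto (fun x : ℝ => LSeries (fun n => χ n) x) Filter.atTop (nhds (χ ((1:ℕ) : ZMod q))) :=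
      LSeries.tendsto_atTop (f := fun n => χ n) (by
        rw [DirichletCharacter.absicssaOfAbsConv_eq_one (NeZero.ne q)]
        exact_mod_cast EReal.coe_lt_top 1)
    have h3 : acoef χ 1 = 0 := by simp [acoef, lam]
    rw [h3] at h1
    have h4 : Filter.Tendsto (fun x : ℝ => Complex.exp (LSeries (acoef χ) x + c)) Filter.atTop (nhds (Complex.exp (0 + c))) :=
      (Complex.continuous_exp.tendsto _).comp (h1.add_const c)
    have h5 : (fun x : ℝ => Complex.exp (LSeries (acoef χ) x + c)) =ᶠ[Filter.atTop] fun x : ℝ => LSeries (fun n => χ n) x := by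
      filter_upwards [Filter.eventually_gt_atTop (1:ℝ)] with x hx
      have hx' : 1 < (x:ℂ).re := by simpa using hx
      rw [← hconst x hx', ← DirichletCharacter.LFunction_eq_LSeries χ hx', ← hexp x (by linarith)]
      congr 1; ring
    have := tendsto_nhds_unique (h4.congr' h5) h2
    simpa using this
  refine ⟨fun s => f0 s - c, ?_, ?_, ?_⟩
  · intro s hs
    exact ((hder s hs).sub_const c).differentiableAt.differentiableWithinAt
  · intro s hs
    simp only
    rw [Complex.exp_sub, hec, div_one, hexp s hs]
  · intro s hs
    simp only
    rw [← hconst s hs]; ring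

lemma norm_LSeries_acoef_le {q : ℕ} [NeZero q] (χ : DirichletCharacter ℂ q) {s : ℂ} (hs : s.re = 2) :
    ‖LSeries (acoef χ) s‖ ≤ 2 := by
  have hsum : LSeriesSummable (acoef χ) s := LSeriesSummable_of_abscissaOfAbsConv_lt_re (absc_acoef_lt χ (by rw [hs]; norm_num))
  refine (norm_tsum_le_tsum_norm hsum.norm).trans ?_
  have hz := hasSum_zeta_two
  refine (hsum.norm.tsum_le_tsum (g := fun n : ℕ => (1:ℝ) / (n:ℝ)^2) ?_ hz.summable).trans ?_
  · intro n
    rw [LSeries.norm_term_eq, hs]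
    split_ifs with h
    · positivity
    · have := norm_acoef_le χ n
      rw [show ((n:ℝ) ^ (2:ℝ)) = (n:ℝ)^2 by norm_cast]
      gcongr
  · rw [hz.tsum_eq]
    have := Real.pi_lt_d2
    have := Real.pi_gt_three
    nlinarith

/-- growth of the branch of `log L` in strips -/
lemma logL_growth {q : ℕ} [NeZero q] {χ : DirichletCharacter ℂ q} (hχ : χ ≠ 1) {f : ℂ → ℂ}
    (hd : DifferentiableOn ℂ f {s : ℂ | 1/2 < s.re})
    (he : ∀ s : ℂ, 1/2 < s.re → Complex.exp (f s) = DirichletCharacter.LFunction χ s)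
    (hl : ∀ s : ℂ, 1 < s.re → f s = LSeries (acoef χ) s) {δ : ℝ} (hδ : 0 < δ) :
    ∃ K : ℝ, 0 < K ∧ ∀ s : ℂ, 1/2 + δ ≤ s.re → s.re ≤ 2 → ‖f s‖ ≤ K * (1 + |s.im|) := by
  have hq : (1:ℝ) ≤ q := by exact_mod_cast NeZero.pos q
  refine ⟨(3 * (2 * (q+1)) * 4 + 6) / δ, by positivity, ?_⟩
  intro s hs1 hs2
  set M : ℝ := 2 * (q+1) * (4 + |s.im|) with hM
  have hMpos : 0 < M := by positivity
  set c : ℂ := 2 + s.im * I with hc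
  have hcre : c.re = 2 := by simp [hc]
  have hcim : c.im = s.im := by simp [hc]
  have hball : ∀ z ∈ Metric.ball (0:ℂ) (3/2), 1/2 < (c + z).re := by
    intro z hz
    have h1 := Complex.abs_re_le_norm z
    have h2 := neg_abs_le z.re
    have h3 : ‖z‖ < 3/2 := by simpa using hz
    rw [Complex.add_re, hcre]; linarith
  have hsc : s - c = ((s.re - 2 : ℝ) : ℂ) := by
    apply Complex.ext <;> simp [hc]
  have hnorm : ‖s - c‖ = 2 - s.re := by
    rw [hsc, Complex.norm_real, Real.norm_eq_abs, abs_of_nonpos (by linarith)]; ring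
  have := Complex.borelCaratheodory (f := fun z => f (c + z)) (R := 3/2) (M := M) (z := s - c) hMpos ?_ ?_ (by norm_num) ?_
  · simp only [add_zero, add_sub_cancel] at this
    rw [hl c (by rw [hcre]; norm_num), hnorm] at this
    refine this.trans ?_
    have h2 := norm_LSeries_acoef_le χ hcre
    have h3 : δ ≤ 3/2 - (2 - s.re) := by linarith
    have h4 : 2 - s.re ≤ 3/2 := by linarith
    have h5 : 0 ≤ 2 - s.re := by linarith
    have e1 : 2 * M * (2 - s.re) / (3/2 - (2 - s.re)) ≤ 2 * M * (3/2) / δ := by gcongr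
    have e2 : ‖LSeries (acoef χ) c‖ * (3/2 + (2 - s.re)) / (3/2 - (2 - s.re)) ≤ 2 * (3/2 + 3/2) / δ := by gcongr
    refine (add_le_add e1 e2).trans ?_
    rw [← add_div, div_mul_eq_mul_div]
    gcongr
    rw [hM]
    have : 0 ≤ |s.im| := abs_nonneg _
    nlinarith
  · refine hd.comp (by fun_prop) hball
  · intro z hz
    show (f (c+z)).re ≤ M
    have h1 : ‖DirichletCharacter.LFunction χ (c+z)‖ = Real.exp (f (c+z)).re := by
      rw [← he _ (hball z hz), Complex.norm_exp]
    have h2 := norm_LFunction_le hχ (s := c + z) (by have := hball z hz; linarith)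
    have h3 := Real.add_one_le_exp (f (c+z)).re
    have h4 : ‖c + z‖ ≤ 4 + |s.im| := by
      refine (norm_add_le _ _).trans ?_
      have h3 : ‖z‖ < 3/2 := by simpa using hz
      have : ‖c‖ ≤ 2 + |s.im| := by
        rw [hc]; refine (norm_add_le _ _).trans ?_
        simp
      linarith
    have h5 : ((q:ℝ) + 1) / (c+z).re ≤ 2 * (q+1) := by
      rw [div_le_iff₀ (by have := hball z hz; linarith)]
      have := hball z hz
      nlinarith
    have h6 : ‖c+z‖ * ((q+1) / (c+z).re) ≤ (4 + |s.im|) * (2 * (q+1)) := by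
      have h7 : 0 ≤ ((q:ℝ) + 1) / (c+z).re := div_nonneg (by positivity) (by have := hball z hz; linarith)
      gcongr
    rw [hM]
    nlinarith
  · simp only [Metric.mem_ball, dist_zero_right]; rw [hnorm]; linarith

end S18


namespace S18

lemma gamma_factor_bound {x h y u : ℝ} (hx : 0 < x) (hh : 0 < h) (hu : 0 ≤ u) :
    ‖((x : ℂ) - h + y * I + u)‖ ≤ ‖((x:ℂ) + h + y * I + u)‖ *
      Real.exp (-(2 * h * ((x + u) / ((x + u + h)^2 + y^2)))) := by
  have hn1 : ‖((x : ℂ) - h + y * I + u)‖ ^ 2 = (x + u - h)^2 + y^2 := by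
    rw [← Complex.normSq_eq_norm_sq, Complex.normSq_apply]; simp; ring
  have hn2 : ‖((x : ℂ) + h + y * I + u)‖ ^ 2 = (x + u + h)^2 + y^2 := by
    rw [← Complex.normSq_eq_norm_sq, Complex.normSq_apply]; simp; ring
  have hpos : 0 < (x + u + h)^2 + y^2 := by positivity
  refine le_of_sq_le_sq ?_ (by positivity)
  rw [mul_pow, hn1, hn2, ← Real.exp_nat_mul]
  have := Real.add_one_le_exp (((2:ℕ):ℝ) * -(2 * h * ((x + u) / ((x + u + h)^2 + y^2))))
  calc (x + u - h)^2 + y^2 = ((x + u + h)^2 + y^2) * (((2:ℕ):ℝ) * -(2 * h * ((x + u) / ((x + u + h)^2 + y^2))) + 1) := by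
        field_simp; push_cast; ring
    _ ≤ _ := by gcongr

lemma gamma_term_lower {x h y u : ℝ} (hx : 0 < x) (hh : 0 < h) (hu : h + |y| ≤ u) :
    1 / (u + (x + 3 * h + |y|)) ≤ (x + u) / ((x + u + h)^2 + y^2) := by
  have hy := abs_nonneg y
  have hu0 : 0 < u := by linarith
  have hpos : 0 < (x + u + h)^2 + y^2 := by positivity
  rw [div_le_div_iff₀ (by positivity) hpos]
  have h1 : y^2 = |y|^2 := (sq_abs y).symm
  have h2 : h^2 + |y|^2 ≤ (x+u) * (h + |y|) := by nlinarith
  rw [h1]; nlinarith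

lemma gamma_sum_lower {x h y : ℝ} (hx : 0 < x) (hh : 0 < h) (n : ℕ) (hn : 1 ≤ n) :
    Real.log n - Real.log (x + 4 * h + 2 * |y| + 1) ≤
      ∑ j ∈ Finset.range (n+1), (x + j) / ((x + j + h)^2 + y^2) := by
  have hy := abs_nonneg y
  set j0 : ℕ := ⌈h + |y|⌉₊ with hj0
  set B : ℝ := x + 3 * h + |y| with hB
  have hBpos : 0 < B := by positivity
  set G : ℕ → ℝ := fun j => Real.log (((max j j0 : ℕ) : ℝ) + B) with hG
  have h1 : ∑ j ∈ Finset.range (n+1), (G (j+1) - G j) = G (n+1) - G 0 := Finset.sum_range_sub G (n+1)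
  have h2 : ∀ j ∈ Finset.range (n+1), G (j+1) - G j ≤ (x + j) / ((x + j + h)^2 + y^2) := by
    intro j _
    by_cases hj : j < j0
    · have : G (j+1) - G j = 0 := by
        simp only [hG]
        rw [max_eq_right (by omega), max_eq_right (by omega), sub_self]
      rw [this]; positivity
    · have hjj : j0 ≤ j := not_lt.1 hj
      have hjr : h + |y| ≤ j := (Nat.le_ceil _).trans (by exact_mod_cast hjj)
      refine le_trans ?_ (gamma_term_lower hx hh hjr)
      simp only [hG]
      rw [max_eq_left (by omega), max_eq_left hjj, ← Real.log_div (by positivity) (by positivity)]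
      refine (Real.log_le_sub_one_of_pos (by positivity)).trans (le_of_eq ?_)
      push_cast; field_simp; ring
  have h3 := Finset.sum_le_sum h2
  rw [h1] at h3
  refine le_trans ?_ h3
  have h4 : Real.log n ≤ G (n+1) := by
    apply Real.log_le_log (by positivity)
    have : (n:ℝ) ≤ ((max (n+1) j0 : ℕ):ℝ) := by exact_mod_cast (by omega)
    linarith
  have h5 : G 0 ≤ Real.log (x + 4 * h + 2 * |y| + 1) := by
    apply Real.log_le_log (by positivity)
    have : ((max 0 j0 : ℕ):ℝ) ≤ h + |y| + 1 := by
      rw [Nat.zero_max]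
      exact (Nat.ceil_lt_add_one (by positivity)).le
    rw [hB]; linarith
  linarith

/-- a clean upper bound for quotients of Gamma values -/
lemma gamma_ratio {x h y : ℝ} (hx : 0 < x) (hh : 0 < h)
    (h0 : Complex.Gamma ((x:ℂ) - h + y * I) ≠ 0) :
    ‖Complex.Gamma ((x:ℂ) + h + y * I)‖ ≤
      Real.exp (2 * h * Real.log (x + 4 * h + 2 * |y| + 1)) * ‖Complex.Gamma ((x:ℂ) - h + y * I)‖ := by
  have hne : ∀ j : ℕ, (x:ℂ) - h + y * I + j ≠ 0 := by
    intro j hj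
    apply h0
    rw [Complex.Gamma_eq_zero_iff]
    exact ⟨j, by linear_combination hj⟩
  have t1 := (Complex.GammaSeq_tendsto_Gamma ((x:ℂ) + h + y * I)).norm
  have t2 := ((Complex.GammaSeq_tendsto_Gamma ((x:ℂ) - h + y * I)).norm).const_mul
    (Real.exp (2 * h * Real.log (x + 4 * h + 2 * |y| + 1)))
  refine le_of_tendsto_of_tendsto t1 t2 ?_
  filter_upwards [Filter.eventually_ge_atTop 1] with n hn
  rw [Complex.GammaSeq, Complex.GammaSeq]
  simp only [norm_div, norm_mul, norm_prod]
  have hnpos : (0:ℝ) < n := by positivity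
  rw [Complex.norm_natCast_cpow_of_pos hn, Complex.norm_natCast_cpow_of_pos hn]
  have e1 : ((x:ℂ) + h + y * I).re = x + h := by simp
  have e2 : ((x:ℂ) - h + y * I).re = x - h := by simp
  rw [e1, e2]
  set P1 := ∏ j ∈ Finset.range (n+1), ‖(x:ℂ) + h + y * I + j‖ with hP1
  set P2 := ∏ j ∈ Finset.range (n+1), ‖(x:ℂ) - h + y * I + j‖ with hP2
  have hP2pos : 0 < P2 := Finset.prod_pos fun j _ => norm_pos_iff.2 (hne j)
  have hle : P2 ≤ P1 * Real.exp (-(2 * h * (Real.log n - Real.log (x + 4 * h + 2 * |y| + 1)))) := by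
    have h1 : P2 ≤ ∏ j ∈ Finset.range (n+1), (‖(x:ℂ) + h + y * I + j‖ *
      Real.exp (-(2 * h * ((x + j) / ((x + j + h)^2 + y^2))))) := by
      refine Finset.prod_le_prod (fun j _ => norm_nonneg _) fun j _ => ?_
      have := gamma_factor_bound (x := x) (h := h) (y := y) (u := j) hx hh (by positivity)
      simpa using this
    rw [Finset.prod_mul_distrib, ← Real.exp_sum, Finset.sum_neg_distrib, ← Finset.mul_sum] at h1
    refine h1.trans ?_
    have hP1n : 0 ≤ P1 := Finset.prod_nonneg fun j _ => norm_nonneg _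
    have := gamma_sum_lower (y := y) hx hh n hn
    gcongr
  have hP1pos : 0 < P1 := by
    by_contra hcon
    have : P1 * Real.exp (-(2 * h * (Real.log n - Real.log (x + 4 * h + 2 * |y| + 1)))) ≤ 0 :=
      mul_nonpos_of_nonpos_of_nonneg (not_lt.1 hcon) (Real.exp_nonneg _)
    linarith
  have e3 : (n:ℝ) ^ (x + h) = (n:ℝ) ^ (x - h) * Real.exp (2 * h * Real.log n) := by
    rw [Real.rpow_def_of_pos hnpos, Real.rpow_def_of_pos hnpos, ← Real.exp_add]; ring_nf
  rw [e3, ← mul_div_assoc, div_le_div_iff₀ hP1pos hP2pos]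
  set F := ‖((n.factorial : ℕ) : ℂ)‖
  have hF : 0 ≤ F := norm_nonneg _
  have hnp : 0 ≤ (n:ℝ) ^ (x - h) := by positivity
  calc (n:ℝ) ^ (x - h) * Real.exp (2 * h * Real.log n) * F * P2
      ≤ (n:ℝ) ^ (x - h) * Real.exp (2 * h * Real.log n) * F * (P1 * Real.exp (-(2 * h * (Real.log n - Real.log (x + 4 * h + 2 * |y| + 1))))) := by gcongr
    _ = (n:ℝ) ^ (x - h) * F * P1 * (Real.exp (2 * h * Real.log n) * Real.exp (-(2 * h * (Real.log n - Real.log (x + 4 * h + 2 * |y| + 1))))) := by ring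
    _ = _ := by rw [← Real.exp_add]; ring_nf

lemma LSeries_conj {q : ℕ} [NeZero q] (χ : DirichletCharacter ℂ q) (s : ℂ) :
    LSeries (fun n => χ⁻¹ (n : ZMod q)) s = (starRingEnd ℂ) (LSeries (fun n => χ (n : ZMod q)) ((starRingEnd ℂ) s)) := by
  rw [LSeries, LSeries, Complex.conj_tsum]
  refine tsum_congr fun n => ?_
  rw [LSeries.term_def, LSeries.term_def]
  split_ifs with h
  · simp
  · rw [map_div₀, ← MulChar.star_apply']
    congr 1
    have h9 := Complex.cpow_conj (n:ℂ) s (by rw [Complex.natCast_arg]; exact Real.pi_pos.ne)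
    rw [h9]; simp

lemma LFunction_conj {q : ℕ} [NeZero q] {χ : DirichletCharacter ℂ q} (hχ : χ ≠ 1) (s : ℂ) :
    DirichletCharacter.LFunction χ⁻¹ s = (starRingEnd ℂ) (DirichletCharacter.LFunction χ ((starRingEnd ℂ) s)) := by
  have hχ' : χ⁻¹ ≠ 1 := inv_ne_one.2 hχ
  have hd1 := DirichletCharacter.differentiable_LFunction hχ'
  have hd2 : Differentiable ℂ (fun s => (starRingEnd ℂ) (DirichletCharacter.LFunction χ ((starRingEnd ℂ) s))) := by
    intro z
    have h9 := (DirichletCharacter.differentiable_LFunction hχ ((starRingEnd ℂ) z)).conj_conj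
    rw [Complex.conj_conj] at h9
    exact h9
  have h1 : AnalyticOnNhd ℂ (DirichletCharacter.LFunction χ⁻¹) Set.univ := fun z _ => hd1.analyticAt z
  have h2 : AnalyticOnNhd ℂ (fun s => (starRingEnd ℂ) (DirichletCharacter.LFunction χ ((starRingEnd ℂ) s))) Set.univ :=
    fun z _ => hd2.analyticAt z
  have := AnalyticOnNhd.eqOn_of_preconnected_of_eventuallyEq (𝕜 := ℂ) h1 h2 isPreconnected_univ (z₀ := 2) (Set.mem_univ _) ?_
  · exact this (Set.mem_univ s)
  · have ho : IsOpen {s : ℂ | 1 < s.re} := isOpen_lt continuous_const Complex.continuous_re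
    filter_upwards [ho.mem_nhds (by show (1:ℝ) < (2:ℂ).re; norm_num)] with z hz
    replace hz : 1 < z.re := hz
    rw [DirichletCharacter.LFunction_eq_LSeries _ hz, DirichletCharacter.LFunction_eq_LSeries _ (by simpa using hz)]
    exact LSeries_conj χ z

lemma norm_LFunction_inv_conj {q : ℕ} [NeZero q] {χ : DirichletCharacter ℂ q} (hχ : χ ≠ 1) (s : ℂ) :
    ‖DirichletCharacter.LFunction χ⁻¹ ((starRingEnd ℂ) s)‖ = ‖DirichletCharacter.LFunction χ s‖ := by
  rw [LFunction_conj hχ]; simp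

lemma gammaFactor_inv {q : ℕ} (χ : DirichletCharacter ℂ q) (s : ℂ) :
    DirichletCharacter.gammaFactor χ⁻¹ s = DirichletCharacter.gammaFactor χ s := by
  have : χ⁻¹.Even ↔ χ.Even := by
    simp [DirichletCharacter.Even, MulChar.inv_apply_eq_inv']
  unfold DirichletCharacter.gammaFactor
  by_cases h : χ.Even
  · rw [if_pos h, if_pos (this.2 h)]
  · rw [if_neg h, if_neg (fun h' => h (this.1 h'))]

lemma norm_Gammaℝ_conj (s : ℂ) : ‖Complex.Gammaℝ ((starRingEnd ℂ) s)‖ = ‖Complex.Gammaℝ s‖ := by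
  rw [Complex.Gammaℝ_def, Complex.Gammaℝ_def, norm_mul, norm_mul]
  have hpi : ((Real.pi : ℝ):ℂ) = (Real.pi : ℂ) := rfl
  rw [Complex.norm_cpow_eq_rpow_re_of_pos Real.pi_pos, Complex.norm_cpow_eq_rpow_re_of_pos Real.pi_pos]
  have h1 : (starRingEnd ℂ) s / 2 = (starRingEnd ℂ) (s / 2) := by rw [map_div₀, map_ofNat]
  rw [h1, Complex.Gamma_conj, Complex.norm_conj]
  simp

lemma norm_gammaFactor_conj {q : ℕ} (χ : DirichletCharacter ℂ q) (s : ℂ) :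
    ‖DirichletCharacter.gammaFactor χ ((starRingEnd ℂ) s)‖ = ‖DirichletCharacter.gammaFactor χ s‖ := by
  unfold DirichletCharacter.gammaFactor
  split_ifs
  · exact norm_Gammaℝ_conj s
  · rw [← norm_Gammaℝ_conj (s+1)]; simp

lemma gammaFactor_ne_zero {q : ℕ} (χ : DirichletCharacter ℂ q) {s : ℂ} (hs : 0 < s.re) :
    DirichletCharacter.gammaFactor χ s ≠ 0 := by
  unfold DirichletCharacter.gammaFactor
  split_ifs
  · exact Complex.Gammaℝ_ne_zero_of_re_pos hs
  · exact Complex.Gammaℝ_ne_zero_of_re_pos (by simp; linarith)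

lemma completed_eq {q : ℕ} [NeZero q] (χ : DirichletCharacter ℂ q) {s : ℂ} (hs : 0 < s.re) :
    DirichletCharacter.completedLFunction χ s = DirichletCharacter.LFunction χ s * DirichletCharacter.gammaFactor χ s := by
  have hs0 : s ≠ 0 := by rintro rfl; simp at hs
  rw [DirichletCharacter.LFunction_eq_completed_div_gammaFactor χ s (Or.inl hs0),
    div_mul_cancel₀ _ (gammaFactor_ne_zero χ hs)]

lemma norm_completed_inv_conj {q : ℕ} [NeZero q] {χ : DirichletCharacter ℂ q} (hχ : χ ≠ 1) {s : ℂ} (hs : 0 < s.re) :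
    ‖DirichletCharacter.completedLFunction χ⁻¹ ((starRingEnd ℂ) s)‖ = ‖DirichletCharacter.completedLFunction χ s‖ := by
  rw [completed_eq χ hs, completed_eq χ⁻¹ (by simpa using hs), norm_mul, norm_mul,
    norm_LFunction_inv_conj hχ, gammaFactor_inv, norm_gammaFactor_conj]

lemma isPrimitive_inv {q : ℕ} {χ : DirichletCharacter ℂ q} (h : χ.IsPrimitive) : χ⁻¹.IsPrimitive := by
  rw [DirichletCharacter.isPrimitive_def] at h ⊢
  have h1 : ∀ χ : DirichletCharacter ℂ q, χ⁻¹.conductorSet ⊆ χ.conductorSet := by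
    intro χ d hd
    rw [DirichletCharacter.mem_conductorSet_iff] at hd ⊢
    obtain ⟨hd1, χ0, h0⟩ := hd
    refine ⟨hd1, χ0⁻¹, ?_⟩
    rw [← inv_inv χ, h0, map_inv]
  refine Eq.trans ?_ h
  rw [DirichletCharacter.conductor, DirichletCharacter.conductor]
  congr 1
  exact Set.Subset.antisymm (h1 χ) (by simpa using h1 χ⁻¹)

lemma norm_natCast_cpow_sub {q : ℕ} [NeZero q] (s : ℂ) : ‖(q:ℂ) ^ (s - 1/2)‖ = (q:ℝ) ^ (s.re - 1/2) := by
  rw [Complex.norm_natCast_cpow_of_pos (NeZero.pos q)]; simp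

lemma norm_rootNumber {q : ℕ} [NeZero q] {χ : DirichletCharacter ℂ q} (hχ : χ ≠ 1) (hp : χ.IsPrimitive)
    (hRH : dirichletRH χ) : ‖DirichletCharacter.rootNumber χ‖ = 1 := by
  have hp' := isPrimitive_inv hp
  have hχ' : χ⁻¹ ≠ 1 := inv_ne_one.2 hχ
  have hq : (0:ℝ) < q := by exact_mod_cast NeZero.pos q
  set s : ℂ := ((3/4 : ℝ) : ℂ) with hs
  have hsre : s.re = 3/4 := by simp [hs]
  have hsc : (starRingEnd ℂ) s = s := by rw [hs, Complex.conj_ofReal]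
  have h1s : (starRingEnd ℂ) (1 - s) = 1 - s := by rw [map_sub, hsc]; simp
  have h1sre : (1 - s).re = 1/4 := by simp [hs]; norm_num
  have hne : DirichletCharacter.completedLFunction χ s ≠ 0 := by
    rw [completed_eq χ (by rw [hsre]; norm_num)]
    exact mul_ne_zero (LFunction_ne_zero_of_RH hχ hRH (by rw [hsre]; norm_num)) (gammaFactor_ne_zero χ (by rw [hsre]; norm_num))
  have f1 := hp.completedLFunction_one_sub s
  have f2 := hp.completedLFunction_one_sub (1 - s)
  have n1 := congrArg norm f1
  have n2 := congrArg norm f2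
  rw [norm_mul, norm_mul, norm_natCast_cpow_sub] at n1 n2
  have c1 : ‖DirichletCharacter.completedLFunction χ⁻¹ s‖ = ‖DirichletCharacter.completedLFunction χ s‖ := by
    have := norm_completed_inv_conj hχ (s := s) (by rw [hsre]; norm_num)
    rwa [hsc] at this
  have c2 : ‖DirichletCharacter.completedLFunction χ⁻¹ (1-s)‖ = ‖DirichletCharacter.completedLFunction χ (1-s)‖ := by
    have := norm_completed_inv_conj hχ (s := 1-s) (by rw [h1sre]; norm_num)
    rwa [h1s] at this
  rw [c1, hsre] at n1
  rw [c2, h1sre, sub_sub_cancel, n1] at n2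
  have e : (q:ℝ) ^ ((1:ℝ)/4 - 1/2) * (q:ℝ) ^ ((3:ℝ)/4 - 1/2) = 1 := by
    rw [← Real.rpow_add hq]; norm_num
  set a := ‖DirichletCharacter.completedLFunction χ s‖
  have ha : a ≠ 0 := norm_ne_zero_iff.2 hne
  set e0 := ‖DirichletCharacter.rootNumber χ‖
  have he0 : 0 ≤ e0 := norm_nonneg _
  have h3 : a * 1 = a * (e0 * e0) := by
    calc a * 1 = _ := by rw [mul_one]
      _ = _ := n2
      _ = ((q:ℝ) ^ ((1:ℝ)/4 - 1/2) * (q:ℝ) ^ ((3:ℝ)/4 - 1/2)) * (a * (e0*e0)) := by ring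
      _ = _ := by rw [e, one_mul]
  have h4 := mul_left_cancel₀ ha h3
  nlinarith

/-- The functional equation as an inequality. -/
theorem FE_ineq {q : ℕ} [NeZero q] {χ : DirichletCharacter ℂ q} (hχ : χ ≠ 1) (hp : χ.IsPrimitive)
    (hRH : dirichletRH χ) {h : ℝ} (hh : 0 < h) (y : ℝ) :
    ‖DirichletCharacter.LFunction χ (1/2 - h + y * I)‖ ≤
      Real.exp (h * (Real.log q + Real.log (2 + 2 * h + |y|))) * ‖DirichletCharacter.LFunction χ (1/2 + h + y * I)‖ := by
  have hq : (0:ℝ) < q := by exact_mod_cast NeZero.pos q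
  have hq1 : q ≠ 1 := by
    rintro rfl
    exact hχ (DirichletCharacter.level_one χ)
  set w : ℂ := 1/2 + h + y * I with hw
  set s : ℂ := (starRingEnd ℂ) w with hs
  have hwre : w.re = 1/2 + h := by simp [hw]
  have hsre : s.re = 1/2 + h := by rw [hs, Complex.conj_re, hwre]
  have e1 : (1/2 - h + y * I : ℂ) = 1 - s := by
    rw [hs, hw]
    apply Complex.ext
    · simp; ring
    · simp
  have e2 : DirichletCharacter.LFunction χ (1/2 - h + y * I) =
      DirichletCharacter.completedLFunction χ (1 - s) / DirichletCharacter.gammaFactor χ (1/2 - h + y * I) := by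
    rw [← e1]; exact DirichletCharacter.LFunction_eq_completed_div_gammaFactor χ _ (Or.inr hq1)
  rw [e2, hp.completedLFunction_one_sub s, norm_div, norm_mul, norm_mul, norm_natCast_cpow_sub,
    norm_rootNumber hχ hp hRH, hs, norm_completed_inv_conj hχ (by rw [hwre]; linarith), ← hs, hsre, mul_one,
    completed_eq χ (by rw [hwre]; linarith), norm_mul]
  have e3 : (q:ℝ) ^ (1/2 + h - 1/2) = Real.exp (h * Real.log q) := by
    rw [Real.rpow_def_of_pos hq]; ring_nf
  rw [e3]
  by_cases h0 : DirichletCharacter.gammaFactor χ (1/2 - h + y * I) = 0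
  · rw [h0]; simp; positivity
  have key : ‖DirichletCharacter.gammaFactor χ w‖ ≤ Real.exp (h * Real.log (2 + 2 * h + |y|)) *
      ‖DirichletCharacter.gammaFactor χ (1/2 - h + y * I)‖ := by
    have gen : ∀ x : ℝ, 0 < x → x ≤ 3/4 → ∀ z1 z2 : ℂ, z1 = 2 * ((x:ℂ) + (h/2 : ℝ) + ((y/2 : ℝ)) * I) →
        z2 = 2 * ((x:ℂ) - (h/2 : ℝ) + ((y/2 : ℝ)) * I) → Complex.Gammaℝ z2 ≠ 0 →
        ‖Complex.Gammaℝ z1‖ ≤ Real.exp (h * Real.log (2 + 2 * h + |y|)) * ‖Complex.Gammaℝ z2‖ := by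
      intro x hx hx2 z1 z2 h1 h2 hne
      rw [Complex.Gammaℝ_def] at hne ⊢
      rw [Complex.Gammaℝ_def, norm_mul, norm_mul, Complex.norm_cpow_eq_rpow_re_of_pos Real.pi_pos, Complex.norm_cpow_eq_rpow_re_of_pos Real.pi_pos]
      have d1 : z1 / 2 = ((x:ℂ) + (h/2 : ℝ) + ((y/2 : ℝ)) * I) := by rw [h1]; ring
      have d2 : z2 / 2 = ((x:ℂ) - (h/2 : ℝ) + ((y/2 : ℝ)) * I) := by rw [h2]; ring
      have r1 : (-z1 / 2).re = -(x + h/2) := by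
        rw [neg_div, d1]; simp
      have r2 : (-z2 / 2).re = -(x - h/2) := by
        rw [neg_div, d2]; simp
      rw [r1, r2, d1, d2]
      have hG := gamma_ratio (x := x) (h := h/2) (y := y/2) hx (by positivity) (by
        rw [← d2]; exact right_ne_zero_of_mul hne)
      have hpi1 : (Real.pi:ℝ) ^ (-(x + h/2)) ≤ Real.pi ^ (-(x - h/2)) :=
        Real.rpow_le_rpow_of_exponent_le (by have := Real.pi_gt_three; linarith) (by linarith)
      have hlog : Real.exp (2 * (h/2) * Real.log (x + 4 * (h/2) + 2 * |y/2| + 1)) ≤ Real.exp (h * Real.log (2 + 2 * h + |y|)) := by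
        apply Real.exp_le_exp.2
        rw [show 2 * (h/2) = h by ring]
        apply mul_le_mul_of_nonneg_left _ hh.le
        have hyy : |y/2| = |y|/2 := by rw [abs_div]; simp
        apply Real.log_le_log (by positivity)
        rw [hyy]; linarith
      calc _ ≤ Real.pi ^ (-(x - h/2)) * (Real.exp (h * Real.log (2 + 2 * h + |y|)) * ‖Complex.Gamma ((x:ℂ) - (h/2 : ℝ) + ((y/2 : ℝ)) * I)‖) := by
            refine mul_le_mul hpi1 (hG.trans ?_) (norm_nonneg _) (by positivity)
            exact mul_le_mul_of_nonneg_right hlog (norm_nonneg _)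
        _ = _ := by ring
    unfold DirichletCharacter.gammaFactor at h0 ⊢
    split_ifs at h0 ⊢ with hev
    · exact gen (1/4) (by norm_num) (by norm_num) _ _ (by rw [hw]; push_cast; ring) (by push_cast; ring) h0
    · exact gen (3/4) (by norm_num) (by norm_num) _ _ (by rw [hw]; push_cast; ring) (by push_cast; ring) h0
  rw [div_le_iff₀ (norm_pos_iff.2 h0), mul_add, Real.exp_add]
  calc _ ≤ Real.exp (h * Real.log q) * (‖DirichletCharacter.LFunction χ w‖ * (Real.exp (h * Real.log (2 + 2 * h + |y|)) *
      ‖DirichletCharacter.gammaFactor χ (1/2 - h + y * I)‖)) := by gcongr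
    _ = _ := by ring

end S18


namespace S18
open MeasureTheory FourierTransform Convolution

noncomputable def rho : ℝ := 1 / (4 * Real.pi)

lemma rho_pos : 0 < rho := by unfold rho; positivity

noncomputable def bR (z : ℂ) : ℝ := expNegInvGlue (rho ^ 2 - ‖z‖ ^ 2)

noncomputable def bb (z : ℂ) : ℂ := (bR z : ℂ)

lemma bR_contDiff : ContDiff ℝ ((⊤ : ℕ∞) : WithTop ℕ∞) bR := by
  unfold bR
  exact expNegInvGlue.contDiff.comp (contDiff_const.sub (contDiff_norm_sq ℝ (E := ℂ)))

lemma bR_nonneg (z : ℂ) : 0 ≤ bR z := expNegInvGlue.nonneg _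

lemma bR_zero {z : ℂ} (hz : rho ≤ ‖z‖) : bR z = 0 := by
  apply expNegInvGlue.zero_of_nonpos
  have := rho_pos
  nlinarith

lemma bR_pos : 0 < bR 0 := by
  apply expNegInvGlue.pos_of_pos
  have := rho_pos
  simp; positivity

lemma bb_contDiff : ContDiff ℝ ((⊤ : ℕ∞) : WithTop ℕ∞) bb := Complex.ofRealCLM.contDiff.comp bR_contDiff

lemma bb_cs : HasCompactSupport bb := by
  refine HasCompactSupport.of_support_subset_isCompact (isCompact_closedBall (0:ℂ) rho) ?_
  intro z hz
  by_contra h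
  apply hz
  simp only [Metric.mem_closedBall, dist_zero_right, not_le] at h
  simp [bb, bR_zero h.le]

noncomputable def bS : SchwartzMap ℂ ℂ := bb_cs.toSchwartzMap bb_contDiff

lemma bS_coe : (bS : ℂ → ℂ) = bb := rfl

noncomputable def Fb (w : ℂ) : ℂ := 𝓕 bb w

lemma Fb_eq : Fb = (𝓕 bS : SchwartzMap ℂ ℂ) := by
  ext w
  rw [SchwartzMap.fourier_coe]; rfl

lemma bb_int : Integrable bb := bb_contDiff.continuous.integrable_of_hasCompactSupport bb_cs

lemma bb_radial (A : ℂ ≃ₗᵢ[ℝ] ℂ) : bb ∘ A = bb := by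
  ext z; simp [bb, bR]

lemma Fb_radial (A : ℂ ≃ₗᵢ[ℝ] ℂ) (w : ℂ) : Fb (A w) = Fb w := by
  have := Real.fourier_comp_linearIsometry A bb w
  rw [bb_radial] at this
  exact this.symm

lemma Fb_norm (w : ℂ) : Fb w = Fb (‖w‖ : ℂ) := by
  by_cases hw : w = 0
  · simp [hw]
  have hn : ‖w‖ ≠ 0 := norm_ne_zero_iff.2 hw
  let c : Circle := ⟨w / ‖w‖, by
    rw [Submonoid.unitSphere, ]
    simp [hn]⟩
  have := Fb_radial (rotation c) (‖w‖ : ℂ)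
  rw [← this, rotation_apply]
  congr 1
  show w = w / ‖w‖ * ‖w‖
  have : (‖w‖:ℂ) ≠ 0 := by exact_mod_cast hn
  field_simp

lemma Fb_conj (w : ℂ) : (starRingEnd ℂ) (Fb w) = Fb w := by
  have h1 : (starRingEnd ℂ) (Fb w) = Fb (-w) := by
    unfold Fb
    rw [Real.fourier_eq', Real.fourier_eq', ← integral_conj]
    congr 1
    ext v
    simp only [smul_eq_mul, map_mul, ← Complex.exp_conj, inner_neg_right]
    congr 1
    · congr 1
      simp [map_ofNat]
      ring
    · simp [bb]
  rw [h1]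
  exact Fb_radial (LinearIsometryEquiv.neg ℝ) w

noncomputable def phi0 (w : ℂ) : ℝ := (Fb w).re ^ 2

noncomputable def GG : ℂ → ℂ := bb ⋆[ContinuousLinearMap.mul ℂ ℂ] bb

lemma phi0_eq (w : ℂ) : (phi0 w : ℂ) = 𝓕 GG w := by
  have h1 := Real.fourier_mul_convolution_eq bb_int bb_int w
  unfold GG
  rw [h1]
  have h2 : ((Fb w).re : ℂ) = Fb w := Complex.conj_eq_iff_re.1 (Fb_conj w)
  rw [phi0]
  push_cast
  rw [h2, sq]; rfl

lemma GG_cont : Continuous GG :=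
  bb_cs.continuous_convolution_right _ bb_int.locallyIntegrable bb_contDiff.continuous

lemma GG_zero {z : ℂ} (hz : 2 * rho ≤ ‖z‖) : GG z = 0 := by
  unfold GG
  rw [convolution_def]
  rw [← integral_zero ℂ ℂ]
  congr 1
  ext t
  simp only [ContinuousLinearMap.mul_apply']
  by_cases h : rho ≤ ‖t‖
  · simp [bb, bR_zero h]
  · have : rho ≤ ‖z - t‖ := by
      have := norm_sub_norm_le z t
      push Not at h
      linarith
    simp [bb, bR_zero this]

lemma GG_cs : HasCompactSupport GG := by
  refine HasCompactSupport.of_support_subset_isCompact (isCompact_closedBall (0:ℂ) (2 * rho)) ?_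
  intro z hz
  by_contra h
  apply hz
  simp only [Metric.mem_closedBall, dist_zero_right, not_le] at h
  exact GG_zero h.le

lemma phi0_cont : Continuous phi0 := by
  unfold phi0
  rw [Fb_eq]
  exact (Complex.continuous_re.comp (SchwartzMap.continuous _)).pow 2

lemma phi0_nonneg (z : ℂ) : 0 ≤ phi0 z := sq_nonneg _

lemma phi0_decay : ∃ C : ℝ, 0 < C ∧ ∀ z : ℂ, phi0 z ≤ C / (1 + ‖z‖) ^ 6 := by
  obtain ⟨C, hC0, hC⟩ := (𝓕 bS : SchwartzMap ℂ ℂ).decay 3 0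
  obtain ⟨D, hD0, hD⟩ := (𝓕 bS : SchwartzMap ℂ ℂ).decay 0 0
  refine ⟨(8 * (C + D)) ^ 2, by positivity, ?_⟩
  intro z
  have h1 := hC z
  have h2 := hD z
  rw [norm_iteratedFDeriv_zero, ← Fb_eq] at h1 h2
  rw [pow_zero, one_mul] at h2
  have h3 : (1 + ‖z‖) ^ 3 * ‖Fb z‖ ≤ 8 * (C + D) := by
    have hz := norm_nonneg z
    have : (1 + ‖z‖) ^ 3 ≤ 8 * (1 + ‖z‖ ^ 3) := by
      nlinarith [sq_nonneg (‖z‖ - 1), mul_nonneg hz (sq_nonneg (‖z‖ - 1))]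
    calc _ ≤ 8 * (1 + ‖z‖ ^ 3) * ‖Fb z‖ := by gcongr
      _ = 8 * (‖Fb z‖ + ‖z‖ ^ 3 * ‖Fb z‖) := by ring
      _ ≤ _ := by linarith
  rw [le_div_iff₀ (by positivity)]
  have h4 : phi0 z ≤ ‖Fb z‖ ^ 2 := by
    unfold phi0
    rw [← sq_abs]
    gcongr
    exact Complex.abs_re_le_norm _
  calc phi0 z * (1 + ‖z‖) ^ 6 ≤ ‖Fb z‖ ^ 2 * (1 + ‖z‖) ^ 6 := by gcongr
    _ = ((1 + ‖z‖) ^ 3 * ‖Fb z‖) ^ 2 := by ring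
    _ ≤ _ := by gcongr

lemma phi0_norm (w : ℂ) : phi0 w = phi0 (‖w‖ : ℂ) := by
  unfold phi0; rw [Fb_norm]

noncomputable def gx (x : ℝ) (w : ℝ) : ℂ :=
  ∫ u : ℝ, Complex.exp (-2 * Real.pi * x * u * I) * GG (u + w * I)

lemma gx_zero {x w : ℝ} (h : 2 * rho ≤ |w|) : gx x w = 0 := by
  unfold gx
  rw [← integral_zero ℝ ℂ]
  congr 1
  ext u
  rw [GG_zero, mul_zero]
  refine h.trans ?_
  have := Complex.abs_im_le_norm (u + w * I)
  simpa using this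

lemma gx_eq (x w : ℝ) : gx x w =
    ∫ u in Set.Icc (-(2 * rho)) (2 * rho), Complex.exp (-2 * Real.pi * x * u * I) * GG (u + w * I) := by
  unfold gx
  symm
  apply setIntegral_eq_integral_of_forall_compl_eq_zero
  intro u hu
  rw [GG_zero, mul_zero]
  have := Complex.abs_re_le_norm (u + w * I)
  simp at this
  refine le_trans ?_ this
  by_contra h
  push Not at h
  exact hu ⟨(abs_lt.1 h).1.le, (abs_lt.1 h).2.le⟩

lemma gx_cont (x : ℝ) : Continuous (gx x) := by
  have : gx x = fun w : ℝ => ∫ u in Set.Icc (-(2 * rho)) (2 * rho),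
      Complex.exp (-2 * Real.pi * x * u * I) * GG (u + w * I) := by
    ext w; exact gx_eq x w
  rw [this]
  apply continuous_parametric_integral_of_continuous _ isCompact_Icc
  have := GG_cont
  unfold Function.uncurry
  fun_prop

lemma gx_cs (x : ℝ) : HasCompactSupport (gx x) := by
  refine HasCompactSupport.of_support_subset_isCompact (isCompact_closedBall (0:ℝ) (2 * rho)) ?_
  intro z hz
  by_contra h
  apply hz
  simp only [Metric.mem_closedBall, dist_zero_right, not_le] at h
  exact gx_zero h.le

lemma mul_GG_int (h : ℂ → ℂ) (hc : Continuous h) : Integrable (fun z : ℂ => h z • GG z) := by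
  refine Continuous.integrable_of_hasCompactSupport (hc.smul GG_cont) ?_
  have := GG_cs.mul_left (f := h)
  exact this

set_option maxHeartbeats 1000000 in
lemma gx_fourier (x v : ℝ) : 𝓕 (gx x) v = (phi0 (x + v * I) : ℂ) := by
  rw [phi0_eq, Real.fourier_eq', Real.fourier_eq']
  rw [← (Complex.volume_preserving_equiv_real_prod.symm).integral_comp
    (Complex.measurableEquivRealProd.symm.measurableEmbedding)]
  have hInteg : Integrable (fun z : ℂ => Complex.exp (↑(-2 * Real.pi * inner ℝ z (x + v * I : ℂ)) * I) • GG z) := by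
    have hc : Continuous (fun z : ℂ => Complex.exp (↑(-2 * Real.pi * inner ℝ z (x + v * I : ℂ)) * I)) := by
      fun_prop
    exact mul_GG_int _ hc
  have hint2 := ((Complex.volume_preserving_equiv_real_prod.symm).integrable_comp_emb
    (Complex.measurableEquivRealProd.symm.measurableEmbedding)).2 hInteg
  rw [Measure.volume_eq_prod] at hint2 ⊢
  simp only [Function.comp_def] at hint2
  rw [integral_prod_symm _ hint2]
  congr 1
  ext w
  unfold gx
  rw [smul_eq_mul, ← integral_const_mul]
  congr 1
  ext u
  have e1 : Complex.measurableEquivRealProd.symm (u, w) = (u + w * I : ℂ) := by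
    apply Complex.ext <;> simp
  rw [e1, smul_eq_mul, ← mul_assoc, ← Complex.exp_add]
  congr 2
  simp [Complex.inner]
  ring

lemma integrable_of_decay {f : ℝ → ℝ} (hf : Continuous f) {C : ℝ}
    (h : ∀ v, |f v| ≤ C / (1 + |v|) ^ 2) : Integrable f := by
  have h1 : Integrable (fun v : ℝ => C * (1 + v ^ 2)⁻¹) := integrable_inv_one_add_sq.const_mul C
  refine h1.mono' hf.aestronglyMeasurable (Filter.Eventually.of_forall fun v => ?_)
  have hC : 0 ≤ C := by
    have := (abs_nonneg _).trans (h 0)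
    simpa using this
  rw [Real.norm_eq_abs]
  refine (h v).trans ?_
  rw [div_eq_mul_inv]
  gcongr
  nlinarith [abs_nonneg v, sq_abs v]

lemma phi0_vint (x : ℝ) : Integrable (fun v : ℝ => phi0 (x + v * I)) := by
  obtain ⟨C, hC, h⟩ := phi0_decay
  apply integrable_of_decay (C := C)
  · have := phi0_cont
    fun_prop
  · intro v
    rw [abs_of_nonneg (phi0_nonneg _)]
    refine (h _).trans ?_
    have h1 : |v| ≤ ‖(x + v * I : ℂ)‖ := by
      have := Complex.abs_im_le_norm (x + v * I)
      simpa using this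
    gcongr C / ?_
    calc (1 + |v|) ^ 2 ≤ (1 + |v|) ^ 6 := pow_le_pow_right₀ (by linarith [abs_nonneg v]) (by norm_num)
      _ ≤ _ := by gcongr

lemma phi0_ft_zero (x : ℝ) {l : ℝ} (hl : 1 ≤ |l|) :
    ∫ v : ℝ, (phi0 (x + v * I) : ℂ) * Complex.exp (-(l * v) * I) = 0 := by
  have hF : 𝓕 (gx x) = fun v : ℝ => (phi0 (x + v * I) : ℂ) := by
    ext v; exact gx_fourier x v
  have h1 := Continuous.fourierInv_fourier_eq (gx_cont x)
    ((gx_cont x).integrable_of_hasCompactSupport (gx_cs x))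
    (by rw [hF]; exact (phi0_vint x).ofReal)
  have h2 := congrFun h1 (-l / (2 * Real.pi))
  rw [gx_zero, hF, Real.fourierInv_eq'] at h2
  · rw [← h2]
    congr 1
    ext v
    rw [smul_eq_mul, mul_comm]
    congr 2
    have := Real.pi_ne_zero
    have : (Real.pi:ℂ) ≠ 0 := by exact_mod_cast this
    simp
    field_simp
  · rw [abs_div, abs_neg, abs_of_pos (by positivity : 0 < 2 * Real.pi)]
    unfold rho
    rw [le_div_iff₀ (by positivity)]
    have := Real.pi_pos
    field_simp
    linarith

lemma integrable_decay4 : Integrable (fun z : ℂ => (1 + ‖z‖) ^ (-(4:ℝ))) :=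
  integrable_one_add_norm (by simp [Complex.finrank_real_complex]; norm_num)

lemma phi0_poly_int {g : ℂ → ℝ} (hg : Continuous g) {A : ℝ} (h : ∀ z, |g z| ≤ A * (1 + ‖z‖) ^ 2) :
    Integrable (fun z : ℂ => g z * phi0 z) := by
  obtain ⟨C, hC, hd⟩ := phi0_decay
  refine (integrable_decay4.const_mul (A * C)).mono' (hg.mul phi0_cont).aestronglyMeasurable
    (Filter.Eventually.of_forall fun z => ?_)
  have hz : 0 < 1 + ‖z‖ := by positivity
  rw [Real.norm_eq_abs, abs_mul, abs_of_nonneg (phi0_nonneg z)]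
  have hA : 0 ≤ A * (1 + ‖z‖) ^ 2 := (abs_nonneg _).trans (h z)
  calc _ ≤ (A * (1 + ‖z‖) ^ 2) * (C / (1 + ‖z‖) ^ 6) :=
        mul_le_mul (h z) (hd z) (phi0_nonneg z) hA
    _ = A * C * (1 + ‖z‖) ^ (-(4:ℝ)) := by
      have : (1 + ‖z‖) ^ (-(4:ℝ)) = ((1 + ‖z‖) ^ 4)⁻¹ := by
        rw [Real.rpow_neg hz.le]; norm_cast
      rw [this]
      field_simp

lemma phi0_int : Integrable phi0 := by
  have := phi0_poly_int (g := fun _ => 1) (A := 1) continuous_const (fun z => by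
    simp only [abs_one, one_mul]
    exact one_le_pow₀ (by linarith [norm_nonneg z]))
  simpa using this

lemma bR_int_pos : 0 < ∫ z : ℂ, bR z := by
  have hc : Continuous bR := bR_contDiff.continuous
  have hi : Integrable bR := by
    have := bb_int.re
    simpa [bb] using this
  exact hc.integral_pos_of_hasCompactSupport_nonneg_nonzero (by
      refine HasCompactSupport.of_support_subset_isCompact (isCompact_closedBall (0:ℂ) rho) ?_
      intro z hz
      by_contra h
      apply hz
      simp only [Metric.mem_closedBall, dist_zero_right, not_le] at h
      exact bR_zero h.le) (fun z => bR_nonneg z) (x := 0) bR_pos.ne'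

lemma phi0_zero_pos : 0 < phi0 0 := by
  have : Fb 0 = ((∫ z : ℂ, bR z : ℝ) : ℂ) := by
    unfold Fb
    rw [Real.fourier_eq']
    simp only [inner_zero_right, bb]
    simp
    exact integral_ofReal
  unfold phi0
  rw [this, Complex.ofReal_re]
  exact pow_pos bR_int_pos 2

lemma phi0_int_pos : 0 < ∫ z, phi0 z :=
  integral_pos_of_integrable_nonneg_nonzero phi0_cont phi0_int phi0_nonneg (x := 0) phi0_zero_pos.ne'

/-- the normalised kernel -/
noncomputable def ph (z : ℂ) : ℝ := phi0 z / ∫ z, phi0 z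

lemma ph_cont : Continuous ph := phi0_cont.div_const _
lemma ph_nonneg (z : ℂ) : 0 ≤ ph z := div_nonneg (phi0_nonneg z) phi0_int_pos.le
lemma ph_norm (z : ℂ) : ph z = ph (‖z‖ : ℂ) := by unfold ph; rw [phi0_norm]
lemma ph_norm_eq {z w : ℂ} (h : ‖z‖ = ‖w‖) : ph z = ph w := by rw [ph_norm, h, ← ph_norm]
lemma ph_int : Integrable ph := phi0_int.div_const _
lemma ph_integral : ∫ z, ph z = 1 := by
  unfold ph
  rw [integral_div, div_self phi0_int_pos.ne']

lemma ph_poly_int {g : ℂ → ℝ} (hg : Continuous g) {A : ℝ} (h : ∀ z, |g z| ≤ A * (1 + ‖z‖) ^ 2) :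
    Integrable (fun z : ℂ => g z * ph z) := by
  have := (phi0_poly_int hg h).div_const (∫ z, phi0 z)
  unfold ph
  simpa [mul_div_assoc] using this

lemma ph_decay : ∃ C : ℝ, 0 < C ∧ ∀ z : ℂ, ph z ≤ C / (1 + ‖z‖) ^ 6 := by
  obtain ⟨C, hC, h⟩ := phi0_decay
  refine ⟨C / ∫ z, phi0 z, div_pos hC phi0_int_pos, fun z => ?_⟩
  unfold ph
  rw [div_div, mul_comm, ← div_div]
  exact div_le_div_of_nonneg_right (h z) phi0_int_pos.le

lemma ph_ft_zero (x : ℝ) {l : ℝ} (hl : 1 ≤ |l|) :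
    ∫ v : ℝ, (ph (x + v * I) : ℂ) * Complex.exp (-(l * v) * I) = 0 := by
  unfold ph
  have := phi0_ft_zero x hl
  simp only [Complex.ofReal_div, div_mul_eq_mul_div]
  rw [integral_div, this, zero_div]

lemma ph_v_int {g : ℝ → ℂ} (hg : Continuous g) {A : ℝ} (h : ∀ v, ‖g v‖ ≤ A * (1 + |v|)) (x : ℝ) :
    Integrable (fun v : ℝ => g v * ph (x + v * I)) := by
  obtain ⟨C, hC, hd⟩ := ph_decay
  have hpc := ph_cont
  have h1 : Integrable (fun v : ℝ => (A * C) * (1 + v ^ 2)⁻¹) := integrable_inv_one_add_sq.const_mul _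
  refine h1.mono' (by fun_prop) (Filter.Eventually.of_forall fun v => ?_)
  rw [norm_mul, Complex.norm_real, Real.norm_eq_abs, abs_of_nonneg (ph_nonneg _)]
  have hA : 0 ≤ A * (1 + |v|) := (norm_nonneg _).trans (h v)
  have hA0 : 0 ≤ A := by
    by_contra h; push Not at h
    have : 0 < 1 + |v| := by positivity
    nlinarith
  have h1 : |v| ≤ ‖(x + v * I : ℂ)‖ := by
    have := Complex.abs_im_le_norm (x + v * I)
    simpa using this
  have h2 : ph (x + v * I) ≤ C / (1 + |v|) ^ 6 := by
    refine (hd _).trans ?_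
    gcongr
  have hv := abs_nonneg v
  calc _ ≤ (A * (1 + |v|)) * (C / (1 + |v|) ^ 6) :=
        mul_le_mul (h v) h2 (ph_nonneg _) hA
    _ = A * C * ((1 + |v|) ^ 5)⁻¹ := by field_simp
    _ ≤ _ := by
      gcongr
      calc 1 + v ^ 2 ≤ (1 + |v|) ^ 2 := by nlinarith [sq_abs v]
        _ ≤ _ := pow_le_pow_right₀ (by linarith) (by norm_num)

end S18


namespace S18
open MeasureTheory

lemma jensen_le {F : ℂ → ℂ} (hF : Differentiable ℂ F) (h0 : F 0 ≠ 0) {ε : ℝ} (hε : 0 < ε) :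
    Real.log ‖F 0‖ ≤ Real.circleAverage (fun w => Real.log (max ‖F w‖ ε)) 0 1 := by
  have hA : AnalyticOnNhd ℂ F Set.univ := fun z _ => hF.analyticAt z
  have hA1 : AnalyticOnNhd ℂ F (Metric.closedBall 0 |(1:ℝ)|) := hA.mono (Set.subset_univ _)
  have hJ := AnalyticOnNhd.circleAverage_log_norm one_ne_zero hA1 h0
  have h1 : Real.log ‖F 0‖ ≤ Real.circleAverage (fun w => Real.log ‖F w‖) 0 1 := by
    rw [hJ]
    have : 0 ≤ ∑ᶠ u, (MeromorphicOn.divisor F (Metric.closedBall 0 |(1:ℝ)|) u : ℝ) * Real.log (1 * ‖0 - u‖⁻¹) := by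
      apply finsum_nonneg
      intro u
      by_cases hu : u ∈ Metric.closedBall (0:ℂ) |(1:ℝ)|
      · apply mul_nonneg
        · exact_mod_cast MeromorphicOn.AnalyticOnNhd.divisor_nonneg hA1 u
        · simp only [one_mul, zero_sub, norm_neg]
          simp only [Metric.mem_closedBall, dist_zero_right, abs_one] at hu
          rw [Real.log_inv]
          have := Real.log_nonpos (norm_nonneg u) hu
          linarith
      · rw [Function.locallyFinsuppWithin.apply_eq_zero_of_notMem _ hu]
        simp
    linarith
  refine h1.trans ?_
  classical
  let g : ℂ → ℝ := fun w => if F w = 0 then Real.log ε else Real.log ‖F w‖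
  have hcod : (fun w => Real.log ‖F w‖) =ᶠ[Filter.codiscreteWithin (Metric.sphere 0 |(1:ℝ)|)] g := by
    have := hA.preimage_zero_mem_codiscrete h0
    have h2 := Filter.codiscreteWithin_mono (Set.subset_univ (Metric.sphere (0:ℂ) |(1:ℝ)|)) this
    filter_upwards [h2] with w hw
    have : F w ≠ 0 := hw
    simp [g, this]
  have hi1 : CircleIntegrable (fun w => Real.log ‖F w‖) 0 1 :=
    MeromorphicOn.circleIntegrable_log_norm ((hA.mono (Set.subset_univ _)).meromorphicOn)
  rw [Real.circleAverage_congr_codiscreteWithin hcod one_ne_zero]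
  apply Real.circleAverage_mono (hi1.congr_codiscreteWithin hcod)
  · apply Continuous.intervalIntegrable
    have := hF.continuous
    refine Continuous.log ?_ (fun θ => ?_)
    · fun_prop
    · exact (lt_max_of_lt_right hε).ne'
  · intro w _
    by_cases hw : F w = 0
    · simp only [g, hw, if_true]
      exact Real.log_le_log hε (le_max_right _ _)
    · simp only [g, hw, if_false]
      exact Real.log_le_log (norm_pos_iff.2 hw) (le_max_left _ _)

lemma submean {F : ℂ → ℂ} (hF : Differentiable ℂ F) (c : ℂ) (h0 : F c ≠ 0) {ε : ℝ} (hε : 0 < ε)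
    {A : ℝ} (hA : ∀ z : ℂ, |Real.log (max ‖F (c + z)‖ ε)| ≤ A * (1 + ‖z‖) ^ 2)
    {X : ℝ} (hX : 1 ≤ X) :
    Real.log ‖F c‖ ≤ ∫ z : ℂ, Real.log (max ‖F (c + z / X)‖ ε) * ph z := by
  have hX0 : 0 < X := by linarith
  set G : ℂ → ℝ := fun z => Real.log (max ‖F (c + z / X)‖ ε) with hG
  have hGc : Continuous G := by
    have := hF.continuous
    refine Continuous.log (by fun_prop) (fun z => (lt_max_of_lt_right hε).ne')
  have hA0 : 0 ≤ A := by
    have := (abs_nonneg _).trans (hA 0)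
    simpa using this
  have hGb : ∀ z, |G z| ≤ A * (1 + ‖z‖) ^ 2 := by
    intro z
    refine (hA _).trans ?_
    have : ‖z / (X:ℂ)‖ ≤ ‖z‖ := by
      rw [norm_div, Complex.norm_real, Real.norm_eq_abs, abs_of_pos hX0]
      exact div_le_self (norm_nonneg _) hX
    gcongr
  have hrot : ∀ θ : ℝ, ∫ z, G (circleMap 0 1 θ * z) * ph z = ∫ z, G z * ph z := by
    intro θ
    have h1 := (rotation (Circle.exp θ)).measurePreserving.integral_comp
      (rotation (Circle.exp θ)).toHomeomorph.measurableEmbedding (fun z => G z * ph z)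
    rw [← h1]
    congr 1
    ext z
    have e : (rotation (Circle.exp θ)) z = circleMap 0 1 θ * z := by
      simp [rotation_apply, circleMap]
    rw [e]
    congr 1
    apply ph_norm_eq
    rw [← e, LinearIsometryEquiv.norm_map]
  have hcirc : ∀ z, Real.log ‖F c‖ ≤ (2 * Real.pi)⁻¹ * ∫ θ in (0:ℝ)..(2 * Real.pi), G (circleMap 0 1 θ * z) := by
    intro z
    have := jensen_le (F := fun w => F (c + w * z / X)) (by fun_prop) (by simpa using h0) hε
    rw [Real.circleAverage_def] at this
    simpa [hG] using this
  have hprod : Integrable (fun p : ℂ × ℝ => G (circleMap 0 1 p.2 * p.1) * ph p.1)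
      (volume.prod (volume.restrict (Set.Ioc 0 (2 * Real.pi)))) := by
    have hb := (ph_poly_int (g := fun z => A * (1 + ‖z‖) ^ 2) (by fun_prop) (A := A) (fun z => by
      rw [abs_of_nonneg (by positivity)])).comp_fst (volume.restrict (Set.Ioc 0 (2 * Real.pi)))
    refine hb.mono' ?_ (Filter.Eventually.of_forall fun p => ?_)
    · apply Continuous.aestronglyMeasurable
      have := ph_cont
      have h2 : Continuous (circleMap 0 1) := by fun_prop
      fun_prop
    · rw [Real.norm_eq_abs, abs_mul, abs_of_nonneg (ph_nonneg _)]
      apply mul_le_mul_of_nonneg_right _ (ph_nonneg _)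
      have := hGb (circleMap 0 1 p.2 * p.1)
      simpa using this
  have hswap := integral_integral_swap (f := fun (z : ℂ) (θ : ℝ) => G (circleMap 0 1 θ * z) * ph z) hprod
  simp only [hrot] at hswap
  have hL : ∀ z, Real.log ‖F c‖ * (2 * Real.pi) * ph z ≤
      ∫ θ in Set.Ioc 0 (2 * Real.pi), G (circleMap 0 1 θ * z) * ph z := by
    intro z
    rw [integral_mul_const]
    apply mul_le_mul_of_nonneg_right _ (ph_nonneg _)
    have h2 := hcirc z
    rw [intervalIntegral.integral_of_le (by positivity), inv_mul_eq_div, le_div_iff₀ (by positivity)] at h2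
    exact h2
  have hmono := integral_mono (ph_int.const_mul (Real.log ‖F c‖ * (2 * Real.pi))) hprod.integral_prod_left hL
  rw [hswap, integral_const_mul, ph_integral, mul_one, setIntegral_const, smul_eq_mul] at hmono
  simp only [measureReal_def, Real.volume_Ioc, sub_zero] at hmono
  rw [ENNReal.toReal_ofReal (by positivity), mul_comm] at hmono
  exact le_of_mul_le_mul_left hmono (by positivity)

lemma exists_growth {q : ℕ} [NeZero q] {χ : DirichletCharacter ℂ q} (hχ : χ ≠ 1) (hp : χ.IsPrimitive)
    (hRH : dirichletRH χ) (t : ℝ) : ∃ A : ℝ, 0 ≤ A ∧ ∀ z : ℂ,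
    ‖DirichletCharacter.LFunction χ (1 / 2 + t * I + z)‖ ≤ Real.exp (A * (1 + ‖z‖) ^ 2) := by
  have hR : ∀ z : ℂ, 0 ≤ z.re → ‖DirichletCharacter.LFunction χ (1 / 2 + t * I + z)‖ ≤
      Real.exp (1 + |t| + ‖z‖ + 2 * (q + 1)) := by
    intro z hz
    have h1 := norm_LFunction_le hχ (s := 1 / 2 + t * I + z) (by simp; positivity)
    have hre : (1/2 : ℝ) ≤ (1 / 2 + t * I + z : ℂ).re := by simp; linarith
    have hn : ‖(1 / 2 + t * I + z : ℂ)‖ ≤ 1 + |t| + ‖z‖ := by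
      refine (norm_add_le _ _).trans ?_
      gcongr
      refine (norm_add_le _ _).trans ?_
      simp
      norm_num
    refine h1.trans ?_
    rw [Real.exp_add]
    gcongr ?_ * ?_
    · refine hn.trans ?_
      linarith [Real.add_one_le_exp (1 + |t| + ‖z‖)]
    · have : (q + 1 : ℝ) / (1 / 2 + t * I + z : ℂ).re ≤ (q + 1) / (1/2) := by gcongr
      refine this.trans ?_
      have := Real.add_one_le_exp (2 * ((q:ℝ) + 1))
      linarith
  have hA : (0:ℝ) ≤ (q + 3 + |t|) + (1 + |t| + 2 * (q + 1)) + 1 := by positivity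
  refine ⟨(q + 3 + |t|) + (1 + |t| + 2 * (q + 1)) + 1, hA, fun z => ?_⟩
  have hz0 := norm_nonneg z
  have ht := abs_nonneg t
  have hq : (0:ℝ) ≤ q := Nat.cast_nonneg q
  by_cases hz : 0 ≤ z.re
  · refine (hR z hz).trans ?_
    apply Real.exp_le_exp.2
    nlinarith [mul_nonneg hz0 ht, mul_nonneg hz0 hq, mul_nonneg (mul_nonneg hz0 hz0) ht, mul_nonneg (mul_nonneg hz0 hz0) hq]
  · push Not at hz
    have h1 := FE_ineq hχ hp hRH (h := -z.re) (by linarith) (t + z.im)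
    have e1 : (1 / 2 - ((-z.re : ℝ):ℂ) + ((t + z.im : ℝ) : ℂ) * I) = 1 / 2 + t * I + z := by
      apply Complex.ext <;> simp
    have e2 : (1 / 2 + ((-z.re : ℝ):ℂ) + ((t + z.im : ℝ) : ℂ) * I) = 1 / 2 + t * I + (-z.re + z.im * I) := by
      apply Complex.ext <;> simp
    rw [e1, e2] at h1
    have h2 := hR (-z.re + z.im * I) (by simp; linarith)
    have e3 : ‖(-z.re + z.im * I : ℂ)‖ = ‖z‖ := by
      rw [Complex.norm_eq_sqrt_sq_add_sq, Complex.norm_eq_sqrt_sq_add_sq]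
      simp
    rw [e3] at h2
    refine h1.trans ((mul_le_mul_of_nonneg_left h2 (Real.exp_pos _).le).trans ?_)
    rw [← Real.exp_add]
    apply Real.exp_le_exp.2
    have hre := Complex.abs_re_le_norm z
    have him := Complex.abs_im_le_norm z
    rw [abs_of_neg hz] at hre
    have l1 : Real.log q ≤ q := Real.log_le_self hq
    have l2 : Real.log (2 + 2 * (-z.re) + |t + z.im|) ≤ 2 + 3 * ‖z‖ + |t| := by
      refine (Real.log_le_self (by have := abs_nonneg (t + z.im); linarith)).trans ?_
      have := abs_add_le t z.im
      linarith
    have l3 : -z.re * (Real.log q + Real.log (2 + 2 * (-z.re) + |t + z.im|)) ≤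
        ‖z‖ * (q + (2 + 3 * ‖z‖ + |t|)) := by
      apply mul_le_mul hre (by linarith) _ hz0
      apply add_nonneg
      · exact Real.log_natCast_nonneg q
      · apply Real.log_nonneg
        have := abs_nonneg (t + z.im)
        linarith
    nlinarith [mul_nonneg hz0 ht, mul_nonneg hz0 hq, mul_nonneg (mul_nonneg hz0 hz0) ht, mul_nonneg (mul_nonneg hz0 hz0) hq, mul_nonneg hz0 hz0]

lemma abs_log_max_le {a B ε : ℝ} (hε : 0 < ε) (hB : 0 ≤ B) (h : a ≤ Real.exp B) :
    |Real.log (max a ε)| ≤ B + |Real.log ε| := by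
  rw [abs_le]
  constructor
  · have : Real.log ε ≤ Real.log (max a ε) := Real.log_le_log hε (le_max_right _ _)
    have := neg_abs_le (Real.log ε)
    linarith
  · rcases le_total a ε with h1 | h1
    · rw [max_eq_right h1]
      have := le_abs_self (Real.log ε)
      linarith
    · rw [max_eq_left h1]
      have : Real.log a ≤ B := by
        rw [← Real.log_exp B]
        exact Real.log_le_log (lt_of_lt_of_le hε h1) h
      have := abs_nonneg (Real.log ε)
      linarith

end S18


namespace S18
open MeasureTheory

lemma norm_LSeries_acoef_le' {q : ℕ} [NeZero q] (χ : DirichletCharacter ℂ q) {s : ℂ} (hs : 2 ≤ s.re) :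
    ‖LSeries (acoef χ) s‖ ≤ 2 := by
  have hsum : LSeriesSummable (acoef χ) s := LSeriesSummable_of_abscissaOfAbsConv_lt_re (absc_acoef_lt χ (by linarith))
  refine (norm_tsum_le_tsum_norm hsum.norm).trans ?_
  have hz := hasSum_zeta_two
  refine (hsum.norm.tsum_le_tsum (g := fun n : ℕ => (1:ℝ) / (n:ℝ)^2) ?_ hz.summable).trans ?_
  · intro n
    rw [LSeries.norm_term_eq]
    split_ifs with h
    · positivity
    · have := norm_acoef_le χ n
      have h1 : (1:ℝ) ≤ n := by exact_mod_cast Nat.one_le_iff_ne_zero.2 h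
      have h2 : (n:ℝ)^2 ≤ (n:ℝ) ^ s.re := by
        rw [show ((n:ℝ)^2) = (n:ℝ) ^ (2:ℝ) by norm_cast]
        exact Real.rpow_le_rpow_of_exponent_le h1 hs
      gcongr
  · rw [hz.tsum_eq]
    have := Real.pi_lt_d2
    have := Real.pi_gt_three
    nlinarith

lemma logL_growth' {q : ℕ} [NeZero q] {χ : DirichletCharacter ℂ q} (hχ : χ ≠ 1) {f : ℂ → ℂ}
    (hd : DifferentiableOn ℂ f {s : ℂ | 1/2 < s.re})
    (he : ∀ s : ℂ, 1/2 < s.re → Complex.exp (f s) = DirichletCharacter.LFunction χ s)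
    (hl : ∀ s : ℂ, 1 < s.re → f s = LSeries (acoef χ) s) {δ : ℝ} (hδ : 0 < δ) :
    ∃ K : ℝ, 0 < K ∧ ∀ s : ℂ, 1/2 + δ ≤ s.re → ‖f s‖ ≤ K * (1 + |s.im|) := by
  obtain ⟨K, hK, h⟩ := logL_growth hχ hd he hl hδ
  refine ⟨K + 2, by linarith, fun s hs => ?_⟩
  have him := abs_nonneg s.im
  rcases le_total s.re 2 with h2 | h2
  · refine (h s hs h2).trans ?_
    gcongr; linarith
  · rw [hl s (by linarith)]
    refine (norm_LSeries_acoef_le' χ h2).trans ?_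
    nlinarith

lemma ph_prod_int {g : ℂ → ℝ} (hg : Continuous g) {A : ℝ} (h : ∀ z, |g z| ≤ A * (1 + ‖z‖) ^ 2) :
    Integrable (fun p : ℝ × ℝ => g (p.1 + p.2 * I) * ph (p.1 + p.2 * I)) (volume.prod volume) := by
  have hInteg := ph_poly_int hg h
  have hint2 := ((Complex.volume_preserving_equiv_real_prod.symm).integrable_comp_emb
    (Complex.measurableEquivRealProd.symm.measurableEmbedding)).2 hInteg
  rw [Measure.volume_eq_prod] at hint2
  convert hint2 using 1
  ext p
  have e1 : Complex.measurableEquivRealProd.symm p = (p.1 + p.2 * I : ℂ) := by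
    apply Complex.ext <;> simp
  simp only [Function.comp_apply, e1]

lemma ph_fubini {g : ℂ → ℝ} (hg : Continuous g) {A : ℝ} (h : ∀ z, |g z| ≤ A * (1 + ‖z‖) ^ 2) :
    ∫ z, g z * ph z = ∫ x : ℝ, ∫ v : ℝ, g (x + v * I) * ph (x + v * I) := by
  rw [← (Complex.volume_preserving_equiv_real_prod.symm).integral_comp
    (Complex.measurableEquivRealProd.symm.measurableEmbedding)]
  have hint2 := ph_prod_int hg h
  rw [Measure.volume_eq_prod, ← integral_prod _ hint2]
  congr 1
  ext p
  have e1 : Complex.measurableEquivRealProd.symm p = (p.1 + p.2 * I : ℂ) := by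
    apply Complex.ext <;> simp
  simp only [e1]

lemma ph_v_bound {g : ℂ → ℝ} {A C : ℝ} (hA : 0 ≤ A)
    (hC : ∀ z, ph z ≤ C / (1 + ‖z‖) ^ 6) (h : ∀ z, |g z| ≤ A * (1 + ‖z‖) ^ 2) (x v : ℝ) :
    ‖g (x + v * I) * ph (x + v * I)‖ ≤ (A * C) * (1 + v ^ 2)⁻¹ := by
  have h1 : |v| ≤ ‖(x + v * I : ℂ)‖ := by
    have := Complex.abs_im_le_norm (x + v * I)
    simpa using this
  have hC0 : 0 ≤ C := by
    have := (ph_nonneg 0).trans (hC 0)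
    simpa using this
  set z : ℂ := x + v * I
  have hz : 0 < 1 + ‖z‖ := by positivity
  rw [Real.norm_eq_abs, abs_mul, abs_of_nonneg (ph_nonneg z)]
  calc _ ≤ (A * (1 + ‖z‖) ^ 2) * (C / (1 + ‖z‖) ^ 6) :=
        mul_le_mul (h z) (hC z) (ph_nonneg z) (by positivity)
    _ = A * C * ((1 + ‖z‖) ^ 4)⁻¹ := by field_simp
    _ ≤ _ := by
      gcongr
      calc 1 + v ^ 2 ≤ (1 + ‖z‖) ^ 2 := by nlinarith [sq_abs v, abs_nonneg v]
        _ ≤ _ := pow_le_pow_right₀ (by linarith [norm_nonneg z]) (by norm_num)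

lemma ph_v_int2 {g : ℂ → ℝ} (hg : Continuous g) {A : ℝ} (h : ∀ z, |g z| ≤ A * (1 + ‖z‖) ^ 2) (x : ℝ) :
    Integrable (fun v : ℝ => g (x + v * I) * ph (x + v * I)) := by
  obtain ⟨C, hC, hd⟩ := ph_decay
  have hpc := ph_cont
  have hA : 0 ≤ A := by
    have := (abs_nonneg _).trans (h 0)
    simpa using this
  exact (integrable_inv_one_add_sq.const_mul (A * C)).mono' (by fun_prop)
    (Filter.Eventually.of_forall fun v => ph_v_bound hA hd h x v)

lemma ph_v_sup : ∃ B : ℝ, 0 ≤ B ∧ ∀ x : ℝ, ∫ v : ℝ, (1 + ‖(x + v * I : ℂ)‖) ^ 2 * ph (x + v * I) ≤ B := by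
  obtain ⟨C, hC, hd⟩ := ph_decay
  refine ⟨∫ v : ℝ, (1 * C) * (1 + v ^ 2)⁻¹, by positivity, fun x => ?_⟩
  have hb : ∀ z : ℂ, |(1 + ‖z‖) ^ 2| ≤ 1 * (1 + ‖z‖) ^ 2 := fun z => by
    rw [abs_of_nonneg (by positivity), one_mul]
  apply integral_mono (ph_v_int2 (g := fun z => (1 + ‖z‖) ^ 2) (by fun_prop) hb x)
    (integrable_inv_one_add_sq.const_mul _)
  intro v
  exact (le_abs_self _).trans (ph_v_bound (g := fun z => (1 + ‖z‖) ^ 2) zero_le_one hd hb x v)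

lemma integral_fold {H : ℝ → ℝ} (hH : Integrable H) :
    ∫ x, H x = ∫ x in Set.Ioi (0:ℝ), (H x + H (-x)) := by
  have h1 := intervalIntegral.integral_Iic_add_Ioi (b := 0) hH.integrableOn hH.integrableOn
  have h2 := integral_comp_neg_Ioi (c := 0) H
  have h3 : IntegrableOn (fun x => H (-x)) (Set.Ioi 0) := hH.comp_neg.integrableOn
  rw [integral_add hH.integrableOn h3, h2, neg_zero, ← h1]
  ring

noncomputable def VN {q : ℕ} [NeZero q] (χ : DirichletCharacter ℂ q) (ε : ℝ) (s : ℂ) : ℝ :=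
  Real.log (max ‖DirichletCharacter.LFunction χ s‖ ε)

lemma VN_cont {q : ℕ} [NeZero q] {χ : DirichletCharacter ℂ q} (hχ : χ ≠ 1) {ε : ℝ} (hε : 0 < ε) :
    Continuous (VN χ ε) := by
  have := (DirichletCharacter.differentiable_LFunction hχ).continuous
  exact Continuous.log (by fun_prop) (fun z => (lt_max_of_lt_right hε).ne')

lemma VN_bound {q : ℕ} [NeZero q] {χ : DirichletCharacter ℂ q} (hχ : χ ≠ 1) (hp : χ.IsPrimitive)
    (hRH : dirichletRH χ) (t : ℝ) {X : ℝ} (hX : 1 ≤ X) {ε : ℝ} (hε : 0 < ε) : ∃ A : ℝ,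
    ∀ z : ℂ, |VN χ ε (1 / 2 + t * I + z / X)| ≤ A * (1 + ‖z‖) ^ 2 := by
  obtain ⟨A, hA, h⟩ := exists_growth hχ hp hRH t
  refine ⟨A + |Real.log ε|, fun z => ?_⟩
  refine (abs_log_max_le hε (by positivity) (h (z / X))).trans ?_
  have hX0 : 0 < X := by linarith
  have : ‖z / (X:ℂ)‖ ≤ ‖z‖ := by
    rw [norm_div, Complex.norm_real, Real.norm_eq_abs, abs_of_pos hX0]
    exact div_le_self (norm_nonneg _) hX
  have h1 : A * (1 + ‖z / (X:ℂ)‖) ^ 2 ≤ A * (1 + ‖z‖) ^ 2 := by gcongr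
  have h2 : 1 ≤ (1 + ‖z‖) ^ 2 := one_le_pow₀ (by linarith [norm_nonneg z])
  have := abs_nonneg (Real.log ε)
  nlinarith

lemma VN_FE {q : ℕ} [NeZero q] (hq : 3 ≤ q) {χ : DirichletCharacter ℂ q} (hχ : χ ≠ 1) (hp : χ.IsPrimitive)
    (hRH : dirichletRH χ) {t : ℝ} (ht0 : 0 ≤ t) (ht : t ≤ q + 1) {X : ℝ} (hX : 1 ≤ X) {ε : ℝ} (hε : 0 < ε)
    {x : ℝ} (hx : 0 < x) (v : ℝ) :
    VN χ ε (1 / 2 + t * I + (((-x : ℝ):ℂ) + v * I) / X) ≤ VN χ ε (1 / 2 + t * I + (x + v * I) / X) +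
      (4 * Real.log q / X) * (1 + ‖(x + v * I : ℂ)‖) ^ 2 := by
  have hX0 : 0 < X := by linarith
  have hXc : (X:ℂ) ≠ 0 := by exact_mod_cast hX0.ne'
  have h1 := FE_ineq hχ hp hRH (h := x / X) (by positivity) (t + v / X)
  have e1 : (1 / 2 - ((x / X : ℝ):ℂ) + ((t + v / X : ℝ) : ℂ) * I) = 1 / 2 + t * I + (((-x : ℝ):ℂ) + v * I) / X := by
    push_cast; field_simp; ring
  have e2 : (1 / 2 + ((x / X : ℝ):ℂ) + ((t + v / X : ℝ) : ℂ) * I) = 1 / 2 + t * I + (x + v * I) / X := by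
    push_cast; field_simp; ring
  rw [e1, e2] at h1
  set z : ℂ := x + v * I with hz
  have hxz : x ≤ ‖z‖ := by
    have := Complex.re_le_norm z
    simpa [hz] using this
  have hvz : |v| ≤ ‖z‖ := by
    have := Complex.abs_im_le_norm z
    simpa [hz] using this
  have hq3 : (3:ℝ) ≤ q := by exact_mod_cast hq
  have hlq : 1 ≤ Real.log q := by
    rw [Real.le_log_iff_exp_le (by linarith)]
    have := Real.exp_one_lt_d9
    linarith
  have hz0 := norm_nonneg z
  have hlog : Real.log (2 + 2 * (x / X) + |t + v / X|) ≤ 2 * Real.log q + ‖z‖ := by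
    have h2 : 2 + 2 * (x / X) + |t + v / X| ≤ (q * q) * (1 + ‖z‖) := by
      have a1 : x / X ≤ ‖z‖ := (div_le_self hx.le hX).trans hxz
      have a2 : |t + v / X| ≤ (q + 1) + ‖z‖ := by
        refine (abs_add_le _ _).trans ?_
        rw [abs_of_nonneg ht0, abs_div, abs_of_pos hX0]
        have := div_le_self (abs_nonneg v) hX
        linarith
      have a3 : (3:ℝ) * q ≤ q * q := by nlinarith
      have a4 : (9:ℝ) ≤ q * q := by nlinarith
      nlinarith [mul_le_mul_of_nonneg_right a4 hz0]
    have h3 : 0 < 2 + 2 * (x / X) + |t + v / X| := by positivity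
    calc _ ≤ Real.log ((q * q) * (1 + ‖z‖)) := Real.log_le_log h3 h2
      _ = 2 * Real.log q + Real.log (1 + ‖z‖) := by
        rw [Real.log_mul (by positivity) (by positivity), Real.log_mul (by positivity) (by positivity)]; ring
      _ ≤ _ := by
        have := Real.log_le_sub_one_of_pos (show 0 < 1 + ‖z‖ by positivity)
        linarith
  set B := x / X * (Real.log q + Real.log (2 + 2 * (x / X) + |t + v / X|)) with hB
  have hlog0 : 0 ≤ Real.log (2 + 2 * (x / X) + |t + v / X|) := by
    apply Real.log_nonneg
    have : 0 ≤ x / X := by positivity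
    have := abs_nonneg (t + v / X)
    linarith
  have hB0 : 0 ≤ B := by positivity
  have hBle : B ≤ (4 * Real.log q / X) * (1 + ‖z‖) ^ 2 := by
    have : B ≤ ‖z‖ / X * (3 * Real.log q + ‖z‖) := by
      rw [hB]
      apply mul_le_mul _ (by linarith) (by positivity) (by positivity)
      gcongr
    refine this.trans ?_
    rw [div_mul_eq_mul_div, div_mul_eq_mul_div]
    apply div_le_div_of_nonneg_right _ hX0.le
    nlinarith [mul_nonneg hz0 hz0, mul_nonneg (mul_nonneg hz0 hz0) (sub_nonneg.2 hlq), mul_nonneg hz0 (sub_nonneg.2 hlq)]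
  have : VN χ ε (1 / 2 + t * I + (((-x : ℝ):ℂ) + v * I) / X) ≤ B + VN χ ε (1 / 2 + t * I + z / X) := by
    unfold VN
    rw [← Real.log_exp B, ← Real.log_mul (Real.exp_pos _).ne' (lt_max_of_lt_right hε).ne']
    apply Real.log_le_log (lt_max_of_lt_right hε)
    apply max_le
    · refine h1.trans ?_
      gcongr
      exact le_max_left _ _
    · have : (1:ℝ) ≤ Real.exp B := Real.one_le_exp hB0
      have h5 : ε ≤ max ‖DirichletCharacter.LFunction χ (1 / 2 + t * I + z / X)‖ ε := le_max_right _ _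
      nlinarith
  linarith

noncomputable def M2c : ℝ := ∫ z : ℂ, (1 + ‖z‖) ^ 2 * ph z

lemma M2c_nonneg : 0 ≤ M2c := integral_nonneg fun z => mul_nonneg (by positivity) (ph_nonneg z)

lemma sq_bd (z : ℂ) : |(1 + ‖z‖) ^ 2| ≤ 1 * (1 + ‖z‖) ^ 2 := by
  rw [abs_of_nonneg (by positivity), one_mul]

noncomputable def PV (x : ℝ) : ℝ := ∫ v : ℝ, (1 + ‖(x + v * I : ℂ)‖) ^ 2 * ph (x + v * I)

lemma PV_int : Integrable PV :=
  (ph_prod_int (g := fun z => (1 + ‖z‖) ^ 2) (by fun_prop) sq_bd).integral_prod_left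

lemma PV_nonneg (x : ℝ) : 0 ≤ PV x := integral_nonneg fun v => mul_nonneg (by positivity) (ph_nonneg _)

lemma PV_total : ∫ x in Set.Ioi (0:ℝ), PV x ≤ M2c := by
  rw [M2c, ph_fubini (g := fun z => (1 + ‖z‖) ^ 2) (by fun_prop) sq_bd]
  exact setIntegral_le_integral PV_int (Filter.Eventually.of_forall PV_nonneg)

noncomputable def HN {q : ℕ} [NeZero q] (χ : DirichletCharacter ℂ q) (ε t X x : ℝ) : ℝ :=
  ∫ v : ℝ, VN χ ε (1 / 2 + t * I + (x + v * I) / X) * ph (x + v * I)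

lemma HN_int {q : ℕ} [NeZero q] {χ : DirichletCharacter ℂ q} (hχ : χ ≠ 1) (hp : χ.IsPrimitive)
    (hRH : dirichletRH χ) (t : ℝ) {X : ℝ} (hX : 1 ≤ X) {ε : ℝ} (hε : 0 < ε) :
    Integrable (HN χ ε t X) := by
  obtain ⟨A, hA⟩ := VN_bound hχ hp hRH t hX hε
  have hc : Continuous (fun z : ℂ => VN χ ε (1 / 2 + t * I + z / X)) :=
    (VN_cont hχ hε).comp (by fun_prop)
  exact (ph_prod_int hc hA).integral_prod_left

lemma fold_main {q : ℕ} [NeZero q] (hq : 3 ≤ q) {χ : DirichletCharacter ℂ q} (hχ : χ ≠ 1) (hp : χ.IsPrimitive)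
    (hRH : dirichletRH χ) {t : ℝ} (ht0 : 0 ≤ t) (ht : t ≤ q + 1) {X : ℝ} (hX : 1 ≤ X) {ε : ℝ} (hε : 0 < ε)
    (hL : DirichletCharacter.LFunction χ (1 / 2 + t * I) ≠ 0) :
    Real.log ‖DirichletCharacter.LFunction χ (1 / 2 + t * I)‖ ≤
      2 * (∫ x in Set.Ioi (0:ℝ), HN χ ε t X x) + 4 * M2c * Real.log q / X := by
  have hX0 : 0 < X := by linarith
  obtain ⟨A, hA⟩ := VN_bound hχ hp hRH t hX hε
  have hc : Continuous (fun z : ℂ => VN χ ε (1 / 2 + t * I + z / X)) :=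
    (VN_cont hχ hε).comp (by fun_prop)
  obtain ⟨A1, hA1⟩ := VN_bound hχ hp hRH t le_rfl hε
  have h1 := submean (DirichletCharacter.differentiable_LFunction hχ) (1 / 2 + t * I) hL hε
    (A := A1) (fun z => by have := hA1 z; simpa [VN] using this) hX
  have h2 := ph_fubini hc hA
  have hHi := HN_int hχ hp hRH t hX hε
  rw [show (∫ z : ℂ, Real.log (max ‖DirichletCharacter.LFunction χ (1 / 2 + t * I + z / X)‖ ε) * ph z) =
    ∫ x : ℝ, HN χ ε t X x from h2, integral_fold hHi] at h1
  refine h1.trans ?_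
  have hlq : 0 ≤ Real.log q := Real.log_natCast_nonneg q
  have hpt : ∀ x ∈ Set.Ioi (0:ℝ), HN χ ε t X x + HN χ ε t X (-x) ≤
      2 * HN χ ε t X x + (4 * Real.log q / X) * PV x := by
    intro x hx
    have : HN χ ε t X (-x) ≤ HN χ ε t X x + (4 * Real.log q / X) * PV x := by
      unfold HN PV
      rw [← integral_const_mul, ← integral_add (ph_v_int2 hc hA x)
        ((ph_v_int2 (g := fun z => (1 + ‖z‖) ^ 2) (by fun_prop) sq_bd x).const_mul _)]
      apply integral_mono (ph_v_int2 hc hA (-x)) ((ph_v_int2 hc hA x).add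
        ((ph_v_int2 (g := fun z => (1 + ‖z‖) ^ 2) (by fun_prop) sq_bd x).const_mul _))
      intro v
      have hpe : ph (((-x : ℝ) : ℂ) + v * I) = ph (x + v * I) := by
        apply ph_norm_eq
        rw [Complex.norm_eq_sqrt_sq_add_sq, Complex.norm_eq_sqrt_sq_add_sq]
        simp
      simp only [Pi.add_apply]
      rw [hpe]
      have h3 := VN_FE hq hχ hp hRH ht0 ht hX hε hx v
      have h4 := mul_le_mul_of_nonneg_right h3 (ph_nonneg (x + v * I))
      refine h4.trans (le_of_eq ?_)
      ring
    linarith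
  have h5 := setIntegral_mono_on (hHi.integrableOn.add hHi.comp_neg.integrableOn)
    ((hHi.integrableOn.const_mul 2).add (PV_int.integrableOn.const_mul (4 * Real.log q / X))) measurableSet_Ioi hpt
  refine h5.trans ?_
  simp only [Pi.add_apply]
  rw [integral_add (hHi.integrableOn.const_mul 2) (PV_int.integrableOn.const_mul _), integral_const_mul,
    integral_const_mul]
  have h6 := mul_le_mul_of_nonneg_left PV_total (show 0 ≤ 4 * Real.log q / X by positivity)
  have : 4 * M2c * Real.log q / X = 4 * Real.log q / X * M2c := by ring
  linarith

end S18


namespace S18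
open MeasureTheory

lemma isOpen_hp : IsOpen {s : ℂ | 1/2 < s.re} := isOpen_lt continuous_const Complex.continuous_re

lemma comp_line_cont {f : ℂ → ℂ} (hf : ContinuousOn f {s : ℂ | 1/2 < s.re}) {s : ℂ} (hs : 1/2 < s.re) (X : ℝ) :
    Continuous (fun v : ℝ => f (s + (v / X : ℝ) * I)) := by
  apply hf.comp_continuous (by fun_prop)
  intro v
  show 1/2 < (s + (v / X : ℝ) * I).re
  simpa using hs

lemma norm_one_add {a b : ℝ} (hX : 1 ≤ b) : |a / b| ≤ |a| := by
  rw [abs_div, abs_of_pos (by linarith : 0 < b)]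
  exact div_le_self (abs_nonneg _) hX

lemma J_integrable {f : ℂ → ℂ} (hd : DifferentiableOn ℂ f {s : ℂ | 1/2 < s.re})
    (hg : ∀ δ > 0, ∃ K : ℝ, 0 < K ∧ ∀ s : ℂ, 1/2 + δ ≤ s.re → ‖f s‖ ≤ K * (1 + |s.im|))
    (x : ℝ) {X : ℝ} (hX : 1 ≤ X) {s : ℂ} (hs : 1/2 < s.re) :
    Integrable (fun v : ℝ => f (s + (v / X : ℝ) * I) * ph (x + v * I)) := by
  obtain ⟨K, hK, h⟩ := hg (s.re - 1/2) (by linarith)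
  apply ph_v_int (comp_line_cont hd.continuousOn hs X) (A := K * (1 + |s.im|))
  intro v
  refine (h _ (by simp)).trans ?_
  rw [mul_assoc]
  gcongr
  simp only [add_im, mul_im, ofReal_re, I_im, mul_one, ofReal_im, I_re, mul_zero, add_zero]
  have h1 := abs_add_le s.im (v / X)
  have h2 := norm_one_add (a := v) hX
  nlinarith [mul_nonneg (abs_nonneg s.im) (abs_nonneg v)]

lemma J_diff {f : ℂ → ℂ} (hd : DifferentiableOn ℂ f {s : ℂ | 1/2 < s.re})
    (hg : ∀ δ > 0, ∃ K : ℝ, 0 < K ∧ ∀ s : ℂ, 1/2 + δ ≤ s.re → ‖f s‖ ≤ K * (1 + |s.im|))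
    (x : ℝ) {X : ℝ} (hX : 1 ≤ X) :
    DifferentiableOn ℂ (fun s => ∫ v : ℝ, f (s + (v / X : ℝ) * I) * ph (x + v * I)) {s : ℂ | 1/2 < s.re} := by
  intro s0 hs0
  replace hs0 : 1/2 < s0.re := hs0
  set η : ℝ := (s0.re - 1/2) / 4 with hη
  have hη0 : 0 < η := by rw [hη]; linarith
  obtain ⟨K, hK, h⟩ := hg η hη0
  set Kc : ℝ := K * (2 + |s0.im| + 2 * η) / η with hKc
  have hKc0 : 0 < Kc := by rw [hKc]; positivity
  have hball : ∀ s ∈ Metric.ball s0 η, 1/2 + 3 * η ≤ s.re := by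
    intro s hs
    have h1 := Complex.abs_re_le_norm (s - s0)
    rw [Metric.mem_ball, dist_eq_norm] at hs
    rw [Complex.sub_re] at h1
    have := (abs_le.1 (h1.trans hs.le)).1
    linarith
  have hballim : ∀ s ∈ Metric.ball s0 η, |s.im| ≤ |s0.im| + η := by
    intro s hs
    have h1 := Complex.abs_im_le_norm (s - s0)
    rw [Metric.mem_ball, dist_eq_norm] at hs
    rw [Complex.sub_im] at h1
    have := abs_sub_abs_le_abs_sub s.im s0.im
    linarith
  have key := hasDerivAt_integral_of_dominated_loc_of_deriv_le (μ := volume) (𝕜 := ℂ)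
    (F := fun s (v : ℝ) => f (s + (v / X : ℝ) * I) * ph (x + v * I))
    (F' := fun s (v : ℝ) => deriv f (s + (v / X : ℝ) * I) * ph (x + v * I))
    (x₀ := s0) (s := Metric.ball s0 η)
    (bound := fun v => ‖((Kc * (1 + |v|) : ℝ) : ℂ) * ph (x + v * I)‖)
    (Metric.ball_mem_nhds s0 hη0) ?_ (J_integrable hd hg x hX hs0) ?_ ?_ ?_ ?_
  · exact key.2.differentiableAt.differentiableWithinAt
  · filter_upwards [isOpen_hp.mem_nhds hs0] with s hs
    exact (J_integrable hd hg x hX hs).aestronglyMeasurable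
  · have hpc := ph_cont
    have := comp_line_cont (hd.deriv isOpen_hp).continuousOn hs0 X
    apply Continuous.aestronglyMeasurable
    fun_prop
  · refine Filter.Eventually.of_forall fun v s hs => ?_
    rw [norm_mul, norm_mul]
    gcongr
    rw [Complex.norm_real, Real.norm_eq_abs, abs_of_nonneg (by positivity)]
    have hre := hball s hs
    have him := hballim s hs
    have hsub : ∀ w ∈ Metric.closedBall (s + (v / X : ℝ) * I) η, 1/2 + η ≤ w.re := by
      intro w hw
      rw [Metric.mem_closedBall, dist_eq_norm] at hw
      have h1 := (Complex.abs_re_le_norm _).trans hw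
      simp at h1
      have := (abs_le.1 h1).1
      linarith
    have hsubim : ∀ w ∈ Metric.closedBall (s + (v / X : ℝ) * I) η, |w.im| ≤ |s0.im| + 2 * η + |v| := by
      intro w hw
      rw [Metric.mem_closedBall, dist_eq_norm] at hw
      have h1 := (Complex.abs_im_le_norm _).trans hw
      simp at h1
      have := abs_sub_abs_le_abs_sub w.im (s.im + v / X)
      have h3 := abs_add_le s.im (v / X)
      have h2 := norm_one_add (a := v) hX
      linarith
    have := Complex.norm_deriv_le_of_forall_mem_sphere_norm_le (f := f) (c := s + (v / X : ℝ) * I)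
      (C := K * ((2 + |s0.im| + 2 * η) * (1 + |v|))) hη0 ?_ ?_
    · refine this.trans (le_of_eq ?_)
      rw [hKc]; ring
    · apply DifferentiableOn.diffContOnCl_ball (U := {s : ℂ | 1/2 < s.re}) hd
      intro w hw
      have := hsub w hw
      show 1/2 < w.re
      linarith
    · intro w hw
      have hw' := Metric.sphere_subset_closedBall hw
      refine (h w (hsub w hw')).trans ?_
      have := hsubim w hw'
      gcongr
      nlinarith [abs_nonneg v, abs_nonneg s0.im, mul_nonneg (abs_nonneg s0.im) (abs_nonneg v)]
  · exact (ph_v_int (g := fun v => ((Kc * (1 + |v|) : ℝ) : ℂ)) (by fun_prop) (A := Kc) (fun v => by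
      rw [Complex.norm_real, Real.norm_eq_abs, abs_of_nonneg (by positivity)]) x).norm
  · refine Filter.Eventually.of_forall fun v s hs => ?_
    have hre := hball s hs
    have h1 : HasDerivAt f (deriv f (s + (v / X : ℝ) * I)) (s + (v / X : ℝ) * I) := by
      apply (hd.differentiableAt (isOpen_hp.mem_nhds _)).hasDerivAt
      show 1/2 < (s + (v / X : ℝ) * I).re
      simp; linarith
    exact (h1.comp_add_const s _).mul_const _

/-- partial Fourier transform of the kernel -/
noncomputable def pft (x l : ℝ) : ℂ := ∫ v : ℝ, (ph (x + v * I) : ℂ) * Complex.exp (-(l * v) * I)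

lemma pft_zero (x : ℝ) {l : ℝ} (hl : 1 ≤ l) : pft x l = 0 :=
  ph_ft_zero x (by rw [abs_of_nonneg (by linarith)]; exact hl)

noncomputable def PP {q : ℕ} [NeZero q] (χ : DirichletCharacter ℂ q) (X x : ℝ) (s : ℂ) : ℂ :=
  ∑ n ∈ Finset.Icc 1 ⌊Real.exp X⌋₊, acoef χ n * (n:ℂ) ^ (-s) * pft x (Real.log n / X)

lemma cpow_line {n : ℕ} (hn : n ≠ 0) (s : ℂ) (y : ℝ) :
    (n:ℂ) ^ (-(s + y * I)) = (n:ℂ) ^ (-s) * Complex.exp (-(Real.log n * y) * I) := by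
  have hn' : (n:ℂ) ≠ 0 := by exact_mod_cast hn
  rw [neg_add, Complex.cpow_add _ _ hn', Complex.cpow_def_of_ne_zero hn' (-(y * I)), Complex.natCast_log]
  congr 2
  ring

lemma J_eq_series {q : ℕ} [NeZero q] {χ : DirichletCharacter ℂ q} {f : ℂ → ℂ}
    (hl : ∀ s : ℂ, 1 < s.re → f s = LSeries (acoef χ) s) (x : ℝ) {X : ℝ} (hX : 1 ≤ X)
    {s : ℂ} (hs : 1 < s.re) :
    ∫ v : ℝ, f (s + (v / X : ℝ) * I) * ph (x + v * I) = PP χ X x s := by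
  have hX0 : 0 < X := by linarith
  have hre : ∀ v : ℝ, (s + (v / X : ℝ) * I).re = s.re := fun v => by simp
  have hsumm : ∀ v : ℝ, LSeriesSummable (acoef χ) (s + (v / X : ℝ) * I) := fun v =>
    LSeriesSummable_of_abscissaOfAbsConv_lt_re (absc_acoef_lt χ (by rw [hre]; exact hs))
  have hsum0 : Summable (fun n => ‖LSeries.term (acoef χ) s n‖) :=
    (LSeriesSummable_of_abscissaOfAbsConv_lt_re (absc_acoef_lt χ hs)).norm
  have hterm : ∀ n (v : ℝ), ‖LSeries.term (acoef χ) (s + (v / X : ℝ) * I) n‖ = ‖LSeries.term (acoef χ) s n‖ := by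
    intro n v
    rw [LSeries.norm_term_eq, LSeries.norm_term_eq, hre]
  have hpc := ph_cont
  have hphi : Integrable (fun v : ℝ => (ph (x + v * I) : ℝ)) := by
    have := (ph_v_int (g := fun _ => 1) continuous_const (A := 1) (fun v => by simp) x).re
    simpa using this
  have hS := hasSum_integral_of_dominated_convergence (μ := volume)
    (F := fun n (v : ℝ) => LSeries.term (acoef χ) (s + (v / X : ℝ) * I) n * ph (x + v * I))
    (f := fun v : ℝ => f (s + (v / X : ℝ) * I) * ph (x + v * I))
    (fun n v => ‖LSeries.term (acoef χ) s n‖ * ph (x + v * I)) ?_ ?_ ?_ ?_ ?_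
  · rw [← hS.tsum_eq]
    rw [tsum_eq_sum (s := Finset.Icc 1 ⌊Real.exp X⌋₊)]
    · unfold PP
      apply Finset.sum_congr rfl
      intro n hn
      have hn0 : n ≠ 0 := by have := (Finset.mem_Icc.1 hn).1; omega
      unfold pft
      rw [← integral_const_mul]
      congr 1
      ext v
      rw [LSeries.term_of_ne_zero hn0, div_eq_mul_inv, ← Complex.cpow_neg, cpow_line hn0]
      have : (-(((Real.log n / X : ℝ):ℂ) * v) * I) = -(Real.log n * ((v / X : ℝ):ℂ)) * I := by
        push_cast; ring
      rw [this]
      ring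
    · intro n hn
      rcases Nat.eq_zero_or_pos n with h0 | h0
      · simp [h0]
      have hn0 : n ≠ 0 := by omega
      have hbig : Real.exp X < n := by
        by_contra hle
        push Not at hle
        exact hn (Finset.mem_Icc.2 ⟨h0, Nat.le_floor hle⟩)
      have hlog : 1 ≤ Real.log n / X := by
        rw [le_div_iff₀ hX0, one_mul, Real.le_log_iff_exp_le (by positivity)]
        exact hbig.le
      have hz := pft_zero x hlog
      have : ∫ v : ℝ, LSeries.term (acoef χ) (s + (v / X : ℝ) * I) n * ph (x + v * I) =
          (acoef χ n * (n:ℂ) ^ (-s)) * pft x (Real.log n / X) := by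
        unfold pft
        rw [← integral_const_mul]
        congr 1
        ext v
        rw [LSeries.term_of_ne_zero hn0, div_eq_mul_inv, ← Complex.cpow_neg, cpow_line hn0]
        have : (-(((Real.log n / X : ℝ):ℂ) * v) * I) = -(Real.log n * ((v / X : ℝ):ℂ)) * I := by
          push_cast; ring
        rw [this]
        ring
      rw [this, hz, mul_zero]
  · intro n
    apply Continuous.aestronglyMeasurable
    rcases Nat.eq_zero_or_pos n with h0 | h0
    · simp only [h0, LSeries.term_zero, zero_mul]; exact continuous_const
    have hn0 : n ≠ 0 := by omega
    simp only [LSeries.term_of_ne_zero hn0, div_eq_mul_inv, ← Complex.cpow_neg, cpow_line hn0]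
    fun_prop
  · intro n
    refine Filter.Eventually.of_forall fun v => ?_
    rw [norm_mul, hterm, Complex.norm_real, Real.norm_eq_abs, abs_of_nonneg (ph_nonneg _)]
  · refine Filter.Eventually.of_forall fun v => hsum0.mul_right _
  · simp only [tsum_mul_right]
    exact hphi.const_mul _
  · refine Filter.Eventually.of_forall fun v => ?_
    rw [hl _ (by rw [hre]; exact hs)]
    exact (hsumm v).hasSum.mul_right _

lemma J_eq {q : ℕ} [NeZero q] {χ : DirichletCharacter ℂ q} {f : ℂ → ℂ}
    (hd : DifferentiableOn ℂ f {s : ℂ | 1/2 < s.re})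
    (hg : ∀ δ > 0, ∃ K : ℝ, 0 < K ∧ ∀ s : ℂ, 1/2 + δ ≤ s.re → ‖f s‖ ≤ K * (1 + |s.im|))
    (hl : ∀ s : ℂ, 1 < s.re → f s = LSeries (acoef χ) s) (x : ℝ) {X : ℝ} (hX : 1 ≤ X)
    {s : ℂ} (hs : 1/2 < s.re) :
    ∫ v : ℝ, f (s + (v / X : ℝ) * I) * ph (x + v * I) = PP χ X x s := by
  have h1 := (J_diff hd hg x hX).analyticOnNhd isOpen_hp
  have h2 : AnalyticOnNhd ℂ (PP χ X x) {s : ℂ | 1/2 < s.re} := by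
    apply DifferentiableOn.analyticOnNhd _ isOpen_hp
    apply Differentiable.differentiableOn
    unfold PP
    apply Differentiable.fun_sum
    intro n hn
    have hn0 : (n:ℂ) ≠ 0 := by
      have := (Finset.mem_Icc.1 hn).1
      exact_mod_cast (by omega : n ≠ 0)
    apply Differentiable.mul_const
    apply Differentiable.const_mul
    intro z
    exact (differentiableAt_id.neg).const_cpow (Or.inl hn0)
  have hpre : IsPreconnected {s : ℂ | 1/2 < s.re} := (convex_halfSpace_re_gt (1/2)).isPreconnected
  refine AnalyticOnNhd.eqOn_of_preconnected_of_eventuallyEq (𝕜 := ℂ) h1 h2 hpre (z₀ := 2) ?_ ?_ hs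
  · show 1/2 < (2:ℂ).re
    norm_num
  · have : {s : ℂ | 1 < s.re} ∈ nhds (2:ℂ) :=
      (isOpen_lt continuous_const Complex.continuous_re).mem_nhds (by show 1 < (2:ℂ).re; norm_num)
    filter_upwards [this] with w hw
    exact J_eq_series hl x hX hw

end S18


namespace S18
open MeasureTheory

noncomputable def p0 (x : ℝ) : ℝ := ∫ v : ℝ, ph (x + v * I)

lemma one_bd (z : ℂ) : |(1:ℝ)| ≤ 1 * (1 + ‖z‖) ^ 2 := by
  rw [abs_one, one_mul]
  exact one_le_pow₀ (by linarith [norm_nonneg z])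

lemma ph_vint (x : ℝ) : Integrable (fun v : ℝ => ph (x + v * I)) := by
  have := ph_v_int2 (g := fun _ => 1) continuous_const one_bd x
  simpa using this

lemma p0_int : Integrable p0 := by
  have := (ph_prod_int (g := fun _ => 1) continuous_const one_bd).integral_prod_left
  simp only [one_mul] at this
  exact this

lemma p0_nonneg (x : ℝ) : 0 ≤ p0 x := integral_nonneg fun v => ph_nonneg _

lemma p0_half : ∫ x in Set.Ioi (0:ℝ), p0 x = 1 / 2 := by
  have h1 := ph_fubini (g := fun _ => 1) continuous_const one_bd
  simp only [one_mul] at h1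
  rw [ph_integral] at h1
  have h2 := integral_fold p0_int
  have h3 : ∀ x, p0 (-x) = p0 x := by
    intro x
    unfold p0
    congr 1
    ext v
    apply ph_norm_eq
    rw [Complex.norm_eq_sqrt_sq_add_sq, Complex.norm_eq_sqrt_sq_add_sq]
    simp
  simp only [h3] at h2
  have h4 : ∫ x in Set.Ioi (0:ℝ), (p0 x + p0 x) = 2 * ∫ x in Set.Ioi (0:ℝ), p0 x := by
    rw [← integral_const_mul]; congr 1; ext x; ring
  rw [h4] at h2
  have h5 : ∫ x, p0 x = 1 := by rw [h1]; rfl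
  linarith

lemma p0_le_PV (x : ℝ) : p0 x ≤ PV x := by
  unfold p0 PV
  apply integral_mono (ph_vint x) (ph_v_int2 (g := fun z => (1 + ‖z‖) ^ 2) (by fun_prop) sq_bd x)
  intro v
  have := one_le_pow₀ (n := 2) (show 1 ≤ 1 + ‖(x + v * I : ℂ)‖ by linarith [norm_nonneg (x + v * I : ℂ)])
  have h2 := ph_nonneg (x + v * I)
  show ph (x + v * I) ≤ _
  nlinarith

lemma norm_phase (l v : ℝ) : ‖Complex.exp (-(l * v) * I)‖ = 1 := by
  have : (-(l * v) * I : ℂ) = ((-(l * v) : ℝ) : ℂ) * I := by push_cast; ring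
  rw [this, Complex.norm_exp_ofReal_mul_I]

lemma norm_pft_le (x l : ℝ) : ‖pft x l‖ ≤ p0 x := by
  unfold pft p0
  refine (norm_integral_le_integral_norm _).trans (le_of_eq ?_)
  congr 1
  ext v
  rw [norm_mul, norm_phase, mul_one, Complex.norm_real, Real.norm_eq_abs, abs_of_nonneg (ph_nonneg _)]

lemma pft_int (l : ℝ) : Integrable (fun x => pft x l) := by
  have h1 := ph_prod_int (g := fun _ => 1) continuous_const one_bd
  have hpc := ph_cont
  have h2 : Integrable (fun p : ℝ × ℝ => (ph (p.1 + p.2 * I) : ℂ) * Complex.exp (-(l * p.2) * I)) (volume.prod volume) := by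
    refine h1.mono' (by fun_prop) (Filter.Eventually.of_forall fun p => ?_)
    rw [norm_mul, norm_phase, mul_one, Complex.norm_real, Real.norm_eq_abs, abs_of_nonneg (ph_nonneg _), one_mul]
  exact h2.integral_prod_left

lemma epft_int {l : ℝ} (hl : 0 ≤ l) :
    IntegrableOn (fun x : ℝ => (Real.exp (-(x * l)) : ℂ) * pft x l) (Set.Ioi 0) := by
  apply Integrable.bdd_mul (c := 1) (pft_int l).integrableOn
  · apply Continuous.aestronglyMeasurable; fun_prop
  · refine (ae_restrict_iff' measurableSet_Ioi).2 (Filter.Eventually.of_forall fun x hx => ?_)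
    rw [Complex.norm_real, Real.norm_eq_abs, abs_of_pos (Real.exp_pos _)]
    apply Real.exp_le_one_iff.2
    have := mul_nonneg (le_of_lt hx) hl
    linarith

noncomputable def ww (l : ℝ) : ℂ := 2 * ∫ x in Set.Ioi (0:ℝ), (Real.exp (-(x * l)) : ℂ) * pft x l

lemma ww_le {l : ℝ} (hl : 0 ≤ l) : ‖ww l‖ ≤ 1 := by
  unfold ww
  rw [norm_mul]
  have : ‖∫ x in Set.Ioi (0:ℝ), (Real.exp (-(x * l)) : ℂ) * pft x l‖ ≤ 1 / 2 := by
    rw [← p0_half]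
    apply norm_integral_le_of_norm_le p0_int.integrableOn
    refine (ae_restrict_iff' measurableSet_Ioi).2 (Filter.Eventually.of_forall fun x hx => ?_)
    rw [norm_mul, Complex.norm_real, Real.norm_eq_abs, abs_of_pos (Real.exp_pos _)]
    have h1 : Real.exp (-(x * l)) ≤ 1 := by
      apply Real.exp_le_one_iff.2
      have := mul_nonneg (le_of_lt hx) hl
      linarith
    have h2 := norm_pft_le x l
    have := norm_nonneg (pft x l)
    nlinarith [Real.exp_pos (-(x * l))]
  rw [Complex.norm_ofNat]
  linarith

lemma ww_zero {l : ℝ} (hl : 1 ≤ l) : ww l = 0 := by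
  unfold ww
  simp [pft_zero _ hl]

lemma PP_shift {q : ℕ} [NeZero q] (χ : DirichletCharacter ℂ q) (X x t : ℝ) :
    PP χ X x (1 / 2 + t * I + ((x / X : ℝ) : ℂ)) = ∑ n ∈ Finset.Icc 1 ⌊Real.exp X⌋₊,
      acoef χ n * (n:ℂ) ^ (-(1 / 2 + t * I)) * ((Real.exp (-(x * (Real.log n / X))) : ℂ) * pft x (Real.log n / X)) := by
  unfold PP
  apply Finset.sum_congr rfl
  intro n hn
  have hn0 : n ≠ 0 := by have := (Finset.mem_Icc.1 hn).1; omega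
  have hn' : (n:ℂ) ≠ 0 := by exact_mod_cast hn0
  have : (n:ℂ) ^ (-(1 / 2 + t * I + ((x / X : ℝ) : ℂ))) = (n:ℂ) ^ (-(1 / 2 + t * I)) * (Real.exp (-(x * (Real.log n / X))) : ℂ) := by
    rw [neg_add, Complex.cpow_add _ _ hn', Complex.cpow_def_of_ne_zero hn' (-((x / X : ℝ) : ℂ)), ← Complex.natCast_log]
    congr 1
    rw [Complex.ofReal_exp]
    congr 1
    push_cast; ring
  rw [this]; ring

noncomputable def DPoly {q : ℕ} [NeZero q] (χ : DirichletCharacter ℂ q) (X t : ℝ) : ℂ :=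
  ∑ n ∈ Finset.Icc 1 ⌊Real.exp X⌋₊, acoef χ n * (n:ℂ) ^ (-(1 / 2 + t * I)) * ww (Real.log n / X)

lemma PP_integral {q : ℕ} [NeZero q] (χ : DirichletCharacter ℂ q) {X : ℝ} (hX : 1 ≤ X) (t : ℝ) :
    IntegrableOn (fun x : ℝ => PP χ X x (1 / 2 + t * I + ((x / X : ℝ) : ℂ))) (Set.Ioi 0) ∧
    2 * ∫ x in Set.Ioi (0:ℝ), PP χ X x (1 / 2 + t * I + ((x / X : ℝ) : ℂ)) = DPoly χ X t := by
  have hi : ∀ n ∈ Finset.Icc 1 ⌊Real.exp X⌋₊, IntegrableOn (fun x : ℝ =>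
      acoef χ n * (n:ℂ) ^ (-(1 / 2 + t * I)) * ((Real.exp (-(x * (Real.log n / X))) : ℂ) * pft x (Real.log n / X))) (Set.Ioi 0) := by
    intro n hn
    apply Integrable.const_mul
    apply epft_int
    exact div_nonneg (Real.log_natCast_nonneg n) (by linarith)
  simp only [PP_shift]
  refine ⟨integrable_finsetSum _ hi, ?_⟩
  rw [integral_finsetSum _ hi, Finset.mul_sum]
  unfold DPoly
  apply Finset.sum_congr rfl
  intro n hn
  rw [integral_const_mul]
  unfold ww
  ring

lemma norm_PP_shift_le {q : ℕ} [NeZero q] (χ : DirichletCharacter ℂ q) {X : ℝ} (hX : 1 ≤ X) (t : ℝ) {x : ℝ} (hx : 0 < x) :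
    ‖PP χ X x (1 / 2 + t * I + ((x / X : ℝ) : ℂ))‖ ≤
      (∑ n ∈ Finset.Icc 1 ⌊Real.exp X⌋₊, ‖acoef χ n * (n:ℂ) ^ (-(1 / 2 + t * I))‖) * PV x := by
  rw [PP_shift]
  refine (norm_sum_le _ _).trans ?_
  rw [Finset.sum_mul]
  apply Finset.sum_le_sum
  intro n _
  rw [norm_mul]
  gcongr
  rw [norm_mul, Complex.norm_real, Real.norm_eq_abs, abs_of_pos (Real.exp_pos _)]
  have h1 : Real.exp (-(x * (Real.log n / X))) ≤ 1 := by
    apply Real.exp_le_one_iff.2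
    have := mul_nonneg hx.le (div_nonneg (Real.log_natCast_nonneg n) (by linarith : 0 ≤ X))
    linarith
  have h2 := (norm_pft_le x (Real.log n / X)).trans (p0_le_PV x)
  have := norm_nonneg (pft x (Real.log n / X))
  nlinarith [Real.exp_pos (-(x * (Real.log n / X)))]

lemma max_trick {a N : ℝ} (hN : 0 < N) : max a (-N) ≤ a + a ^ 2 / N := by
  apply max_le
  · have : 0 ≤ a ^ 2 / N := by positivity
    linarith
  · rw [← sub_nonneg]
    have : a + a ^ 2 / N - -N = (a ^ 2 + a * N + N ^ 2) / N := by field_simp; ring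
    rw [this]
    apply div_nonneg _ hN.le
    nlinarith [sq_nonneg (a + N), sq_nonneg a, sq_nonneg N]

lemma HN_le {q : ℕ} [NeZero q] {χ : DirichletCharacter ℂ q} (hχ : χ ≠ 1) (hp : χ.IsPrimitive)
    (hRH : dirichletRH χ) (t : ℝ) {X : ℝ} (hX : 1 ≤ X) {f : ℂ → ℂ}
    (hd : DifferentiableOn ℂ f {s : ℂ | 1/2 < s.re})
    (he : ∀ s : ℂ, 1/2 < s.re → Complex.exp (f s) = DirichletCharacter.LFunction χ s)
    (hl : ∀ s : ℂ, 1 < s.re → f s = LSeries (acoef χ) s) {δ : ℝ} (hδ : 0 < δ) :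
    ∃ K : ℝ, 0 ≤ K ∧ ∀ N > 0, ∀ x : ℝ, δ < x → HN χ (Real.exp (-N)) t X x ≤
      (PP χ X x (1 / 2 + t * I + ((x / X : ℝ) : ℂ))).re + K / N * PV x := by
  have hX0 : 0 < X := by linarith
  have hXc : (X:ℂ) ≠ 0 := by exact_mod_cast hX0.ne'
  obtain ⟨K, hK, hgr⟩ := logL_growth' hχ hd he hl (δ := δ / X) (by positivity)
  refine ⟨(K * (1 + |t|)) ^ 2, by positivity, ?_⟩
  intro N hN x hx
  have hx0 : 0 < x := hδ.trans hx
  have hre : 1 / 2 < (1 / 2 + t * I + ((x / X : ℝ) : ℂ)).re := by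
    have : 0 < x / X := by positivity
    simp
    positivity
  have hg : ∀ δ > 0, ∃ K : ℝ, 0 < K ∧ ∀ s : ℂ, 1/2 + δ ≤ s.re → ‖f s‖ ≤ K * (1 + |s.im|) :=
    fun δ hδ => logL_growth' hχ hd he hl hδ
  rw [← J_eq hd hg hl x hX hre]
  have hJi := J_integrable hd hg x hX hre
  have hJre : Integrable (fun v : ℝ => (f (1 / 2 + t * I + ((x / X : ℝ) : ℂ) + (v / X : ℝ) * I) * ph (x + v * I)).re) := hJi.re
  have hre2 : (∫ v : ℝ, f (1 / 2 + t * I + ((x / X : ℝ) : ℂ) + (v / X : ℝ) * I) * ph (x + v * I)).re =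
      ∫ v : ℝ, (f (1 / 2 + t * I + ((x / X : ℝ) : ℂ) + (v / X : ℝ) * I) * ph (x + v * I)).re :=
    (integral_re hJi).symm
  rw [hre2]
  have hPVi := (ph_v_int2 (g := fun z => (1 + ‖z‖) ^ 2) (by fun_prop) sq_bd x)
  unfold HN PV
  rw [← integral_const_mul, ← integral_add hJre (hPVi.const_mul _)]
  obtain ⟨A, hA⟩ := VN_bound hχ hp hRH t hX (Real.exp_pos (-N))
  have hc : Continuous (fun z : ℂ => VN χ (Real.exp (-N)) (1 / 2 + t * I + z / X)) :=
    (VN_cont hχ (Real.exp_pos _)).comp (by fun_prop)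
  apply integral_mono (ph_v_int2 hc hA x) (hJre.add (hPVi.const_mul _))
  intro v
  simp only [Pi.add_apply]
  have e1 : (1 / 2 + t * I + (x + v * I) / X : ℂ) = 1 / 2 + t * I + ((x / X : ℝ) : ℂ) + (v / X : ℝ) * I := by
    push_cast; field_simp; ring
  rw [e1]
  set s : ℂ := 1 / 2 + t * I + ((x / X : ℝ) : ℂ) + (v / X : ℝ) * I with hs
  have hsre : s.re = 1 / 2 + x / X := by simp [hs]
  have hsim : s.im = t + v / X := by simp [hs]
  have hsgt : 1 / 2 < s.re := by rw [hsre]; have : 0 < x / X := by positivity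
                                 linarith
  have hV : VN χ (Real.exp (-N)) s = max (f s).re (-N) := by
    unfold VN
    rw [← he s hsgt, Complex.norm_exp]
    rcases le_total (f s).re (-N) with h | h
    · rw [max_eq_right h, max_eq_right (Real.exp_le_exp.2 h), Real.log_exp]
    · rw [max_eq_left h, max_eq_left (Real.exp_le_exp.2 h), Real.log_exp]
  have hb : (f s).re ^ 2 ≤ (K * (1 + |t|)) ^ 2 * (1 + ‖(x + v * I : ℂ)‖) ^ 2 := by
    rw [← mul_pow, ← sq_abs]
    apply pow_le_pow_left₀ (abs_nonneg _)
    refine (Complex.abs_re_le_norm _).trans ((hgr s ?_).trans ?_)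
    · rw [hsre]; gcongr
    · rw [hsim, mul_assoc]
      gcongr
      have h1 := abs_add_le t (v / X)
      have h2 := norm_one_add (a := v) hX
      have h3 : |v| ≤ ‖(x + v * I : ℂ)‖ := by
        have := Complex.abs_im_le_norm (x + v * I)
        simpa using this
      nlinarith [mul_nonneg (abs_nonneg t) (norm_nonneg (x + v * I : ℂ))]
  have hmain : VN χ (Real.exp (-N)) s ≤ (f s).re + (K * (1 + |t|)) ^ 2 / N * (1 + ‖(x + v * I : ℂ)‖) ^ 2 := by
    rw [hV]
    refine (max_trick hN).trans ?_
    have : (f s).re ^ 2 / N ≤ (K * (1 + |t|)) ^ 2 * (1 + ‖(x + v * I : ℂ)‖) ^ 2 / N := by gcongr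
    rw [div_mul_eq_mul_div]
    linarith
  have h4 := mul_le_mul_of_nonneg_right hmain (ph_nonneg (x + v * I))
  refine h4.trans (le_of_eq ?_)
  simp
  ring

lemma HN_le_small {q : ℕ} [NeZero q] {χ : DirichletCharacter ℂ q} (hχ : χ ≠ 1) (hp : χ.IsPrimitive)
    (hRH : dirichletRH χ) (t : ℝ) {X : ℝ} (hX : 1 ≤ X) :
    ∃ A : ℝ, 0 ≤ A ∧ ∀ N > 0, ∀ x : ℝ, HN χ (Real.exp (-N)) t X x ≤ A * PV x := by
  obtain ⟨A, hA, h⟩ := exists_growth hχ hp hRH t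
  refine ⟨A, hA, fun N hN x => ?_⟩
  have hX0 : 0 < X := by linarith
  have hPVi := (ph_v_int2 (g := fun z => (1 + ‖z‖) ^ 2) (by fun_prop) sq_bd x)
  unfold HN PV
  rw [← integral_const_mul]
  obtain ⟨A', hA'⟩ := VN_bound hχ hp hRH t hX (Real.exp_pos (-N))
  have hc : Continuous (fun z : ℂ => VN χ (Real.exp (-N)) (1 / 2 + t * I + z / X)) :=
    (VN_cont hχ (Real.exp_pos _)).comp (by fun_prop)
  apply integral_mono (ph_v_int2 hc hA' x) (hPVi.const_mul _)
  intro v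
  simp only
  rw [← mul_assoc]
  apply mul_le_mul_of_nonneg_right _ (ph_nonneg _)
  set z : ℂ := x + v * I
  have h1 := h (z / X)
  have h2 : ‖z / (X:ℂ)‖ ≤ ‖z‖ := by
    rw [norm_div, Complex.norm_real, Real.norm_eq_abs, abs_of_pos hX0]
    exact div_le_self (norm_nonneg _) hX
  have h3 : A * (1 + ‖z / (X:ℂ)‖) ^ 2 ≤ A * (1 + ‖z‖) ^ 2 := by gcongr
  unfold VN
  rw [← Real.log_exp (A * (1 + ‖z‖) ^ 2)]
  apply Real.log_le_log (lt_max_of_lt_right (Real.exp_pos _))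
  apply max_le
  · exact h1.trans (Real.exp_le_exp.2 h3)
  · apply Real.exp_le_exp.2
    have : 0 ≤ A * (1 + ‖z‖) ^ 2 := by positivity
    linarith

theorem partA {q : ℕ} [NeZero q] (hq : 3 ≤ q) {χ : DirichletCharacter ℂ q} (hχ : χ ≠ 1) (hp : χ.IsPrimitive)
    (hRH : dirichletRH χ) {t : ℝ} (ht0 : 0 ≤ t) (ht : t ≤ q + 1) {X : ℝ} (hX : 1 ≤ X) :
    ‖DirichletCharacter.LFunction χ (1 / 2 + t * I)‖ ≤
      Real.exp ((DPoly χ X t).re + 4 * M2c * Real.log q / X) := by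
  by_cases hL : DirichletCharacter.LFunction χ (1 / 2 + t * I) = 0
  · rw [hL, norm_zero]; positivity
  rw [← Real.log_le_iff_le_exp (norm_pos_iff.2 hL)]
  obtain ⟨f, hd, he, hl⟩ := exists_logL hχ hRH
  obtain ⟨hPi, hPe⟩ := PP_integral χ hX t
  have hPre : (∫ x in Set.Ioi (0:ℝ), (PP χ X x (1 / 2 + t * I + ((x / X : ℝ) : ℂ))).re) * 2 = (DPoly χ X t).re := by
    have := integral_re hPi
    rw [← hPe, mul_comm]
    simp only [RCLike.re_eq_complex_re] at this
    rw [this]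
    simp
  obtain ⟨A, hA0, hA⟩ := HN_le_small hχ hp hRH t hX
  obtain ⟨B, hB0, hB⟩ := ph_v_sup
  set D : ℝ := ∑ n ∈ Finset.Icc 1 ⌊Real.exp X⌋₊, ‖acoef χ n * (n:ℂ) ^ (-(1 / 2 + t * I))‖ with hD
  have hD0 : 0 ≤ D := Finset.sum_nonneg fun _ _ => norm_nonneg _
  apply le_of_forall_pos_le_add
  intro η hη
  -- choose δ
  obtain ⟨δ, hδ, hδ1⟩ : ∃ δ : ℝ, 0 < δ ∧ (A + D) * B * δ ≤ η / 4 := by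
    refine ⟨η / 4 / ((A + D) * B + 1), by positivity, ?_⟩
    rw [mul_div_assoc', div_le_iff₀ (by positivity)]
    nlinarith [mul_nonneg (add_nonneg hA0 hD0) hB0]
  obtain ⟨K, hK0, hK⟩ := HN_le hχ hp hRH t hX hd he hl hδ
  obtain ⟨N, hN, hN1⟩ : ∃ N : ℝ, 0 < N ∧ K / N * M2c ≤ η / 4 := by
    refine ⟨4 * (K * M2c + 1) / η, by have := M2c_nonneg; positivity, ?_⟩
    have := M2c_nonneg
    have hpos : 0 < K * M2c + 1 := by positivity
    rw [div_div_eq_mul_div, div_mul_eq_mul_div, div_le_div_iff₀ (by positivity) (by norm_num)]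
    nlinarith
  have hfold := fold_main hq hχ hp hRH ht0 ht hX (Real.exp_pos (-N)) hL
  have hHi := HN_int hχ hp hRH t hX (Real.exp_pos (-N))
  have hunion : Set.Ioc (0:ℝ) δ ∪ Set.Ioi δ = Set.Ioi 0 := Set.Ioc_union_Ioi_eq_Ioi hδ.le
  have hdisj : Disjoint (Set.Ioc (0:ℝ) δ) (Set.Ioi δ) := Set.Ioc_disjoint_Ioi le_rfl
  have hPi' := hPi.re
  simp only [RCLike.re_eq_complex_re] at hPi'
  have hPi1 : IntegrableOn (fun x : ℝ => (PP χ X x (1 / 2 + t * I + ((x / X : ℝ) : ℂ))).re) (Set.Ioi 0) := hPi'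
  have s1 : ∫ x in Set.Ioi (0:ℝ), HN χ (Real.exp (-N)) t X x =
      (∫ x in Set.Ioc (0:ℝ) δ, HN χ (Real.exp (-N)) t X x) + ∫ x in Set.Ioi δ, HN χ (Real.exp (-N)) t X x := by
    rw [← hunion, setIntegral_union hdisj measurableSet_Ioi hHi.integrableOn hHi.integrableOn]
  have s2 : ∫ x in Set.Ioi (0:ℝ), (PP χ X x (1 / 2 + t * I + ((x / X : ℝ) : ℂ))).re =
      (∫ x in Set.Ioc (0:ℝ) δ, (PP χ X x (1 / 2 + t * I + ((x / X : ℝ) : ℂ))).re) +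
        ∫ x in Set.Ioi δ, (PP χ X x (1 / 2 + t * I + ((x / X : ℝ) : ℂ))).re := by
    rw [← hunion, setIntegral_union hdisj measurableSet_Ioi
      (hPi1.mono_set Set.Ioc_subset_Ioi_self) (hPi1.mono_set (Set.Ioi_subset_Ioi hδ.le))]
  have hvol : ∀ c : ℝ, ∫ _ in Set.Ioc (0:ℝ) δ, c = c * δ := by
    intro c
    rw [setIntegral_const]
    simp [measureReal_def, hδ.le, mul_comm]
  have s3 : ∫ x in Set.Ioc (0:ℝ) δ, HN χ (Real.exp (-N)) t X x ≤ (A * B) * δ := by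
    rw [← hvol]
    apply setIntegral_mono_on hHi.integrableOn (integrableOn_const (by simp)) measurableSet_Ioc
    intro x hx
    exact (hA N hN x).trans (mul_le_mul_of_nonneg_left (hB x) hA0)
  have s4 : -((D * B) * δ) ≤ ∫ x in Set.Ioc (0:ℝ) δ, (PP χ X x (1 / 2 + t * I + ((x / X : ℝ) : ℂ))).re := by
    rw [← neg_mul, ← hvol]
    apply setIntegral_mono_on (integrableOn_const (by simp)) (hPi1.mono_set Set.Ioc_subset_Ioi_self) measurableSet_Ioc
    intro x hx
    have h1 := norm_PP_shift_le χ hX t hx.1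
    have h2 := (Complex.abs_re_le_norm _).trans (h1.trans (mul_le_mul_of_nonneg_left (hB x) hD0))
    exact (abs_le.1 h2).1
  have s5 : ∫ x in Set.Ioi δ, HN χ (Real.exp (-N)) t X x ≤
      (∫ x in Set.Ioi δ, (PP χ X x (1 / 2 + t * I + ((x / X : ℝ) : ℂ))).re) + K / N * M2c := by
    have h1 := setIntegral_mono_on hHi.integrableOn ((hPi1.mono_set (Set.Ioi_subset_Ioi hδ.le)).add
      (PV_int.integrableOn.const_mul (K / N))) measurableSet_Ioi (fun x hx => hK N hN x hx)
    simp only [Pi.add_apply] at h1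
    rw [integral_add (hPi1.mono_set (Set.Ioi_subset_Ioi hδ.le)) (PV_int.integrableOn.const_mul (K / N)),
      integral_const_mul] at h1
    refine h1.trans ?_
    gcongr
    refine le_trans ?_ PV_total
    apply setIntegral_mono_set PV_int.integrableOn (Filter.Eventually.of_forall PV_nonneg)
    exact (Set.Ioi_subset_Ioi hδ.le).eventuallyLE
  nlinarith

end S18


namespace S18

/-- primes up to `N` -/
def prs (N : ℕ) : Finset ℕ := (Finset.Ioc 0 N).filter Nat.Prime

lemma mem_prs {N p : ℕ} : p ∈ prs N ↔ p ≤ N ∧ p.Prime := by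
  simp only [prs, Finset.mem_filter, Finset.mem_Ioc]
  exact ⟨fun h => ⟨h.1.2, h.2⟩, fun h => ⟨⟨h.2.pos, h.1⟩, h.2⟩⟩

lemma mw_dyadic (m : ℕ) : ∑ p ∈ prs (2 ^ m), Real.log p / p ≤ m * (2 * Real.log 4) := by
  induction m with
  | zero =>
    have : prs (2 ^ 0) = ∅ := by
      ext p; simp only [mem_prs, pow_zero, Finset.notMem_empty, iff_false]
      rintro ⟨h1, h2⟩
      have := h2.two_le
      omega
    rw [this]; simp
  | succ m ih =>
    have hsub : prs (2 ^ m) ⊆ prs (2 ^ (m + 1)) := by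
      intro p; rw [mem_prs, mem_prs]
      rintro ⟨h1, h2⟩
      refine ⟨h1.trans ?_, h2⟩
      exact Nat.pow_le_pow_right (by norm_num) (by omega)
    rw [← Finset.sum_sdiff hsub]
    have h1 : ∑ p ∈ prs (2 ^ (m + 1)) \ prs (2 ^ m), Real.log p / p ≤ 2 * Real.log 4 := by
      have h2 : ∀ p ∈ prs (2 ^ (m + 1)) \ prs (2 ^ m), Real.log p / p ≤ Real.log p / (2:ℝ) ^ m := by
        intro p hp
        rw [Finset.mem_sdiff, mem_prs, mem_prs] at hp
        have : 2 ^ m < p := by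
          by_contra h
          exact hp.2 ⟨by omega, hp.1.2⟩
        have h3 : ((2:ℝ)) ^ m ≤ p := by exact_mod_cast this.le
        apply div_le_div_of_nonneg_left (Real.log_natCast_nonneg p) (by positivity) h3
      refine (Finset.sum_le_sum h2).trans ?_
      have h4 : ∑ p ∈ prs (2 ^ (m + 1)) \ prs (2 ^ m), Real.log p / (2:ℝ) ^ m ≤ ∑ p ∈ prs (2 ^ (m + 1)), Real.log p / (2:ℝ) ^ m := by
        apply Finset.sum_le_sum_of_subset_of_nonneg Finset.sdiff_subset
        intro p _ _
        have := Real.log_natCast_nonneg p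
        positivity
      refine h4.trans ?_
      rw [← Finset.sum_div]
      have h5 := Chebyshev.theta_le_log4_mul_x (x := (2:ℝ) ^ (m + 1)) (by positivity)
      have h6 : Chebyshev.theta ((2:ℝ) ^ (m + 1)) = ∑ p ∈ prs (2 ^ (m + 1)), Real.log p := by
        unfold Chebyshev.theta prs
        have : ⌊(2:ℝ) ^ (m + 1)⌋₊ = 2 ^ (m + 1) := by
          have : ((2:ℝ)) ^ (m + 1) = ((2 ^ (m + 1) : ℕ) : ℝ) := by push_cast; ring
          rw [this, Nat.floor_natCast]
        rw [this]
      rw [← h6, div_le_iff₀ (by positivity)]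
      refine h5.trans (le_of_eq ?_)
      ring
    push_cast
    linarith

lemma prs_mono {M N : ℕ} (h : M ≤ N) : prs M ⊆ prs N := by
  intro p; rw [mem_prs, mem_prs]; exact fun h' => ⟨h'.1.trans h, h'.2⟩

/-- weak Mertens -/
lemma mw {N : ℕ} (hN : 2 ≤ N) : ∑ p ∈ prs N, Real.log p / p ≤ 8 * Real.log N := by
  set m := Nat.log 2 N + 1 with hm
  have h1 : N ≤ 2 ^ m := (Nat.lt_pow_succ_log_self (by norm_num) N).le
  have h2 : ∑ p ∈ prs N, Real.log p / p ≤ ∑ p ∈ prs (2 ^ m), Real.log p / p := by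
    apply Finset.sum_le_sum_of_subset_of_nonneg (prs_mono h1)
    intro p _ _
    have := Real.log_natCast_nonneg p
    positivity
  refine (h2.trans (mw_dyadic m)).trans ?_
  have h3 : 2 ^ (Nat.log 2 N) ≤ N := Nat.pow_log_le_self 2 (by omega)
  have h4 : (Nat.log 2 N : ℝ) * Real.log 2 ≤ Real.log N := by
    rw [← Real.log_pow]
    apply Real.log_le_log (by positivity)
    exact_mod_cast h3
  have h5 : Real.log 2 ≤ Real.log N := Real.log_le_log (by norm_num) (by exact_mod_cast hN)
  have h6 : Real.log 4 = 2 * Real.log 2 := by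
    rw [show (4:ℝ) = 2 ^ 2 by norm_num, Real.log_pow]; norm_num
  rw [h6, hm]
  push_cast
  nlinarith

/-- sums of `1/p` over `a < log p ≤ X` -/
lemma recip_range {a X : ℝ} (ha : 0 < a) (hX : a ≤ X) (S : Finset ℕ)
    (hS : ∀ p ∈ S, p.Prime ∧ a ≤ Real.log p ∧ Real.log p ≤ X) : ∑ p ∈ S, (1:ℝ) / p ≤ 8 * X / a := by
  rcases S.eq_empty_or_nonempty with rfl | ⟨p0, hp0⟩
  · have : 0 < X := by linarith
    simp; positivity
  have hsub : S ⊆ prs ⌊Real.exp X⌋₊ := by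
    intro p hp
    rw [mem_prs]
    refine ⟨Nat.le_floor ?_, (hS p hp).1⟩
    rw [← Real.log_le_iff_le_exp (by exact_mod_cast (hS p hp).1.pos)]
    exact (hS p hp).2.2
  have hN : 2 ≤ ⌊Real.exp X⌋₊ := by
    have := mem_prs.1 (hsub hp0)
    exact this.2.two_le.trans this.1
  have h1 : ∑ p ∈ S, (1:ℝ) / p ≤ ∑ p ∈ S, (Real.log p / p) / a := by
    apply Finset.sum_le_sum
    intro p hp
    have hp' : (0:ℝ) < p := by exact_mod_cast (hS p hp).1.pos
    rw [div_div, div_le_div_iff₀ hp' (by positivity)]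
    nlinarith [(hS p hp).2.1]
  refine h1.trans ?_
  rw [← Finset.sum_div]
  gcongr
  have h2 : ∑ p ∈ S, Real.log p / p ≤ ∑ p ∈ prs ⌊Real.exp X⌋₊, Real.log p / p := by
    apply Finset.sum_le_sum_of_subset_of_nonneg hsub
    intro p _ _
    have := Real.log_natCast_nonneg p
    positivity
  refine (h2.trans (mw hN)).trans ?_
  have : Real.log ⌊Real.exp X⌋₊ ≤ X := by
    rw [Real.log_le_iff_le_exp (by have : 0 < ⌊Real.exp X⌋₊ := by omega
                                   exact_mod_cast this)]
    exact Nat.floor_le (Real.exp_pos _).le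
  linarith

lemma zeta_bd : ∃ C : ℝ, 0 < C ∧ ∀ s : ℂ, 1 < s.re → s.re ≤ 2 → |s.im| ≤ 1 → ‖riemannZeta s‖ ≤ C / ‖s - 1‖ := by
  let g : ℂ → ℂ := fun s => ((s - 1) * (completedRiemannZeta₀ s - 1 / s) + 1) * (Gammaℝ s)⁻¹
  have hc : ContinuousOn g (Set.Icc 1 2 ×ℂ Set.Icc (-1) 1) := by
    apply ContinuousOn.mul _ differentiable_Gammaℝ_inv.continuous.continuousOn
    apply ContinuousOn.add _ continuousOn_const
    apply ContinuousOn.mul (by fun_prop)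
    apply ContinuousOn.sub differentiable_completedZeta₀.continuous.continuousOn
    apply ContinuousOn.div continuousOn_const continuousOn_id
    intro s hs h0
    have := (Complex.mem_reProdIm.1 hs).1.1
    simp only [id] at h0
    rw [h0] at this
    norm_num at this
  have hk : IsCompact (Set.Icc (1:ℝ) 2 ×ℂ Set.Icc (-1) 1) := isCompact_Icc.reProdIm isCompact_Icc
  obtain ⟨C, hC⟩ := hk.exists_bound_of_continuousOn hc
  refine ⟨max C 1, by positivity, ?_⟩
  intro s h1 h2 h3
  have hs1 : s - 1 ≠ 0 := by
    intro h
    have : s = 1 := by linear_combination h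
    rw [this] at h1; norm_num at h1
  have hs0 : s ≠ 0 := by
    rintro rfl; norm_num at h1
  rw [le_div_iff₀ (norm_pos_iff.2 hs1), mul_comm, ← norm_mul]
  have h4 : (s - 1) * riemannZeta s = g s := by
    rw [riemannZeta_def_of_ne_zero hs0, completedRiemannZeta_eq]
    simp only [g]
    have : 1 - s ≠ 0 := by intro h; apply hs1; linear_combination -h
    rw [div_eq_mul_inv _ (Gammaℝ s), ← mul_assoc]
    congr 1
    field_simp
    ring
  rw [h4]
  exact (hC s (Complex.mem_reProdIm.2 ⟨⟨h1.le, h2⟩, abs_le.1 h3⟩)).trans (le_max_left _ _)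

lemma prime_cpow_norm (p : Nat.Primes) (s : ℂ) : ‖((p:ℕ):ℂ) ^ (-s)‖ = ((p:ℕ):ℝ) ^ (-s.re) := by
  rw [Complex.norm_natCast_cpow_of_pos p.2.pos]; simp

lemma summable_prime_cpow {s : ℂ} (hs : 1 < s.re) : Summable (fun p : Nat.Primes => ((p:ℕ):ℂ) ^ (-s)) := by
  apply Summable.of_norm
  simp only [prime_cpow_norm]
  exact Nat.Primes.summable_rpow.2 (by linarith)

noncomputable def pz : ℝ := ∑' p : Nat.Primes, ((p:ℕ):ℝ) ^ (-2:ℝ)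

lemma log_zeta_le {s : ℂ} (hs : 1 < s.re) :
    (∑' p : Nat.Primes, ((p:ℕ):ℂ) ^ (-s)).re ≤ Real.log ‖riemannZeta s‖ + pz := by
  have h1 := riemannZeta_eulerProduct_exp_log hs
  have hb : ∀ p : Nat.Primes, ‖-Complex.log (1 - ((p:ℕ):ℂ) ^ (-s)) - ((p:ℕ):ℂ) ^ (-s)‖ ≤ ((p:ℕ):ℝ) ^ (-2:ℝ) := by
    intro p
    have hp2 : (2:ℝ) ≤ (p:ℕ) := by exact_mod_cast p.2.two_le
    have hz : ‖((p:ℕ):ℂ) ^ (-s)‖ ≤ ((p:ℕ):ℝ) ^ (-1:ℝ) := by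
      rw [prime_cpow_norm]
      exact Real.rpow_le_rpow_of_exponent_le (by linarith) (by linarith)
    have hz2 : ((p:ℕ):ℝ) ^ (-1:ℝ) ≤ 1/2 := by
      rw [Real.rpow_neg_one, inv_eq_one_div]
      apply div_le_div_of_nonneg_left <;> linarith
    have hz3 := hz.trans hz2
    have h2 := Complex.norm_log_one_add_sub_self_le (z := -((p:ℕ):ℂ) ^ (-s)) (by rw [norm_neg]; linarith)
    rw [norm_neg] at h2
    have e : -Complex.log (1 - ((p:ℕ):ℂ) ^ (-s)) - ((p:ℕ):ℂ) ^ (-s) = -(Complex.log (1 + -((p:ℕ):ℂ) ^ (-s)) - -((p:ℕ):ℂ) ^ (-s)) := by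
      rw [sub_eq_add_neg 1]; ring
    rw [e, norm_neg]
    refine h2.trans ?_
    have h3 : (1 - ‖((p:ℕ):ℂ) ^ (-s)‖)⁻¹ ≤ 2 := by
      rw [inv_le_comm₀ (by linarith) (by norm_num)]; linarith
    have h4 : ‖((p:ℕ):ℂ) ^ (-s)‖ ^ 2 ≤ ((p:ℕ):ℝ) ^ (-2:ℝ) := by
      have : ((p:ℕ):ℝ) ^ (-2:ℝ) = (((p:ℕ):ℝ) ^ (-1:ℝ)) ^ 2 := by
        rw [← Real.rpow_mul_natCast (by linarith)]; norm_num
      rw [this]; gcongr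
    have h5 : 0 ≤ ‖((p:ℕ):ℂ) ^ (-s)‖ ^ 2 := by positivity
    nlinarith
  have hs2 : Summable (fun p : Nat.Primes => ((p:ℕ):ℝ) ^ (-2:ℝ)) := Nat.Primes.summable_rpow.2 (by norm_num)
  have hd : Summable (fun p : Nat.Primes => -Complex.log (1 - ((p:ℕ):ℂ) ^ (-s)) - ((p:ℕ):ℂ) ^ (-s)) :=
    Summable.of_norm_bounded hs2 hb
  have hsz := summable_prime_cpow hs
  have hlog : Summable (fun p : Nat.Primes => -Complex.log (1 - ((p:ℕ):ℂ) ^ (-s))) := by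
    have := hd.add hsz
    simpa using this
  have h3 := tsum_of_norm_bounded hs2.hasSum hb
  rw [hlog.tsum_sub hsz] at h3
  rw [← h1, Complex.norm_exp, Real.log_exp]
  have h4 := (Complex.abs_re_le_norm _).trans h3
  rw [Complex.sub_re, abs_le] at h4
  unfold pz
  linarith [h4.1]

noncomputable def cc (k : ℝ) (t : Fin 4 → ℝ) (n : ℕ) : ℂ := (k / 4 : ℝ) * ∑ i, (n:ℂ) ^ (-(t i * I))

lemma norm_cpow_I {n : ℕ} (hn : n ≠ 0) (t : ℝ) : ‖(n:ℂ) ^ (-(t * I))‖ = 1 := by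
  rw [Complex.norm_natCast_cpow_of_pos (Nat.pos_of_ne_zero hn)]; simp

lemma norm_cc_le {k : ℝ} (hk : 0 ≤ k) (t : Fin 4 → ℝ) {n : ℕ} (hn : n ≠ 0) : ‖cc k t n‖ ≤ k := by
  unfold cc
  rw [norm_mul, Complex.norm_real, Real.norm_eq_abs, abs_of_nonneg (by positivity)]
  have : ‖∑ i, (n:ℂ) ^ (-(t i * I))‖ ≤ 4 := by
    refine (norm_sum_le _ _).trans ?_
    simp [norm_cpow_I hn]
  nlinarith

lemma norm_cc_sq (k : ℝ) (t : Fin 4 → ℝ) {n : ℕ} (hn : n ≠ 0) :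
    ‖cc k t n‖ ^ 2 = k ^ 2 / 16 * ∑ i, ∑ j, ((n:ℂ) ^ (-((t i - t j : ℝ) * I))).re := by
  unfold cc
  rw [norm_mul, Complex.norm_real, Real.norm_eq_abs, mul_pow, sq_abs, Complex.sq_norm, ← Complex.ofReal_re (Complex.normSq _),
    Complex.normSq_eq_conj_mul_self, map_sum, Finset.sum_mul_sum, Finset.sum_comm, Complex.re_sum]
  congr 1
  · ring
  apply Finset.sum_congr rfl; intro i _
  rw [Complex.re_sum]
  apply Finset.sum_congr rfl; intro j _
  congr 1
  have hn' : (n:ℂ) ≠ 0 := by exact_mod_cast hn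
  have h1 : ∀ j, (starRingEnd ℂ) ((n:ℂ) ^ (-(t j * I))) = (n:ℂ) ^ (t j * I) := by
    intro j
    rw [Complex.cpow_def_of_ne_zero hn', Complex.cpow_def_of_ne_zero hn', ← Complex.exp_conj, ← Complex.natCast_log]
    congr 1
    rw [map_mul, Complex.conj_ofReal, map_neg, map_mul, Complex.conj_ofReal, Complex.conj_I]
    ring
  rw [h1, ← Complex.cpow_add _ _ hn']
  congr 1
  push_cast; ring

lemma psum_bound {k : ℝ} (hk : 0 ≤ k) : ∃ C : ℝ, ∀ q : ℕ, 3 ≤ q → ∀ t : Fin 4 → ℝ, (∀ i j, |t i - t j| ≤ 1) →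
    ∑ p ∈ prs q, ‖cc k t p‖ ^ 2 / p ≤ C + k ^ 2 / 16 * ∑ i, ∑ j, Real.log (1 / (1 / Real.log q + |t i - t j|)) := by
  obtain ⟨C, hC0, hC⟩ := zeta_bd
  refine ⟨8 * k ^ 2 + k ^ 2 / 16 * ∑ i : Fin 4, ∑ j : Fin 4, (Real.log (2 * C) + pz), ?_⟩
  intro q hq t ht
  set L := Real.log q with hL
  have hL1 : 1 ≤ L := by
    rw [hL, Real.le_log_iff_exp_le (by positivity)]
    have : (3:ℝ) ≤ q := by exact_mod_cast hq
    linarith [Real.exp_one_lt_three]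
  have hLp : 0 < 1 / L := by positivity
  have hL1' : 1 / L ≤ 1 := by rw [div_le_one (by linarith)]; exact hL1
  have hsre : ∀ i j, ((1 + 1 / L : ℝ) + (t i - t j : ℝ) * I : ℂ).re = 1 + 1 / L := by intro i j; simp
  have hsim : ∀ i j, ((1 + 1 / L : ℝ) + (t i - t j : ℝ) * I : ℂ).im = t i - t j := by intro i j; simp
  have hbound : ∀ i j, (∑' p : Nat.Primes, ((p:ℕ):ℂ) ^ (-((1 + 1 / L : ℝ) + (t i - t j : ℝ) * I : ℂ))).re ≤
      Real.log (2 * C) + pz + Real.log (1 / (1 / L + |t i - t j|)) := by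
    intro i j
    set s : ℂ := (1 + 1 / L : ℝ) + (t i - t j : ℝ) * I with hs
    have h1 : 1 < s.re := by rw [hsre]; linarith
    have h2 := log_zeta_le h1
    have h3 := hC s h1 (by rw [hsre]; linarith) (by rw [hsim]; exact ht i j)
    have h4 : (1 / L + |t i - t j|) / 2 ≤ ‖s - 1‖ := by
      have h5 := Complex.abs_re_le_norm (s - 1)
      have h6 := Complex.abs_im_le_norm (s - 1)
      rw [Complex.sub_re, hsre, Complex.one_re, show 1 + 1 / L - 1 = 1 / L by ring, abs_of_pos hLp] at h5
      rw [Complex.sub_im, hsim, Complex.one_im, sub_zero] at h6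
      linarith
    have hpos : 0 < 1 / L + |t i - t j| := by positivity
    have h7 : ‖riemannZeta s‖ ≤ (2 * C) * (1 / (1 / L + |t i - t j|)) := by
      refine h3.trans ?_
      rw [mul_one_div, div_le_div_iff₀ (by linarith) hpos]
      nlinarith
    have h8 : 0 < ‖riemannZeta s‖ := norm_pos_iff.2 (riemannZeta_ne_zero_of_one_lt_re h1)
    have h9 := Real.log_le_log h8 h7
    rw [Real.log_mul (by positivity) (by positivity)] at h9
    linarith
  have hu : ∀ p : Nat.Primes, ‖cc k t p‖ ^ 2 * ((p:ℕ):ℝ) ^ (-(1 + 1 / L)) =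
      k ^ 2 / 16 * ∑ i, ∑ j, (((p:ℕ):ℂ) ^ (-((1 + 1 / L : ℝ) + (t i - t j : ℝ) * I : ℂ))).re := by
    intro p
    have hp : ((p:ℕ):ℂ) ≠ 0 := by exact_mod_cast p.2.ne_zero
    rw [norm_cc_sq k t p.2.ne_zero, mul_assoc, Finset.sum_mul]
    congr 1
    apply Finset.sum_congr rfl; intro i _
    rw [Finset.sum_mul]
    apply Finset.sum_congr rfl; intro j _
    rw [neg_add (((1 + 1 / L : ℝ)) : ℂ), Complex.cpow_add _ _ hp, mul_comm]
    have : ((p:ℕ):ℂ) ^ (-((1 + 1 / L : ℝ) : ℂ)) = ((((p:ℕ):ℝ) ^ (-(1 + 1 / L)) : ℝ) : ℂ) := by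
      rw [Complex.ofReal_cpow (by positivity)]; push_cast; ring_nf
    rw [this, Complex.re_ofReal_mul]
  have hsum : ∀ i j, Summable (fun p : Nat.Primes => (((p:ℕ):ℂ) ^ (-((1 + 1 / L : ℝ) + (t i - t j : ℝ) * I : ℂ))).re) := by
    intro i j
    have : Summable (fun p : Nat.Primes => (((p:ℕ):ℂ) ^ (-((1 + 1 / L : ℝ) + (t i - t j : ℝ) * I : ℂ)))) :=
      summable_prime_cpow (by rw [hsre]; linarith)
    exact (Complex.hasSum_re this.hasSum).summable
  have hsum2 : Summable (fun p : Nat.Primes => ‖cc k t p‖ ^ 2 * ((p:ℕ):ℝ) ^ (-(1 + 1 / L))) := by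
    simp only [hu]
    apply Summable.mul_left
    apply summable_sum; intro i _
    apply summable_sum; intro j _
    exact hsum i j
  have h1 : ∑ p ∈ prs q, ‖cc k t p‖ ^ 2 * (p:ℝ) ^ (-(1 + 1 / L)) ≤
      k ^ 2 / 16 * ∑ i, ∑ j, (Real.log (2 * C) + pz + Real.log (1 / (1 / L + |t i - t j|))) := by
    have e1 := Finset.sum_subtype_of_mem (s := prs q) (p := Nat.Prime) (fun p => ‖cc k t p‖ ^ 2 * (p:ℝ) ^ (-(1 + 1 / L)))
      (fun p hp => (mem_prs.1 hp).2)
    rw [← e1]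
    have e2 := Summable.sum_le_tsum (ι := Nat.Primes) (f := fun p : Nat.Primes => ‖cc k t p‖ ^ 2 * ((p:ℕ):ℝ) ^ (-(1 + 1 / L))) (Finset.subtype Nat.Prime (prs q)) (fun p _ => by positivity) hsum2
    refine LE.le.trans e2 ?_
    simp only [hu]
    rw [tsum_mul_left, Summable.tsum_finsetSum (fun i _ => summable_sum fun j _ => hsum i j)]
    gcongr with i _
    rw [Summable.tsum_finsetSum (fun j _ => hsum i j)]
    gcongr with j _
    have := hbound i j
    rw [Complex.re_tsum (summable_prime_cpow (by rw [hsre]; linarith))] at this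
    exact this
  have h2 : ∀ p ∈ prs q, ‖cc k t p‖ ^ 2 / p ≤ ‖cc k t p‖ ^ 2 * (p:ℝ) ^ (-(1 + 1 / L)) + k ^ 2 / L * (Real.log p / p) := by
    intro p hp
    have hp' := (mem_prs.1 hp).2
    have hp0 : (0:ℝ) < p := by exact_mod_cast hp'.pos
    have e1 : (p:ℝ) ^ (-(1 + 1 / L)) = (p:ℝ)⁻¹ * Real.exp (-(Real.log p / L)) := by
      rw [neg_add, Real.rpow_add hp0, Real.rpow_neg_one, Real.rpow_def_of_pos hp0]
      congr 2; ring
    have e2 : 1 - Real.log p / L ≤ Real.exp (-(Real.log p / L)) := by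
      have := Real.add_one_le_exp (-(Real.log p / L)); linarith
    have e3 : ‖cc k t p‖ ^ 2 ≤ k ^ 2 := by
      have := norm_cc_le hk t hp'.ne_zero
      gcongr
    have e4 : 0 ≤ Real.log p / L := div_nonneg (Real.log_natCast_nonneg p) (by linarith)
    rw [e1]
    have e5 : k ^ 2 / L * (Real.log p / p) = (p:ℝ)⁻¹ * (k ^ 2 * (Real.log p / L)) := by field_simp
    have e6 : ‖cc k t p‖ ^ 2 / p = (p:ℝ)⁻¹ * ‖cc k t p‖ ^ 2 := by field_simp
    have e7 : ‖cc k t p‖ ^ 2 * ((p:ℝ)⁻¹ * Real.exp (-(Real.log p / L))) = (p:ℝ)⁻¹ * (‖cc k t p‖ ^ 2 * Real.exp (-(Real.log p / L))) := by ring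
    rw [e5, e6, e7, ← mul_add]
    apply mul_le_mul_of_nonneg_left _ (by positivity)
    have : 0 ≤ ‖cc k t p‖ ^ 2 := by positivity
    nlinarith
  refine (Finset.sum_le_sum h2).trans ?_
  rw [Finset.sum_add_distrib, ← Finset.mul_sum]
  have h3 : k ^ 2 / L * ∑ p ∈ prs q, Real.log p / p ≤ 8 * k ^ 2 := by
    have := mw (N := q) (by omega)
    rw [div_mul_eq_mul_div, div_le_iff₀ (by linarith)]
    have hk2 : 0 ≤ k ^ 2 := by positivity
    nlinarith
  have h4 : ∑ i : Fin 4, ∑ j : Fin 4, (Real.log (2 * C) + pz + Real.log (1 / (1 / L + |t i - t j|))) =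
     (∑ i : Fin 4, ∑ j : Fin 4, (Real.log (2 * C) + pz)) + ∑ i, ∑ j, Real.log (1 / (1 / L + |t i - t j|)) := by
    simp only [Finset.sum_add_distrib]
  rw [h4, mul_add] at h1
  linarith
end S18


namespace S18

open MonoidAlgebra

/-- coefficientwise majorization (away from `0`) -/
def Maj {𝕜 : Type} [RCLike 𝕜] (a : MonoidAlgebra 𝕜 ℕ) (b : MonoidAlgebra ℝ ℕ) : Prop :=
  ∀ n : ℕ, n ≠ 0 → ‖a.coeff n‖ ≤ b.coeff n

section
variable {𝕜 : Type} [RCLike 𝕜] {a a' : MonoidAlgebra 𝕜 ℕ} {b b' c : MonoidAlgebra ℝ ℕ}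

lemma Maj.trans (h : Maj a b) (h' : Maj b c) : Maj a c := fun n hn =>
  (h n hn).trans ((le_abs_self _).trans (h' n hn))

lemma Maj.self_right (h : Maj a b) : Maj b b := fun n hn => by
  rw [Real.norm_of_nonneg ((norm_nonneg _).trans (h n hn))]

lemma Maj.mul (h : Maj a b) (h' : Maj a' b') : Maj (a * a') (b * b') := by
  intro n hn
  have hs : ∀ {p : ℕ × ℕ}, p ∈ n.divisorsAntidiagonal ↔ p.1 * p.2 = n := by
    intro p; rw [Nat.mem_divisorsAntidiagonal]; exact ⟨fun h => h.1, fun h => ⟨h, hn⟩⟩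
  rw [coeff_mul_antidiag a a' n _ hs, coeff_mul_antidiag b b' n _ hs]
  refine (norm_sum_le _ _).trans (Finset.sum_le_sum fun p hp => ?_)
  have hp' := hs.1 hp
  have h1 : p.1 ≠ 0 := by rintro h0; rw [h0] at hp'; simp at hp'; exact hn hp'.symm
  have h2 : p.2 ≠ 0 := by rintro h0; rw [h0] at hp'; simp at hp'; exact hn hp'.symm
  rw [norm_mul]
  exact mul_le_mul (h _ h1) (h' _ h2) (norm_nonneg _) ((norm_nonneg _).trans (h _ h1))

lemma Maj.add (h : Maj a b) (h' : Maj a' b') : Maj (a + a') (b + b') := by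
  intro n hn
  simp only [coeff_add, Finsupp.add_apply]
  exact (norm_add_le _ _).trans (add_le_add (h n hn) (h' n hn))

lemma Maj.zero : Maj (0 : MonoidAlgebra 𝕜 ℕ) 0 := by intro n hn; simp

lemma Maj.one : Maj (1 : MonoidAlgebra 𝕜 ℕ) 1 := by
  intro n hn
  simp only [one_def, coeff_single, Finsupp.single_apply]
  split_ifs <;> simp

lemma Maj.single {n : ℕ} {x : 𝕜} {y : ℝ} (h : ‖x‖ ≤ y) : Maj (MonoidAlgebra.single n x) (MonoidAlgebra.single n y) := by
  intro m hm
  simp only [coeff_single, Finsupp.single_apply]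
  split_ifs <;> simp [h]

lemma Maj.smul {x : 𝕜} {y : ℝ} (hx : ‖x‖ ≤ y) (h : Maj a b) : Maj (x • a) (y • b) := by
  intro n hn
  simp only [coeff_smul, Finsupp.smul_apply, smul_eq_mul, norm_mul]
  exact mul_le_mul hx (h n hn) (norm_nonneg _) ((norm_nonneg _).trans hx)

lemma Maj.pow (h : Maj a b) (m : ℕ) : Maj (a ^ m) (b ^ m) := by
  induction m with
  | zero => simpa using Maj.one
  | succ m ih => rw [pow_succ, pow_succ]; exact ih.mul h

lemma Maj.sum {ι : Type} {s : Finset ι} {f : ι → MonoidAlgebra 𝕜 ℕ} {g : ι → MonoidAlgebra ℝ ℕ}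
    (h : ∀ i ∈ s, Maj (f i) (g i)) : Maj (∑ i ∈ s, f i) (∑ i ∈ s, g i) := by
  classical
  induction s using Finset.induction_on with
  | empty => simpa using Maj.zero
  | insert i s hi ih =>
    rw [Finset.sum_insert hi, Finset.sum_insert hi]
    exact (h i (Finset.mem_insert_self _ _)).add (ih fun j hj => h j (Finset.mem_insert_of_mem hj))

lemma Maj.prod {ι : Type} {s : Finset ι} {f : ι → MonoidAlgebra 𝕜 ℕ} {g : ι → MonoidAlgebra ℝ ℕ}
    (h : ∀ i ∈ s, Maj (f i) (g i)) : Maj (∏ i ∈ s, f i) (∏ i ∈ s, g i) := by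
  classical
  induction s using Finset.induction_on with
  | empty => simpa using Maj.one
  | insert i s hi ih =>
    rw [Finset.prod_insert hi, Finset.prod_insert hi]
    exact (h i (Finset.mem_insert_self _ _)).mul (ih fun j hj => h j (Finset.mem_insert_of_mem hj))

/-- truncated exponential -/
noncomputable def texp {𝕜 : Type} [RCLike 𝕜] {A : Type} [CommRing A] [Algebra 𝕜 A] (d : ℕ) (x : A) : A :=
  ∑ j ∈ Finset.range (d + 1), ((Nat.factorial j : 𝕜)⁻¹) • x ^ j

lemma Maj.texp (h : Maj a b) (d : ℕ) : Maj (texp (𝕜 := 𝕜) d a) (texp (𝕜 := ℝ) d b) := by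
  unfold S18.texp
  apply Maj.sum
  intro j _
  apply Maj.smul _ (h.pow j)
  simp
end

section
variable {b b' x y : MonoidAlgebra ℝ ℕ}

lemma Maj.sum_subset {ι : Type} {s t : Finset ι} (hst : s ⊆ t) {f : ι → MonoidAlgebra ℝ ℕ}
    (h : ∀ i ∈ t, Maj (f i) (f i)) : Maj (∑ i ∈ s, f i) (∑ i ∈ t, f i) := by
  intro n hn
  rw [coeff_sum, coeff_sum, Finsupp.finsetSum_apply, Finsupp.finsetSum_apply]
  have h0 : ∀ i ∈ t, 0 ≤ (f i).coeff n := fun i hi => (norm_nonneg _).trans (h i hi n hn)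
  rw [Real.norm_of_nonneg (Finset.sum_nonneg fun i hi => h0 i (hst hi))]
  exact Finset.sum_le_sum_of_subset_of_nonneg hst fun i hi _ => h0 i hi

lemma texp_add (hx : Maj x x) (hy : Maj y y) (d : ℕ) :
    Maj (texp (𝕜 := ℝ) d (x + y)) (texp (𝕜 := ℝ) d x * texp (𝕜 := ℝ) d y) := by
  let f : ℕ × ℕ → MonoidAlgebra ℝ ℕ := fun m =>
    (((Nat.factorial m.1 : ℝ)⁻¹) • x ^ m.1) * (((Nat.factorial m.2 : ℝ)⁻¹) • y ^ m.2)
  have h1 : texp (𝕜 := ℝ) d x * texp (𝕜 := ℝ) d y = ∑ m ∈ Finset.range (d + 1) ×ˢ Finset.range (d + 1), f m := by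
    unfold texp
    rw [Finset.sum_mul_sum, Finset.sum_product]
  have h2 : texp (𝕜 := ℝ) d (x + y) = ∑ m ∈ (Finset.range (d + 1)).biUnion (fun j => Finset.HasAntidiagonal.antidiagonal j), f m := by
    unfold texp
    rw [Finset.sum_biUnion]
    · apply Finset.sum_congr rfl
      intro j _
      rw [(Commute.all x y).add_pow', Finset.smul_sum]
      apply Finset.sum_congr rfl
      intro m hm
      have hm' : m.1 + m.2 = j := Finset.HasAntidiagonal.mem_antidiagonal.1 hm
      simp only [f]
      rw [smul_mul_smul_comm, ← Nat.cast_smul_eq_nsmul ℝ, smul_smul]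
      congr 1
      have hc := Nat.add_choose_mul_factorial_mul_factorial m.1 m.2
      rw [hm'] at hc
      have hc' : ((j.choose m.1 : ℕ) : ℝ) * (m.1.factorial : ℝ) * (m.2.factorial : ℝ) = (j.factorial : ℝ) := by
        rw [Nat.choose_symm_of_eq_add hm'.symm]; exact_mod_cast hc
      have p1 : (m.1.factorial : ℝ) ≠ 0 := by positivity
      have p2 : (m.2.factorial : ℝ) ≠ 0 := by positivity
      have p3 : (j.factorial : ℝ) ≠ 0 := by positivity
      field_simp
      linarith
    · intro i _ j _ hij
      apply Finset.disjoint_left.2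
      intro m hm hm'
      apply hij
      rw [← Finset.HasAntidiagonal.mem_antidiagonal.1 hm, ← Finset.HasAntidiagonal.mem_antidiagonal.1 hm']
  rw [h1, h2]
  apply Maj.sum_subset
  · intro m hm
    rw [Finset.mem_biUnion] at hm
    obtain ⟨j, hj, hm⟩ := hm
    have := Finset.HasAntidiagonal.mem_antidiagonal.1 hm
    have hj' := Finset.mem_range.1 hj
    rw [Finset.mem_product, Finset.mem_range, Finset.mem_range]
    omega
  · intro m _
    apply Maj.mul
    · exact Maj.smul (by simp) (hx.pow _)
    · exact Maj.smul (by simp) (hy.pow _)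

lemma texp_sum {ι : Type} {s : Finset ι} {f : ι → MonoidAlgebra ℝ ℕ}
    (h : ∀ i ∈ s, Maj (f i) (f i)) (d : ℕ) : Maj (texp (𝕜 := ℝ) d (∑ i ∈ s, f i)) (∏ i ∈ s, texp (𝕜 := ℝ) d (f i)) := by
  classical
  induction s using Finset.induction_on with
  | empty =>
    have : texp (𝕜 := ℝ) d (0 : MonoidAlgebra ℝ ℕ) = 1 := by
      unfold texp
      rw [Finset.sum_eq_single 0]
      · simp
      · intro j _ hj; rw [zero_pow hj, smul_zero]
      · simp
    rw [Finset.sum_empty, Finset.prod_empty, this]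
    exact Maj.one
  | insert i s hi ih =>
    rw [Finset.sum_insert hi, Finset.prod_insert hi]
    have h1 := h i (Finset.mem_insert_self _ _)
    have h2 : ∀ j ∈ s, Maj (f j) (f j) := fun j hj => h j (Finset.mem_insert_of_mem hj)
    refine (texp_add h1 (Maj.sum h2) d).trans ?_
    exact (h1.texp d).mul (ih h2)

lemma pow_maj {ι : Type} {s : Finset ι} {f : ι → MonoidAlgebra ℝ ℕ}
    (h : ∀ i ∈ s, Maj (f i) (f i)) (m : ℕ) {r : ℝ} (hr : 0 < r) :
    Maj ((∑ i ∈ s, f i) ^ m) (((Nat.factorial m : ℝ) * r⁻¹ ^ m) • ∏ i ∈ s, texp (𝕜 := ℝ) m (r • f i)) := by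
  have hr' : ∀ i ∈ s, Maj (r • f i) (r • f i) := fun i hi => Maj.smul (by rw [Real.norm_of_nonneg hr.le]) (h i hi)
  have h1 : Maj (((Nat.factorial m : ℝ)⁻¹) • (∑ i ∈ s, r • f i) ^ m) (texp (𝕜 := ℝ) m (∑ i ∈ s, r • f i)) := by
    unfold texp
    have := Maj.sum_subset (s := {m}) (t := Finset.range (m + 1)) (by simp)
      (f := fun j => ((Nat.factorial j : ℝ)⁻¹) • (∑ i ∈ s, r • f i) ^ j)
      (fun j _ => Maj.smul (by simp) ((Maj.sum hr').pow j))
    simpa using this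
  have h2 := h1.trans (texp_sum hr' m)
  have h3 := Maj.smul (x := ((Nat.factorial m : ℝ) * r⁻¹ ^ m)) (y := ((Nat.factorial m : ℝ) * r⁻¹ ^ m))
    (by rw [Real.norm_of_nonneg (by positivity)]) h2
  have e : ((Nat.factorial m : ℝ) * r⁻¹ ^ m) • (((Nat.factorial m : ℝ)⁻¹) • (∑ i ∈ s, r • f i) ^ m) = (∑ i ∈ s, f i) ^ m := by
    rw [← Finset.smul_sum, smul_pow, smul_smul, smul_smul]
    have : (Nat.factorial m : ℝ) * r⁻¹ ^ m * (Nat.factorial m : ℝ)⁻¹ * r ^ m = 1 := by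
      have p1 : (m.factorial : ℝ) ≠ 0 := by positivity
      rw [inv_pow]
      field_simp
    rw [this, one_smul]
  rwa [e] at h3
end
end S18


namespace S18

open MonoidAlgebra

def Supp {𝕜 : Type} [RCLike 𝕜] (a : MonoidAlgebra 𝕜 ℕ) (A : Set ℕ) : Prop :=
  ∀ n : ℕ, a.coeff n ≠ 0 → n ∈ A

section
variable {𝕜 : Type} [RCLike 𝕜] {a b : MonoidAlgebra 𝕜 ℕ} {A B C : Set ℕ}

lemma Supp.mono (h : Supp a A) (hAB : A ⊆ B) : Supp a B := fun n hn => hAB (h n hn)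

lemma Supp.mul (ha : Supp a A) (hb : Supp b B) (h : ∀ x ∈ A, ∀ y ∈ B, x * y ∈ C) : Supp (a * b) C := by
  classical
  intro n hn
  by_contra hc
  apply hn
  rw [coeff_mul]
  simp only [Finsupp.sum]
  apply Finset.sum_eq_zero
  intro x hx
  apply Finset.sum_eq_zero
  intro y hy
  rw [if_neg]
  rintro rfl
  exact hc (h x (ha x (Finsupp.mem_support_iff.1 hx)) y (hb y (Finsupp.mem_support_iff.1 hy)))

lemma Supp.add (ha : Supp a A) (hb : Supp b A) : Supp (a + b) A := by
  intro n hn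
  by_contra hc
  apply hn
  rw [coeff_add, Finsupp.add_apply, not_not.1 (fun h => hc (ha n h)), not_not.1 (fun h => hc (hb n h)), add_zero]

lemma Supp.zero : Supp (0 : MonoidAlgebra 𝕜 ℕ) A := by intro n hn; simp at hn

lemma Supp.single {m : ℕ} (x : 𝕜) (h : m ∈ A) : Supp (MonoidAlgebra.single m x) A := by
  intro n hn
  rw [coeff_single, Finsupp.single_apply] at hn
  split_ifs at hn with h1
  · rwa [← h1]
  · exact absurd rfl hn

lemma Supp.one (h : 1 ∈ A) : Supp (1 : MonoidAlgebra 𝕜 ℕ) A := by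
  rw [one_def]; exact Supp.single _ h

lemma Supp.smul (ha : Supp a A) (x : 𝕜) : Supp (x • a) A := by
  intro n hn
  apply ha
  intro h
  apply hn
  rw [coeff_smul, Finsupp.smul_apply, h, smul_zero]

lemma Supp.sum {ι : Type} {s : Finset ι} {f : ι → MonoidAlgebra 𝕜 ℕ} (h : ∀ i ∈ s, Supp (f i) A) :
    Supp (∑ i ∈ s, f i) A := by
  classical
  induction s using Finset.induction_on with
  | empty => simpa using Supp.zero
  | insert i s hi ih =>
    rw [Finset.sum_insert hi]
    exact (h i (Finset.mem_insert_self _ _)).add (ih fun j hj => h j (Finset.mem_insert_of_mem hj))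

/-- numbers `1 ≤ n ≤ e^l` -/
def LL (l : ℝ) : Set ℕ := {n | n ≠ 0 ∧ Real.log n ≤ l}

lemma LL_mono {l l' : ℝ} (h : l ≤ l') : LL l ⊆ LL l' := fun _ hn => ⟨hn.1, hn.2.trans h⟩

lemma LL_mul {l l' : ℝ} {x y : ℕ} (hx : x ∈ LL l) (hy : y ∈ LL l') : x * y ∈ LL (l + l') := by
  refine ⟨mul_ne_zero hx.1 hy.1, ?_⟩
  rw [Nat.cast_mul, Real.log_mul (by exact_mod_cast hx.1) (by exact_mod_cast hy.1)]
  exact add_le_add hx.2 hy.2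

lemma Supp.LL_mul {l l' : ℝ} (ha : Supp a (LL l)) (hb : Supp b (LL l')) : Supp (a * b) (LL (l + l')) :=
  ha.mul hb fun _ hx _ hy => S18.LL_mul hx hy

lemma LL_one : 1 ∈ LL 0 := by simp [LL]

lemma Supp.LL_pow {l : ℝ} (ha : Supp a (LL l)) (m : ℕ) : Supp (a ^ m) (LL (m * l)) := by
  induction m with
  | zero => simpa using Supp.one LL_one
  | succ m ih =>
    rw [pow_succ]
    refine (ih.LL_mul ha).mono (LL_mono (le_of_eq ?_))
    push_cast; ring

lemma Supp.LL_prod {ι : Type} {s : Finset ι} {f : ι → MonoidAlgebra 𝕜 ℕ} {l : ι → ℝ}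
    (h : ∀ i ∈ s, Supp (f i) (LL (l i))) : Supp (∏ i ∈ s, f i) (LL (∑ i ∈ s, l i)) := by
  classical
  induction s using Finset.induction_on with
  | empty => simpa using Supp.one LL_one
  | insert i s hi ih =>
    rw [Finset.prod_insert hi, Finset.sum_insert hi]
    exact (h i (Finset.mem_insert_self _ _)).LL_mul (ih fun j hj => h j (Finset.mem_insert_of_mem hj))

lemma Supp.LL_texp {l : ℝ} (hl : 0 ≤ l) (ha : Supp a (LL l)) (d : ℕ) : Supp (texp (𝕜 := 𝕜) d a) (LL (d * l)) := by
  unfold texp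
  apply Supp.sum
  intro j hj
  apply Supp.smul
  refine (ha.LL_pow j).mono (LL_mono ?_)
  have : j ≤ d := by have := Finset.mem_range.1 hj; omega
  gcongr

/-- numbers with prime factors in `S` -/
def PS (S : Finset ℕ) : Set ℕ := {n | n ≠ 0 ∧ ∀ p, p.Prime → p ∣ n → p ∈ S}

lemma PS_mul {S T U : Finset ℕ} (hS : S ⊆ U) (hT : T ⊆ U) {x y : ℕ} (hx : x ∈ PS S) (hy : y ∈ PS T) : x * y ∈ PS U := by
  refine ⟨mul_ne_zero hx.1 hy.1, fun p hp h => ?_⟩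
  rcases (hp.dvd_mul).1 h with h | h
  · exact hS (hx.2 p hp h)
  · exact hT (hy.2 p hp h)

lemma PS_one {S : Finset ℕ} : 1 ∈ PS S :=
  ⟨one_ne_zero, fun p hp h => absurd (Nat.dvd_one.1 h) hp.one_lt.ne'⟩

lemma PS_coprime {S T : Finset ℕ} (h : Disjoint S T) {x y : ℕ} (hx : x ∈ PS S) (hy : y ∈ PS T) : x.Coprime y := by
  apply Nat.Coprime.symm
  apply Nat.coprime_of_dvd
  intro p hp h1 h2
  exact Finset.disjoint_left.1 h (hx.2 p hp h2) (hy.2 p hp h1)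

lemma Supp.PS_prod {ι : Type} {s : Finset ι} {f : ι → MonoidAlgebra 𝕜 ℕ} {T : Finset ℕ}
    (h : ∀ i ∈ s, Supp (f i) (PS T)) : Supp (∏ i ∈ s, f i) (PS T) := by
  classical
  induction s using Finset.induction_on with
  | empty => simpa using Supp.one PS_one
  | insert i s hi ih =>
    rw [Finset.prod_insert hi]
    exact (h i (Finset.mem_insert_self _ _)).mul (ih fun j hj => h j (Finset.mem_insert_of_mem hj))
      fun x hx y hy => PS_mul (subset_refl _) (subset_refl _) hx hy

lemma Supp.PS_mono {S T : Finset ℕ} (ha : Supp a (PS S)) (h : S ⊆ T) : Supp a (PS T) :=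
  ha.mono fun _ hn => ⟨hn.1, fun p hp hd => h (hn.2 p hp hd)⟩
end

/-- squared l2 norm -/
noncomputable def N2 (b : MonoidAlgebra ℝ ℕ) : ℝ := b.coeff.sum fun _ c => c ^ 2

lemma N2_nonneg (b : MonoidAlgebra ℝ ℕ) : 0 ≤ N2 b := Finset.sum_nonneg fun _ _ => sq_nonneg _

lemma N2_mul {a b : MonoidAlgebra ℝ ℕ} {S T : Finset ℕ} (h : Disjoint S T) (ha : Supp a (PS S)) (hb : Supp b (PS T)) :
    N2 (a * b) ≤ N2 a * N2 b := by
  classical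
  have ha' : ∀ x ∈ a.coeff.support, x ∈ PS S := fun x hx => ha x (Finsupp.mem_support_iff.1 hx)
  have hb' : ∀ x ∈ b.coeff.support, x ∈ PS T := fun x hx => hb x (Finsupp.mem_support_iff.1 hx)
  have inj : ∀ x ∈ PS S, ∀ y ∈ PS T, ∀ x' ∈ PS S, ∀ y' ∈ PS T, x * y = x' * y' → x = x' ∧ y = y' := by
    intro x hx y hy x' hx' y' hy' he
    have h1 : x = x' := by
      apply Nat.dvd_antisymm
      · exact (PS_coprime h hx hy').dvd_of_dvd_mul_right (he ▸ Dvd.intro _ rfl)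
      · exact (PS_coprime h hx' hy).dvd_of_dvd_mul_right (he ▸ Dvd.intro _ rfl)
    refine ⟨h1, ?_⟩
    rw [h1] at he
    exact Nat.eq_of_mul_eq_mul_left (Nat.pos_of_ne_zero hx'.1) he
  have hc : ∀ x ∈ a.coeff.support, ∀ y ∈ b.coeff.support, (a * b).coeff (x * y) = a.coeff x * b.coeff y := by
    intro x hx y hy
    rw [coeff_mul]
    simp only [Finsupp.sum]
    rw [Finset.sum_eq_single x, Finset.sum_eq_single y]
    · simp
    · intro y' hy' hne
      rw [if_neg]
      intro he
      exact hne (inj x (ha' x hx) y' (hb' y' hy') x (ha' x hx) y (hb' y hy) he).2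
    · intro hn; exact absurd hy hn
    · intro x' hx' hne
      apply Finset.sum_eq_zero
      intro y' hy'
      rw [if_neg]
      intro he
      exact hne (inj x' (ha' x' hx') y' (hb' y' hy') x (ha' x hx) y (hb' y hy) he).1
    · intro hn; exact absurd hx hn
  have hsup : (a * b).coeff.support ⊆ (a.coeff.support ×ˢ b.coeff.support).image fun z => z.1 * z.2 := by
    have : Supp (a * b) ((a.coeff.support ×ˢ b.coeff.support).image fun z => z.1 * z.2 : Finset ℕ) := by
      apply Supp.mul (A := (a.coeff.support : Set ℕ)) (B := (b.coeff.support : Set ℕ))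
      · intro n hn; simpa using hn
      · intro n hn; simpa using hn
      · intro x hx y hy
        rw [Finset.mem_coe] at *
        exact Finset.mem_image.2 ⟨(x, y), Finset.mem_product.2 ⟨hx, hy⟩, rfl⟩
    intro n hn
    exact_mod_cast this n (Finsupp.mem_support_iff.1 hn)
  unfold N2
  simp only [Finsupp.sum]
  calc ∑ n ∈ (a * b).coeff.support, ((a * b).coeff n) ^ 2
      ≤ ∑ n ∈ (a.coeff.support ×ˢ b.coeff.support).image (fun z => z.1 * z.2), ((a * b).coeff n) ^ 2 :=
        Finset.sum_le_sum_of_subset_of_nonneg hsup fun _ _ _ => sq_nonneg _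
    _ = ∑ z ∈ a.coeff.support ×ˢ b.coeff.support, ((a * b).coeff (z.1 * z.2)) ^ 2 := by
        rw [Finset.sum_image]
        intro z hz w hw he
        rw [Finset.mem_coe, Finset.mem_product] at hz hw
        have := inj z.1 (ha' _ hz.1) z.2 (hb' _ hz.2) w.1 (ha' _ hw.1) w.2 (hb' _ hw.2) he
        exact Prod.ext this.1 this.2
    _ = ∑ z ∈ a.coeff.support ×ˢ b.coeff.support, (a.coeff z.1) ^ 2 * (b.coeff z.2) ^ 2 := by
        apply Finset.sum_congr rfl
        intro z hz
        rw [Finset.mem_product] at hz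
        rw [hc _ hz.1 _ hz.2, mul_pow]
    _ = _ := by rw [Finset.sum_mul_sum, Finset.sum_product]
    _ ≤ _ := le_rfl

lemma N2_one : N2 1 = 1 := by
  unfold N2
  rw [one_def, coeff_single, Finsupp.sum_single_index] <;> simp

lemma N2_prod {S : Finset ℕ} {z : ℕ → MonoidAlgebra ℝ ℕ} (h : ∀ p ∈ S, Supp (z p) (PS {p})) :
    N2 (∏ p ∈ S, z p) ≤ ∏ p ∈ S, N2 (z p) := by
  classical
  induction S using Finset.induction_on with
  | empty => simp [N2_one]
  | insert p S hp ih =>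
    rw [Finset.prod_insert hp, Finset.prod_insert hp]
    have h2 : ∀ j ∈ S, Supp (z j) (PS {j}) := fun j hj => h j (Finset.mem_insert_of_mem hj)
    refine (N2_mul (S := {p}) (T := S) (Finset.disjoint_singleton_left.2 hp) (h p (Finset.mem_insert_self _ _))
      (Supp.PS_prod fun j hj => (h2 j hj).PS_mono (Finset.singleton_subset_iff.2 hj))).trans ?_
    exact mul_le_mul_of_nonneg_left (ih h2) (N2_nonneg _)

lemma N2_smul (c : ℝ) (b : MonoidAlgebra ℝ ℕ) : N2 (c • b) = c ^ 2 * N2 b := by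
  unfold N2
  rw [coeff_smul, Finsupp.sum_smul_index (by simp), Finsupp.mul_sum]
  simp only [mul_pow]

lemma N2_add {a b : MonoidAlgebra ℝ ℕ} {A B : Set ℕ} (h : Disjoint A B) (ha : Supp a A) (hb : Supp b B) :
    N2 (a + b) = N2 a + N2 b := by
  classical
  unfold N2
  rw [coeff_add, Finsupp.sum_add_index_of_disjoint]
  apply Finset.disjoint_left.2
  intro n h1 h2
  exact Set.disjoint_left.1 h (ha n (Finsupp.mem_support_iff.1 h1)) (hb n (Finsupp.mem_support_iff.1 h2))

end S18


namespace S18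

open MonoidAlgebra

lemma Supp.of_texp {𝕜 : Type} [RCLike 𝕜] {a : MonoidAlgebra 𝕜 ℕ} {A : Set ℕ} (ha : Supp a A) (h1 : 1 ∈ A)
    (h : ∀ x ∈ A, ∀ y ∈ A, x * y ∈ A) (d : ℕ) : Supp (texp (𝕜 := 𝕜) d a) A := by
  unfold texp
  apply Supp.sum
  intro j hj
  clear hj
  apply Supp.smul
  induction j with
  | zero => simpa using Supp.one h1
  | succ m ih => rw [pow_succ]; exact ih.mul ha h

noncomputable def aug : MonoidAlgebra ℝ ℕ →ₐ[ℝ] ℝ := MonoidAlgebra.lift ℝ ℝ ℕ 1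

lemma aug_single (n : ℕ) (x : ℝ) : aug (MonoidAlgebra.single n x) = x := by
  unfold aug; rw [lift_single]; simp

lemma aug_texp (d : ℕ) (x : MonoidAlgebra ℝ ℕ) (hx : 0 ≤ aug x) : aug (texp (𝕜 := ℝ) d x) ≤ Real.exp (aug x) := by
  unfold texp
  rw [map_sum]
  refine le_trans (le_of_eq ?_) (Real.sum_le_exp_of_nonneg hx (d + 1))
  apply Finset.sum_congr rfl
  intro j _
  rw [map_smul, map_pow, smul_eq_mul, div_eq_inv_mul]

lemma N2_le_aug {r : MonoidAlgebra ℝ ℕ} (h : Maj r r) (h0 : r.coeff 0 = 0) : N2 r ≤ (aug r) ^ 2 := by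
  unfold N2 aug
  rw [MonoidAlgebra.lift_apply]
  simp only [Finsupp.sum, MonoidHom.one_apply, smul_eq_mul, mul_one]
  apply Finset.sum_sq_le_sq_sum_of_nonneg
  intro n _
  by_cases hn : n = 0
  · rw [hn, h0]
  · exact (norm_nonneg _).trans (h n hn)

lemma supp_pp_pow {p : ℕ} {x : MonoidAlgebra ℝ ℕ} (hx : Supp x {n | ∃ v, 1 ≤ v ∧ n = p ^ v}) (j : ℕ) :
    Supp (x ^ j) {n | ∃ v, j ≤ v ∧ n = p ^ v} := by
  induction j with
  | zero => rw [pow_zero]; exact Supp.one ⟨0, le_refl _, by simp⟩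
  | succ j ih =>
    rw [pow_succ]
    apply ih.mul hx
    rintro _ ⟨v, hv, rfl⟩ _ ⟨w, hw, rfl⟩
    exact ⟨v + w, by omega, by rw [pow_add]⟩

lemma N2_single (n : ℕ) (x : ℝ) : N2 (MonoidAlgebra.single n x) = x ^ 2 := by
  unfold N2
  rw [coeff_single, Finsupp.sum_single_index (by simp)]

/-- local factor -/
noncomputable def loc (p : ℕ) (a b : ℝ) : MonoidAlgebra ℝ ℕ :=
  MonoidAlgebra.single p a + MonoidAlgebra.single (p ^ 2) b

lemma maj_loc {p : ℕ} {a b : ℝ} (ha : 0 ≤ a) (hb : 0 ≤ b) : Maj (loc p a b) (loc p a b) :=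
  (Maj.single (by rw [Real.norm_of_nonneg ha])).add (Maj.single (by rw [Real.norm_of_nonneg hb]))

lemma N2_loc {p : ℕ} (hp : p.Prime) {a b : ℝ} (ha : 0 ≤ a) (hb : 0 ≤ b) {d : ℕ} (hd : 1 ≤ d) :
    N2 (texp (𝕜 := ℝ) d (loc p a b)) ≤ 1 + a ^ 2 + (Real.exp (a + b) - 1 - a) ^ 2 := by
  set x := loc p a b with hx
  have hxs : Supp x {n | ∃ v, 1 ≤ v ∧ n = p ^ v} :=
    Supp.add (Supp.single _ (show p ∈ {n | ∃ v, 1 ≤ v ∧ n = p ^ v} from ⟨1, le_refl _, by simp⟩))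
      (Supp.single _ (show p ^ 2 ∈ {n | ∃ v, 1 ≤ v ∧ n = p ^ v} from ⟨2, by norm_num, rfl⟩))
  have hxm : Maj x x := maj_loc ha hb
  set r : MonoidAlgebra ℝ ℕ := MonoidAlgebra.single (p ^ 2) b +
    ∑ j ∈ Finset.Ico 2 (d + 1), ((Nat.factorial j : ℝ)⁻¹) • x ^ j with hr
  have hrs : Supp r {n | ∃ v, 2 ≤ v ∧ n = p ^ v} := by
    apply Supp.add
    · exact Supp.single _ ⟨2, le_refl _, rfl⟩
    · apply Supp.sum
      intro j hj
      apply Supp.smul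
      apply (supp_pp_pow hxs j).mono
      rintro _ ⟨v, hv, rfl⟩
      exact ⟨v, (Finset.mem_Ico.1 hj).1.trans hv, rfl⟩
  have hrm : Maj r r := by
    apply Maj.add
    · exact Maj.single (by rw [Real.norm_of_nonneg hb])
    · apply Maj.sum
      intro j _
      exact Maj.smul (by simp) (hxm.pow j)
  have e : texp (𝕜 := ℝ) d x = (1 + MonoidAlgebra.single p a) + r := by
    unfold texp
    rw [Finset.range_eq_Ico, ← Finset.sum_Ico_consecutive _ (Nat.zero_le 2) (by omega : 2 ≤ d + 1)]
    rw [← Finset.range_eq_Ico, Finset.sum_range_succ, Finset.sum_range_one, hr]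
    simp only [Nat.factorial, pow_zero, pow_one, Nat.cast_one, inv_one, one_smul]
    rw [hx, loc]
    simp only [mul_one, Nat.cast_one, inv_one, one_smul]
    abel
  have haug : aug x = a + b := by rw [hx, loc, map_add, aug_single, aug_single]
  have haugr : aug r = aug (texp (𝕜 := ℝ) d x) - 1 - a := by
    rw [e, map_add aug (1 + _) r, map_add aug 1 _, map_one, aug_single]; ring
  have hr0 : 0 ≤ aug r := by
    have : aug r = b + ∑ j ∈ Finset.Ico 2 (d + 1), ((Nat.factorial j : ℝ)⁻¹) * (a + b) ^ j := by
      rw [hr, map_add, aug_single, map_sum]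
      congr 1
      apply Finset.sum_congr rfl
      intro j _
      rw [map_smul, map_pow, haug, smul_eq_mul]
    rw [this]
    have : 0 ≤ ∑ j ∈ Finset.Ico 2 (d + 1), ((Nat.factorial j : ℝ)⁻¹) * (a + b) ^ j :=
      Finset.sum_nonneg fun j _ => by positivity
    linarith
  have hp1 : (p : ℕ) ≠ 1 := hp.one_lt.ne'
  have d1 : Disjoint ({1, p} : Set ℕ) {n | ∃ v, 2 ≤ v ∧ n = p ^ v} := by
    rw [Set.disjoint_left]
    rintro n hn ⟨v, hv, rfl⟩
    rcases hn with hn | hn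
    · have := Nat.one_lt_pow (by omega : v ≠ 0) hp.one_lt
      omega
    · have h2 : p ^ v = p := hn
      have := Nat.pow_lt_pow_right hp.one_lt (by omega : 1 < v)
      rw [pow_one] at this
      omega
  have d2 : Disjoint ({1} : Set ℕ) {p} := by
    rw [Set.disjoint_singleton]; exact hp1.symm
  rw [e, N2_add d1 ((Supp.one (by simp)).add (Supp.single _ (by simp))) hrs,
    N2_add d2 (Supp.one (by simp)) (Supp.single _ (by simp)), N2_one, N2_single]
  have h0 : r.coeff 0 = 0 := by
    by_contra h
    obtain ⟨v, _, h2⟩ := hrs 0 h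
    exact (pow_ne_zero v hp.ne_zero) h2.symm
  have h1 := N2_le_aug hrm h0
  have h2 : aug r ≤ Real.exp (a + b) - 1 - a := by
    have := aug_texp d x (by rw [haug]; positivity)
    rw [haug] at this
    rw [haugr]; linarith
  have h3 : aug r ^ 2 ≤ (Real.exp (a + b) - 1 - a) ^ 2 := pow_le_pow_left₀ hr0 h2 2
  linarith

lemma N2_loc_pow {p : ℕ} (hp : p.Prime) {a : ℝ} (ha : 0 ≤ a) {d : ℕ} (hd : 1 ≤ d) :
    N2 (texp (𝕜 := ℝ) d (MonoidAlgebra.single p a)) ≤ Real.exp (2 * a ^ 2) := by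
  have h := N2_loc hp ha le_rfl hd
  have e : loc p a 0 = MonoidAlgebra.single p a := by unfold loc; simp
  rw [e, add_zero] at h
  refine h.trans ?_
  rcases le_total a 1 with h1 | h1
  · have h2 := Real.abs_exp_sub_one_sub_id_le (x := a) (by rwa [abs_of_nonneg ha])
    have h3 : (Real.exp a - 1 - a) ^ 2 ≤ a ^ 2 := by
      rw [sq_le_sq, abs_of_nonneg ha]
      refine h2.trans ?_
      nlinarith
    have := Real.add_one_le_exp (2 * a ^ 2)
    linarith
  · have h2 := Real.add_one_le_exp a
    have h3 : Real.exp (2 * a) ≤ Real.exp (2 * a ^ 2) := Real.exp_le_exp.2 (by nlinarith)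
    have h4 : Real.exp (2 * a) = Real.exp a ^ 2 := by rw [two_mul, Real.exp_add, sq]
    nlinarith

lemma N2_loc_main {p : ℕ} (hp : p.Prime) {κ a b : ℝ} (hκ : 0 ≤ κ) (ha : 0 ≤ a) (hb : 0 ≤ b)
    (ha' : a ≤ κ / √p) (hb' : b ≤ κ / p) {d : ℕ} (hd : 1 ≤ d) :
    N2 (texp (𝕜 := ℝ) d (loc p a b)) ≤ Real.exp (a ^ 2 + (4 * κ ^ 2 * Real.exp (2 * κ) + κ) ^ 2 / (p : ℝ) ^ 2) := by
  refine (N2_loc hp ha hb hd).trans ?_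
  have hp1 : (1 : ℝ) ≤ p := by exact_mod_cast hp.one_lt.le
  have hsp : (1 : ℝ) ≤ √p := Real.one_le_sqrt.2 hp1
  have hpp : √(p : ℝ) ^ 2 = p := Real.sq_sqrt (by linarith)
  have hle : κ / p ≤ κ / √p := by
    apply div_le_div_of_nonneg_left hκ (by linarith)
    nlinarith
  set u := a + b with hu
  have hu0 : 0 ≤ u := by positivity
  have hu1 : u ≤ 2 * (κ / √p) := by linarith
  have hu2 : u ≤ 2 * κ := by
    have : κ / √p ≤ κ := div_le_self hκ hsp
    linarith
  have husq : u ^ 2 ≤ 4 * κ ^ 2 / p := by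
    calc u ^ 2 ≤ (2 * (κ / √p)) ^ 2 := by gcongr
      _ = 4 * κ ^ 2 / p := by rw [mul_pow, div_pow, hpp]; ring
  have h1 : Real.exp u - 1 - u ≤ u ^ 2 * Real.exp u := by
    have h2 := Real.add_one_le_exp (-u)
    have h3 : Real.exp u * Real.exp (-u) = 1 := by rw [← Real.exp_add]; simp
    have h4 := Real.exp_pos u
    have h5 : Real.exp u - 1 ≤ u * Real.exp u := by nlinarith
    nlinarith [mul_le_mul_of_nonneg_left h5 hu0]
  have h2 : Real.exp u - 1 - a ≤ (4 * κ ^ 2 * Real.exp (2 * κ) + κ) / p := by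
    have h3 : u ^ 2 * Real.exp u ≤ 4 * κ ^ 2 / p * Real.exp (2 * κ) := by
      apply mul_le_mul husq (Real.exp_le_exp.2 hu2) (Real.exp_pos _).le (by positivity)
    have : (4 * κ ^ 2 * Real.exp (2 * κ) + κ) / p = 4 * κ ^ 2 / p * Real.exp (2 * κ) + κ / p := by ring
    rw [this]
    linarith
  have h0 : 0 ≤ Real.exp u - 1 - a := by have := Real.add_one_le_exp u; linarith
  have h3 : (Real.exp u - 1 - a) ^ 2 ≤ (4 * κ ^ 2 * Real.exp (2 * κ) + κ) ^ 2 / (p : ℝ) ^ 2 := by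
    rw [← div_pow]; exact pow_le_pow_left₀ h0 h2 2
  have := Real.add_one_le_exp (a ^ 2 + (4 * κ ^ 2 * Real.exp (2 * κ) + κ) ^ 2 / (p : ℝ) ^ 2)
  linarith

lemma supp_loc {p : ℕ} (hp : p.Prime) (a b : ℝ) (d : ℕ) : Supp (texp (𝕜 := ℝ) d (loc p a b)) (PS {p}) := by
  have h1 : p ∈ PS {p} := ⟨hp.ne_zero, fun r hr h => by
    rw [Finset.mem_singleton]; exact (Nat.prime_dvd_prime_iff_eq hr hp).1 h⟩
  have hm : ∀ x ∈ PS {p}, ∀ y ∈ PS {p}, x * y ∈ PS {p} :=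
    fun x hx y hy => PS_mul (subset_refl _) (subset_refl _) hx hy
  apply Supp.of_texp _ PS_one hm
  apply Supp.add (Supp.single _ h1) (Supp.single _ _)
  rw [sq]; exact hm _ h1 _ h1

lemma supp_loc' {p : ℕ} (hp : p.Prime) (a : ℝ) (d : ℕ) : Supp (texp (𝕜 := ℝ) d (MonoidAlgebra.single p a)) (PS {p}) := by
  have := supp_loc hp a 0 d
  rwa [loc, MonoidAlgebra.single_zero, add_zero] at this

/-! second moment -/

noncomputable def ev {q : ℕ} (χ : DirichletCharacter ℂ q) : MonoidAlgebra ℂ ℕ →ₐ[ℂ] ℂ :=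
  MonoidAlgebra.lift ℂ ℂ ℕ (χ.toMonoidHom.comp (Nat.castRingHom (ZMod q)).toMonoidHom)

lemma ev_single {q : ℕ} (χ : DirichletCharacter ℂ q) (n : ℕ) (x : ℂ) : ev χ (MonoidAlgebra.single n x) = x * χ n := by
  unfold ev; rw [lift_single]; simp

lemma ev_apply {q : ℕ} (χ : DirichletCharacter ℂ q) (a : MonoidAlgebra ℂ ℕ) :
    ev χ a = ∑ n ∈ a.coeff.support, a.coeff n * χ n := by
  unfold ev; rw [MonoidAlgebra.lift_apply]; simp [Finsupp.sum]

lemma orth {q : ℕ} [NeZero q] (n m : ℕ) (hn : n < q) (hm : m < q) :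
    ∑ χ : DirichletCharacter ℂ q, χ n * (starRingEnd ℂ) (χ m) =
      if n = m ∧ IsUnit (m : ZMod q) then (q.totient : ℂ) else 0 := by
  by_cases hu : IsUnit (m : ZMod q)
  · have h := DirichletCharacter.sum_char_inv_mul_char_eq ℂ hu (n : ZMod q)
    have he : ∀ χ : DirichletCharacter ℂ q, χ n * (starRingEnd ℂ) (χ m) = χ (m : ZMod q)⁻¹ * χ n := by
      intro χ
      rw [mul_comm]
      congr 1
      have h1 := MulChar.star_apply' χ (m : ZMod q)
      rw [MulChar.inv_apply_eq_inv'] at h1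
      have h2 : χ (m : ZMod q)⁻¹ * χ (m : ZMod q) = 1 := by
        rw [← map_mul, ZMod.inv_mul_of_unit _ hu, map_one]
      rw [eq_inv_of_mul_eq_one_left h2]
      exact h1
    rw [Finset.sum_congr rfl fun χ _ => he χ, h]
    have : ((m : ZMod q) = (n : ZMod q)) ↔ (n = m ∧ IsUnit (m : ZMod q)) := by
      constructor
      · intro h
        have h' := (ZMod.natCast_eq_natCast_iff' m n q).1 h
        rw [Nat.mod_eq_of_lt hn, Nat.mod_eq_of_lt hm] at h'
        exact ⟨h'.symm, hu⟩
      · rintro ⟨rfl, _⟩; rfl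
    simp only [this]
  · rw [if_neg (fun h => hu h.2)]
    apply Finset.sum_eq_zero
    intro χ _
    rw [MulChar.map_nonunit χ hu]; simp

lemma second_moment {q : ℕ} [NeZero q] {a : MonoidAlgebra ℂ ℕ} {b : MonoidAlgebra ℝ ℕ} (hab : Maj a b)
    (hs : Supp a {n | n ≠ 0 ∧ n < q}) : ∑ χ : DirichletCharacter ℂ q, ‖ev χ a‖ ^ 2 ≤ q.totient * N2 b := by
  have hs' : ∀ n ∈ a.coeff.support, n ≠ 0 ∧ n < q := fun n hn => hs n (Finsupp.mem_support_iff.1 hn)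
  have h1 : ((∑ χ : DirichletCharacter ℂ q, ‖ev χ a‖ ^ 2 : ℝ) : ℂ) =
      ∑ n ∈ a.coeff.support, ∑ m ∈ a.coeff.support, (a.coeff n * (starRingEnd ℂ) (a.coeff m)) *
        ∑ χ : DirichletCharacter ℂ q, χ n * (starRingEnd ℂ) (χ m) := by
    have : ∀ χ : DirichletCharacter ℂ q, ((‖ev χ a‖ ^ 2 : ℝ) : ℂ) = ∑ n ∈ a.coeff.support, ∑ m ∈ a.coeff.support,
        (a.coeff n * (starRingEnd ℂ) (a.coeff m)) * (χ n * (starRingEnd ℂ) (χ m)) := by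
      intro χ
      rw [Complex.ofReal_pow, ← Complex.mul_conj', ev_apply, map_sum, Finset.sum_mul_sum]
      apply Finset.sum_congr rfl; intro n _
      apply Finset.sum_congr rfl; intro m _
      rw [map_mul]; ring
    rw [Complex.ofReal_sum, Finset.sum_congr rfl fun χ _ => this χ, Finset.sum_comm]
    apply Finset.sum_congr rfl; intro n _
    rw [Finset.sum_comm]
    apply Finset.sum_congr rfl; intro m _
    rw [Finset.mul_sum]
  have h2 : ((∑ χ : DirichletCharacter ℂ q, ‖ev χ a‖ ^ 2 : ℝ) : ℂ) =
      ((∑ n ∈ a.coeff.support, (if IsUnit (n : ZMod q) then ‖a.coeff n‖ ^ 2 * q.totient else 0) : ℝ) : ℂ) := by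
    rw [h1, Complex.ofReal_sum]
    apply Finset.sum_congr rfl; intro n hn
    rw [Finset.sum_eq_single n]
    · rw [orth n n (hs' n hn).2 (hs' n hn).2]
      simp only [true_and]
      split_ifs
      · rw [Complex.mul_conj']; push_cast; ring
      · simp
    · intro m hm hne
      rw [orth n m (hs' n hn).2 (hs' m hm).2, if_neg (fun h => hne h.1.symm), mul_zero]
    · intro h; exact absurd hn h
  rw [Complex.ofReal_inj.1 h2]
  calc _ ≤ ∑ n ∈ a.coeff.support, (b.coeff n) ^ 2 * q.totient := by
        apply Finset.sum_le_sum
        intro n hn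
        have h3 := hab n (hs' n hn).1
        have h4 : ‖a.coeff n‖ ^ 2 ≤ (b.coeff n) ^ 2 := pow_le_pow_left₀ (norm_nonneg _) h3 2
        split_ifs
        · gcongr
        · positivity
    _ = q.totient * ∑ n ∈ a.coeff.support, (b.coeff n) ^ 2 := by rw [Finset.mul_sum]; simp only [mul_comm]
    _ ≤ q.totient * N2 b := by
        apply mul_le_mul_of_nonneg_left _ (by positivity)
        unfold N2
        simp only [Finsupp.sum]
        apply Finset.sum_le_sum_of_subset_of_nonneg
        · intro n hn
          rw [Finsupp.mem_support_iff]
          have h3 := hab n (hs' n hn).1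
          have h4 := norm_pos_iff.2 (Finsupp.mem_support_iff.1 hn)
          linarith
        · intro _ _ _; positivity

end S18


namespace S18

/-- coefficients of the combined Dirichlet polynomial -/
noncomputable def al (k : ℝ) (t : Fin 4 → ℝ) (X : ℝ) (n : ℕ) : ℂ :=
  (lam n : ℂ) * (n : ℂ) ^ (-(1 / 2) : ℂ) * cc k t n * ww (Real.log n / X)

lemma norm_half {n : ℕ} (hn : n ≠ 0) : ‖(n : ℂ) ^ (-(1 / 2) : ℂ)‖ = (n : ℝ) ^ (-(1 / 2) : ℝ) := by
  rw [Complex.norm_natCast_cpow_of_pos (Nat.pos_of_ne_zero hn)]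
  congr 1
  simp

lemma norm_al_le' {k : ℝ} {t : Fin 4 → ℝ} {X : ℝ} (hX : 0 < X) {n : ℕ} (hn : n ≠ 0) :
    ‖al k t X n‖ ≤ lam n * (n : ℝ) ^ (-(1 / 2) : ℝ) * ‖cc k t n‖ := by
  unfold al
  rw [norm_mul, norm_mul, norm_mul, norm_half hn, Complex.norm_real, Real.norm_of_nonneg (lam_nonneg n)]
  apply mul_le_of_le_one_right
  · have := lam_nonneg n
    positivity
  · apply ww_le
    have := Real.log_natCast_nonneg n
    positivity

lemma lam_prime_pow {p r : ℕ} (hp : p.Prime) (hr : r ≠ 0) : lam (p ^ r) = 1 / r := by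
  unfold lam
  rw [ArithmeticFunction.vonMangoldt_apply_pow hr, ArithmeticFunction.vonMangoldt_apply_prime hp, Nat.cast_pow, Real.log_pow]
  have : 0 < Real.log p := Real.log_pos (by exact_mod_cast hp.one_lt)
  have h2 : (r : ℝ) ≠ 0 := by exact_mod_cast hr
  field_simp

lemma norm_al_prime {k : ℝ} {t : Fin 4 → ℝ} {X : ℝ} (hX : 0 < X) {p : ℕ} (hp : p.Prime) :
    ‖al k t X p‖ ≤ ‖cc k t p‖ / √p := by
  refine (norm_al_le' hX hp.ne_zero).trans (le_of_eq ?_)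
  have := lam_prime_pow hp one_ne_zero
  rw [pow_one] at this
  rw [this, Real.sqrt_eq_rpow, Real.rpow_neg (by positivity)]
  simp
  ring

lemma norm_al_sq {k : ℝ} (hk : 0 ≤ k) {t : Fin 4 → ℝ} {X : ℝ} (hX : 0 < X) {p : ℕ} (hp : p.Prime) :
    ‖al k t X (p ^ 2)‖ ≤ k / p := by
  have h0 : p ^ 2 ≠ 0 := pow_ne_zero _ hp.ne_zero
  refine (norm_al_le' hX h0).trans ?_
  rw [lam_prime_pow hp two_ne_zero]
  have h1 : ((p ^ 2 : ℕ) : ℝ) ^ (-(1 / 2) : ℝ) = 1 / p := by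
    rw [Nat.cast_pow, ← Real.rpow_natCast_mul (by positivity)]
    norm_num
    rw [Real.rpow_neg_one]
  rw [h1]
  have h2 := norm_cc_le hk t h0
  have h3 : (0 : ℝ) < p := by exact_mod_cast hp.pos
  calc 1 / ((2 : ℕ) : ℝ) * (1 / p) * ‖cc k t (p ^ 2)‖ ≤ 1 * (1 / p) * k := by
        gcongr
        norm_num
    _ = k / p := by ring

lemma al_zero {k : ℝ} {t : Fin 4 → ℝ} {X : ℝ} (hX : 0 < X) {n : ℕ} (h : X ≤ Real.log n) : al k t X n = 0 := by
  unfold al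
  rw [ww_zero, mul_zero]
  rwa [one_le_div hX]

lemma al_not_pp {k : ℝ} {t : Fin 4 → ℝ} {X : ℝ} {n : ℕ} (h : ¬ IsPrimePow n) : al k t X n = 0 := by
  unfold al lam
  rw [ArithmeticFunction.vonMangoldt_eq_zero_iff.2 h]
  simp

noncomputable def zc : ℝ := ∑' n : ℕ, (n : ℝ) ^ (-(3 / 2) : ℝ)

lemma zc_summable : Summable fun n : ℕ => (n : ℝ) ^ (-(3 / 2) : ℝ) :=
  Real.summable_nat_rpow.2 (by norm_num)

noncomputable def C1c (k : ℝ) : ℝ := k * zc * (1 - (2 : ℝ) ^ (-(1 / 2) : ℝ))⁻¹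

lemma zc_nonneg : 0 ≤ zc := tsum_nonneg fun n => by positivity

lemma C1c_nonneg {k : ℝ} (hk : 0 ≤ k) : 0 ≤ C1c k := by
  have h1 : (2 : ℝ) ^ (-(1 / 2) : ℝ) ≤ 1 := Real.rpow_le_one_of_one_le_of_nonpos (by norm_num) (by norm_num)
  have h2 : 0 ≤ 1 - (2 : ℝ) ^ (-(1 / 2) : ℝ) := by linarith
  have := zc_nonneg
  unfold C1c
  positivity

lemma al_high {k : ℝ} (hk : 0 ≤ k) {t : Fin 4 → ℝ} {X : ℝ} (hX : 0 < X) {p r : ℕ} (hp : p.Prime) (hr : 3 ≤ r) :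
    ‖al k t X (p ^ r)‖ ≤ k * (p : ℝ) ^ (-(3 / 2) : ℝ) * ((2 : ℝ) ^ (-(1 / 2) : ℝ)) ^ (r - 3) := by
  have h0 : p ^ r ≠ 0 := pow_ne_zero _ hp.ne_zero
  refine (norm_al_le' hX h0).trans ?_
  have h2 := norm_cc_le hk t h0
  have h3 : (2 : ℝ) ≤ p := by exact_mod_cast hp.two_le
  have h4 : ((p ^ r : ℕ) : ℝ) ^ (-(1 / 2) : ℝ) ≤ (p : ℝ) ^ (-(3 / 2) : ℝ) * ((2 : ℝ) ^ (-(1 / 2) : ℝ)) ^ (r - 3) := by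
    have h5 : ((p : ℝ) ^ (-(1 / 2) : ℝ)) ^ r = ((p ^ r : ℕ) : ℝ) ^ (-(1 / 2) : ℝ) := by
      rw [Nat.cast_pow, ← Real.rpow_natCast_mul (by positivity), ← Real.rpow_mul_natCast (by positivity)]
      ring_nf
    have h6 : ((p : ℝ) ^ (-(1 / 2) : ℝ)) ^ 3 = (p : ℝ) ^ (-(3 / 2) : ℝ) := by
      rw [← Real.rpow_mul_natCast (by positivity)]
      norm_num
    rw [← h5, ← h6]
    conv_lhs => rw [← Nat.add_sub_cancel' hr, pow_add]
    gcongr ?_ * ?_ ^ _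
    exact Real.rpow_le_rpow_of_nonpos (by norm_num) h3 (by norm_num)
  calc lam (p ^ r) * ((p ^ r : ℕ) : ℝ) ^ (-(1 / 2) : ℝ) * ‖cc k t (p ^ r)‖
      ≤ 1 * ((p : ℝ) ^ (-(3 / 2) : ℝ) * ((2 : ℝ) ^ (-(1 / 2) : ℝ)) ^ (r - 3)) * k := by
        gcongr
        exact lam_le_one _
    _ = _ := by ring

noncomputable def Dp {q : ℕ} (χ : DirichletCharacter ℂ q) (k : ℝ) (t : Fin 4 → ℝ) (X : ℝ) : ℂ :=
  ∑ n ∈ Finset.Icc 1 ⌊Real.exp X⌋₊, al k t X n * χ n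

lemma sum_DPoly {q : ℕ} [NeZero q] (χ : DirichletCharacter ℂ q) (k : ℝ) (t : Fin 4 → ℝ) (X : ℝ) :
    ∑ i, ((k / 2 : ℝ) : ℂ) * DPoly χ X (t i) = 2 * Dp χ k t X := by
  unfold DPoly Dp
  simp only [Finset.mul_sum]
  rw [Finset.sum_comm]
  apply Finset.sum_congr rfl
  intro n hn
  have hn0 : (n : ℂ) ≠ 0 := by
    have := (Finset.mem_Icc.1 hn).1
    exact_mod_cast (by omega : n ≠ 0)
  unfold al cc acoef
  have : ∀ i, (n : ℂ) ^ (-(1 / 2 + (t i : ℂ) * I)) = (n : ℂ) ^ (-(1 / 2) : ℂ) * (n : ℂ) ^ (-((t i : ℂ) * I)) := by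
    intro i
    rw [← Complex.cpow_add _ _ hn0]
    congr 1; ring
  simp only [this]
  simp only [Finset.mul_sum, Finset.sum_mul]
  apply Finset.sum_congr rfl
  intro i _
  push_cast
  ring

lemma C1_bound {q : ℕ} (χ : DirichletCharacter ℂ q) {k : ℝ} (hk : 0 ≤ k) (t : Fin 4 → ℝ) {X : ℝ} (hX : 1 ≤ X)
    (hXq : X ≤ Real.log q) (hq : 0 < q) :
    ‖Dp χ k t X - ∑ p ∈ prs q, (al k t X p * χ p + al k t X (p ^ 2) * χ ((p ^ 2 : ℕ) : ZMod q))‖ ≤ C1c k := by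
  have hX0 : 0 < X := by linarith
  set x := Real.exp X with hx
  have hx0 : 0 < x := Real.exp_pos _
  have hxq : x ≤ q := by
    rw [hx, ← Real.exp_log (by exact_mod_cast hq : (0 : ℝ) < q)]
    exact Real.exp_le_exp.2 hXq
  set f : ℕ → ℂ := fun n => al k t X n * χ (n : ZMod q) with hf
  set N := ⌊Real.log x / Real.log 2⌋₊ + 2 with hN
  have e1 : Dp χ k t X = ∑ r ∈ Finset.Icc 1 N, ∑ p ∈ Finset.Ioc 0 ⌊x ^ ((1 : ℝ) / r)⌋₊ with p.Prime, f (p ^ r) := by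
    rw [← Chebyshev.sum_PrimePow_eq_sum_sum' f hx0.le (by omega : ⌊Real.log x / Real.log 2⌋₊ ≤ N)]
    unfold Dp
    rw [Finset.sum_filter]
    apply Finset.sum_congr
    · rfl
    · intro n _
      split_ifs with h
      · rfl
      · rw [al_not_pp h, zero_mul]
  have e2 : ∀ r ∈ Finset.Icc 1 N, ∑ p ∈ Finset.Ioc 0 ⌊x ^ ((1 : ℝ) / r)⌋₊ with p.Prime, f (p ^ r) =
      ∑ p ∈ prs q, f (p ^ r) := by
    intro r hr
    have hr1 : 1 ≤ r := (Finset.mem_Icc.1 hr).1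
    have hr0 : (0 : ℝ) < r := by exact_mod_cast hr1
    apply Finset.sum_subset
    · intro p hp
      rw [Finset.mem_filter, Finset.mem_Ioc] at hp
      rw [mem_prs]
      refine ⟨?_, hp.2⟩
      have h1 : (p : ℝ) ≤ x ^ ((1 : ℝ) / r) := (Nat.le_floor_iff (by positivity)).1 hp.1.2
      have h2 : x ^ ((1 : ℝ) / r) ≤ x ^ (1 : ℝ) := by
        apply Real.rpow_le_rpow_of_exponent_le (Real.one_le_exp hX0.le)
        rw [div_le_one hr0]; exact_mod_cast hr1
      rw [Real.rpow_one] at h2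
      exact_mod_cast h1.trans (h2.trans hxq)
    · intro p hp hnp
      rw [mem_prs] at hp
      have h1 : ¬ p ≤ ⌊x ^ ((1 : ℝ) / r)⌋₊ := fun h => hnp (by
        rw [Finset.mem_filter, Finset.mem_Ioc]; exact ⟨⟨hp.2.pos, h⟩, hp.2⟩)
      rw [Nat.le_floor_iff (by positivity), not_le] at h1
      simp only [hf]
      rw [al_zero hX0, zero_mul]
      rw [Nat.cast_pow, Real.log_pow]
      have h2 := Real.log_le_log (by positivity) h1.le
      rw [Real.log_rpow hx0, hx, Real.log_exp] at h2
      rw [div_mul_eq_mul_div, one_mul, div_le_iff₀ hr0] at h2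
      linarith
  rw [Finset.sum_congr rfl e2] at e1
  have e3 : Finset.Icc 1 N = insert 1 (insert 2 (Finset.Icc 3 N)) := by
    ext r; simp only [Finset.mem_Icc, Finset.mem_insert]; omega
  rw [e3, Finset.sum_insert (by simp), Finset.sum_insert (by simp), ← add_assoc, ← Finset.sum_add_distrib] at e1
  simp only [pow_one] at e1
  rw [e1, add_sub_cancel_left]
  have h1 : ∀ r ∈ Finset.Icc 3 N, ‖∑ p ∈ prs q, f (p ^ r)‖ ≤ k * zc * ((2 : ℝ) ^ (-(1 / 2) : ℝ)) ^ (r - 3) := by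
    intro r hr
    calc ‖∑ p ∈ prs q, f (p ^ r)‖ ≤ ∑ p ∈ prs q, k * (p : ℝ) ^ (-(3 / 2) : ℝ) * ((2 : ℝ) ^ (-(1 / 2) : ℝ)) ^ (r - 3) := by
          apply norm_sum_le_of_le
          intro p hp
          simp only [hf]
          rw [norm_mul]
          refine (mul_le_of_le_one_right (norm_nonneg _) (DirichletCharacter.norm_le_one χ _)).trans ?_
          exact al_high hk hX0 (mem_prs.1 hp).2 (Finset.mem_Icc.1 hr).1
      _ = k * (∑ p ∈ prs q, (p : ℝ) ^ (-(3 / 2) : ℝ)) * ((2 : ℝ) ^ (-(1 / 2) : ℝ)) ^ (r - 3) := by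
          rw [Finset.mul_sum, Finset.sum_mul]
      _ ≤ _ := by
          gcongr
          exact zc_summable.sum_le_tsum _ fun n _ => by positivity
  refine (norm_sum_le_of_le _ h1).trans ?_
  rw [← Finset.mul_sum]
  unfold C1c
  have hρ : (2 : ℝ) ^ (-(1 / 2) : ℝ) < 1 := Real.rpow_lt_one_of_one_lt_of_neg (by norm_num) (by norm_num)
  apply mul_le_mul_of_nonneg_left _ (mul_nonneg hk zc_nonneg)
  rw [← tsum_geometric_of_lt_one (by positivity) hρ]
  have e4 : ∑ r ∈ Finset.Icc 3 N, ((2 : ℝ) ^ (-(1 / 2) : ℝ)) ^ (r - 3) =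
      ∑ j ∈ (Finset.Icc 3 N).image (fun r => r - 3), ((2 : ℝ) ^ (-(1 / 2) : ℝ)) ^ j := by
    rw [Finset.sum_image]
    intro a ha b hb hab
    rw [Finset.mem_coe, Finset.mem_Icc] at ha hb
    simp only at hab
    omega
  rw [e4]
  exact (summable_geometric_of_lt_one (by positivity) hρ).sum_le_tsum _ fun n _ => by positivity

lemma C0_bound {q : ℕ} [NeZero q] (hq : 3 ≤ q) {χ : DirichletCharacter ℂ q} (hχ : χ ≠ 1) (hp : χ.IsPrimitive)
    (hRH : dirichletRH χ) {k : ℝ} (hk : 0 ≤ k) {t : Fin 4 → ℝ} (ht0 : ∀ i, 0 ≤ t i) (ht : ∀ i, t i ≤ q + 1)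
    {X : ℝ} (hX : 1 ≤ X) (hXq : X ≤ Real.log q) :
    ∏ i, ‖DirichletCharacter.LFunction χ (1 / 2 + t i * I)‖ ^ (k / 2) ≤
      Real.exp (2 * (∑ p ∈ prs q, (al k t X p * χ p + al k t X (p ^ 2) * χ ((p ^ 2 : ℕ) : ZMod q))).re
        + (8 * k * M2c * (Real.log q / X) + 2 * C1c k)) := by
  have h1 : ∏ i, ‖DirichletCharacter.LFunction χ (1 / 2 + t i * I)‖ ^ (k / 2) ≤
      ∏ i, Real.exp ((k / 2) * ((DPoly χ X (t i)).re + 4 * M2c * Real.log q / X)) := by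
    apply Finset.prod_le_prod
    · intro i _; positivity
    · intro i _
      have := partA hq hχ hp hRH (ht0 i) (ht i) hX
      rw [mul_comm (k / 2), Real.exp_mul]
      exact Real.rpow_le_rpow (norm_nonneg _) this (by positivity)
  refine h1.trans ?_
  rw [← Real.exp_sum]
  apply Real.exp_le_exp.2
  have h2 := congrArg Complex.re (sum_DPoly χ k t X)
  have h3 : ∑ i, (k / 2) * (DPoly χ X (t i)).re = 2 * (Dp χ k t X).re := by
    rw [Complex.re_sum] at h2
    simp only [Complex.re_ofReal_mul] at h2
    rw [h2]; simp
  have h4 : ∑ i : Fin 4, (k / 2) * ((DPoly χ X (t i)).re + 4 * M2c * Real.log q / X) =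
      2 * (Dp χ k t X).re + 8 * k * M2c * (Real.log q / X) := by
    rw [← h3]
    simp only [mul_add, Finset.sum_add_distrib, Finset.sum_const, Finset.card_univ, Fintype.card_fin, nsmul_eq_mul]
    push_cast; ring
  rw [h4]
  have h5 := (Complex.abs_re_le_norm _).trans (C1_bound χ hk t hX hXq (by omega))
  rw [Complex.sub_re] at h5
  have := (abs_le.1 h5).2
  linarith

end S18


namespace S18

open MonoidAlgebra

noncomputable def Xs (q l : ℕ) : ℝ := Real.log q * Real.exp (-l)
noncomputable def Js (q : ℕ) : ℕ := ⌊Real.log (Real.log q)⌋₊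
noncomputable def idx (q p : ℕ) : ℕ := min (Js q) ⌊Real.log (Real.log q / Real.log p)⌋₊
noncomputable def RR (q i : ℕ) : Finset ℕ := (prs q).filter fun p => idx q p = i
noncomputable def Bc : ℝ := 8 * Real.exp 1 / Real.log 2

lemma Bc_pos : 0 < Bc := by
  have := Real.log_pos (by norm_num : (1 : ℝ) < 2)
  unfold Bc; positivity

lemma log_pos_prime {p : ℕ} (hp : p.Prime) : 0 < Real.log p := Real.log_pos (by exact_mod_cast hp.one_lt)

section
variable {q : ℕ} (hq : 1 ≤ Real.log q)
include hq

lemma Xs_le {l : ℕ} : Xs q l ≤ Real.log q := by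
  unfold Xs
  apply mul_le_of_le_one_right (by linarith)
  apply Real.exp_le_one_iff.2
  simp

lemma Xs_pos {l : ℕ} : 0 < Xs q l := by unfold Xs; positivity

lemma Xs_J : 1 ≤ Xs q (Js q) ∧ Xs q (Js q) ≤ Real.exp 1 := by
  have h0 : 0 ≤ Real.log (Real.log q) := Real.log_nonneg hq
  have h1 : (Js q : ℝ) ≤ Real.log (Real.log q) := Nat.floor_le h0
  have h2 : Real.log (Real.log q) < Js q + 1 := Nat.lt_floor_add_one _
  have e : Xs q (Js q) = Real.exp (Real.log (Real.log q) - Js q) := by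
    unfold Xs
    rw [sub_eq_add_neg, Real.exp_add, Real.exp_log (by linarith)]
  rw [e]
  exact ⟨Real.one_le_exp (by linarith), Real.exp_le_exp.2 (by linarith)⟩

lemma Xs_one_le {l : ℕ} (hl : l ≤ Js q) : 1 ≤ Xs q l := by
  refine (Xs_J hq).1.trans ?_
  unfold Xs
  have : (l : ℝ) ≤ Js q := by exact_mod_cast hl
  gcongr

lemma log_div_Xs {l : ℕ} : Real.log q / Xs q l = Real.exp l := by
  unfold Xs
  rw [Real.exp_neg]
  have : Real.log q ≠ 0 := by linarith
  field_simp

lemma idx_nonneg {p : ℕ} (hp : p.Prime) (hpq : p ≤ q) : 0 ≤ Real.log (Real.log q / Real.log p) := by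
  apply Real.log_nonneg
  rw [one_le_div (log_pos_prime hp)]
  exact Real.log_le_log (by exact_mod_cast hp.pos) (by exact_mod_cast hpq)

lemma RR_le {p i : ℕ} (hp : p ∈ RR q i) : Real.log p ≤ Xs q i := by
  unfold RR at hp
  rw [Finset.mem_filter, mem_prs] at hp
  obtain ⟨⟨hpq, hp⟩, hi⟩ := hp
  have h0 := log_pos_prime hp
  have h1 : (i : ℝ) ≤ Real.log (Real.log q / Real.log p) := by
    have : i ≤ ⌊Real.log (Real.log q / Real.log p)⌋₊ := by rw [← hi]; exact min_le_right _ _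
    exact (Nat.le_floor_iff (idx_nonneg hq hp hpq)).1 this
  have h2 := Real.exp_le_exp.2 h1
  rw [Real.exp_log (by positivity), le_div_iff₀ h0] at h2
  unfold Xs
  rw [Real.exp_neg, ← div_eq_mul_inv, le_div_iff₀ (Real.exp_pos _)]
  linarith

lemma RR_gt {p i : ℕ} (hp : p ∈ RR q i) (hi : i < Js q) : Xs q (i + 1) ≤ Real.log p := by
  unfold RR at hp
  rw [Finset.mem_filter, mem_prs] at hp
  obtain ⟨⟨hpq, hp⟩, hi'⟩ := hp
  have h0 := log_pos_prime hp
  have h1 : ⌊Real.log (Real.log q / Real.log p)⌋₊ = i := by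
    unfold idx at hi'; omega
  have h2 := Nat.lt_floor_add_one (Real.log (Real.log q / Real.log p))
  rw [h1] at h2
  have h3 := Real.exp_le_exp.2 h2.le
  rw [Real.exp_log (by positivity), div_le_iff₀ h0] at h3
  unfold Xs
  rw [Real.exp_neg, ← div_eq_mul_inv, div_le_iff₀ (Real.exp_pos _)]
  push_cast
  linarith

lemma RR_gt' {p i l : ℕ} (hp : p ∈ RR q i) (hi : i < l) (hl : l ≤ Js q) : Xs q l ≤ Real.log p := by
  refine le_trans ?_ (RR_gt hq hp (by omega))
  unfold Xs
  have : ((i + 1 : ℕ) : ℝ) ≤ l := by exact_mod_cast hi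
  gcongr

omit hq in
lemma RR_prime {p i : ℕ} (hp : p ∈ RR q i) : p.Prime := by
  unfold RR at hp
  rw [Finset.mem_filter, mem_prs] at hp
  exact hp.1.2

omit hq in
lemma RR_disj {i j : ℕ} (h : i ≠ j) : Disjoint (RR q i) (RR q j) := by
  apply Finset.disjoint_left.2
  intro p h1 h2
  unfold RR at h1 h2
  rw [Finset.mem_filter] at h1 h2
  exact h (h1.2.symm.trans h2.2)

omit hq in
lemma RR_sub (i : ℕ) : RR q i ⊆ prs q := Finset.filter_subset _ _

lemma RR_recip (i : ℕ) (hi : i ≤ Js q) : ∑ p ∈ RR q i, (1 : ℝ) / p ≤ Bc := by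
  have hl2 : 0 < Real.log 2 := Real.log_pos (by norm_num)
  have hl2' : Real.log 2 ≤ 1 := by have := Real.log_two_lt_d9; linarith
  rcases hi.lt_or_eq with h | h
  · have e : Xs q i = Real.exp 1 * Xs q (i + 1) := by
      unfold Xs
      rw [mul_left_comm, ← Real.exp_add]
      congr 2
      push_cast; ring
    have hp := Xs_pos hq (l := i + 1)
    have he : 1 ≤ Real.exp 1 := Real.one_le_exp (by norm_num)
    refine (recip_range hp (by rw [e]; nlinarith) (RR q i)
      (fun p hp => ⟨RR_prime hp, RR_gt hq hp h, RR_le hq hp⟩)).trans ?_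
    rw [e]
    have : 8 * (Real.exp 1 * Xs q (i + 1)) / Xs q (i + 1) = 8 * Real.exp 1 := by field_simp
    rw [this, Bc, le_div_iff₀ hl2]
    nlinarith
  · subst h
    have he : 1 ≤ Real.exp 1 := Real.one_le_exp (by norm_num)
    refine recip_range hl2 (by linarith) _ (fun p hp => ⟨RR_prime hp, ?_, (RR_le hq hp).trans (Xs_J hq).2⟩)
    exact Real.log_le_log (by norm_num) (by exact_mod_cast (RR_prime hp).two_le)

lemma sum_RR {l : ℕ} (hl : l ≤ Js q) {F : ℕ → ℂ} (hF : ∀ p ∈ prs q, Xs q l ≤ Real.log p → F p = 0) :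
    ∑ p ∈ prs q, F p = ∑ i ∈ Finset.Icc l (Js q), ∑ p ∈ RR q i, F p := by
  have h1 : ∑ p ∈ prs q, F p = ∑ i ∈ Finset.Icc 0 (Js q), ∑ p ∈ RR q i, F p := by
    unfold RR
    rw [Finset.sum_fiberwise_of_maps_to]
    intro p _
    rw [Finset.mem_Icc]
    exact ⟨Nat.zero_le _, min_le_left _ _⟩
  rw [h1]
  symm
  apply Finset.sum_subset
  · exact Finset.Icc_subset_Icc_left (Nat.zero_le _)
  · intro i hi hni
    rw [Finset.mem_Icc] at hi hni
    apply Finset.sum_eq_zero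
    intro p hp
    exact hF p (RR_sub i hp) (RR_gt' hq hp (by omega) hl)
end

/-! the polynomials -/

noncomputable def EE1 (k : ℝ) (t : Fin 4 → ℝ) (q l i : ℕ) : MonoidAlgebra ℂ ℕ :=
  ∑ p ∈ RR q i, MonoidAlgebra.single p (al k t (Xs q l) p)

noncomputable def EE (k : ℝ) (t : Fin 4 → ℝ) (q l i : ℕ) : MonoidAlgebra ℂ ℕ :=
  ∑ p ∈ RR q i, (MonoidAlgebra.single p (al k t (Xs q l) p) + MonoidAlgebra.single (p ^ 2) (al k t (Xs q l) (p ^ 2)))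

noncomputable def aa (k : ℝ) (t : Fin 4 → ℝ) (p : ℕ) : ℝ := ‖cc k t p‖ / √p

lemma aa_nonneg (k : ℝ) (t : Fin 4 → ℝ) (p : ℕ) : 0 ≤ aa k t p := by unfold aa; positivity

lemma aa_sq (k : ℝ) (t : Fin 4 → ℝ) (p : ℕ) : aa k t p ^ 2 = ‖cc k t p‖ ^ 2 / p := by
  unfold aa; rw [div_pow, Real.sq_sqrt (by positivity)]

section
variable {k : ℝ} (hk : 0 ≤ k) {t : Fin 4 → ℝ} {q : ℕ} (hq : 1 ≤ Real.log q)
include hq hk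

lemma aa_le {p : ℕ} (hp : p ≠ 0) : aa k t p ≤ k / √p := by
  unfold aa
  have := norm_cc_le hk t hp
  gcongr

omit hk in
lemma EE1_supp (l i : ℕ) : Supp (EE1 k t q l i) (LL (Xs q i)) := by
  apply Supp.sum
  intro p hp
  exact Supp.single _ ⟨(RR_prime hp).ne_zero, RR_le hq hp⟩

omit hk in
lemma EE_supp (l i : ℕ) : Supp (EE k t q l i) (LL (2 * Xs q i)) := by
  apply Supp.sum
  intro p hp
  have h := RR_le hq hp
  have h0 := Xs_pos hq (l := i)
  apply Supp.add
  · exact Supp.single _ ⟨(RR_prime hp).ne_zero, by linarith⟩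
  · refine Supp.single _ ⟨pow_ne_zero _ (RR_prime hp).ne_zero, ?_⟩
    rw [Nat.cast_pow, Real.log_pow]; push_cast; linarith

omit hk in
lemma EE1_maj (l i : ℕ) : Maj (EE1 k t q l i) (∑ p ∈ RR q i, MonoidAlgebra.single p (aa k t p)) := by
  apply Maj.sum
  intro p hp
  exact Maj.single (norm_al_prime (Xs_pos hq) (RR_prime hp))

lemma EE_maj (l i : ℕ) : Maj (EE k t q l i) (∑ p ∈ RR q i, loc p (aa k t p) (k / p)) := by
  apply Maj.sum
  intro p hp
  exact (Maj.single (norm_al_prime (Xs_pos hq) (RR_prime hp))).add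
    (Maj.single (norm_al_sq hk (Xs_pos hq) (RR_prime hp)))

/-- the product part of the majorant -/
noncomputable def BB (k : ℝ) (t : Fin 4 → ℝ) (q : ℕ) (d : ℕ → ℕ) (I : Finset ℕ) : MonoidAlgebra ℝ ℕ :=
  ∏ i ∈ I, ∏ p ∈ RR q i, texp (𝕜 := ℝ) (d i) (loc p (aa k t p) (k / p))

lemma prod_maj (l : ℕ) (d : ℕ → ℕ) (I : Finset ℕ) :
    Maj (∏ i ∈ I, texp (𝕜 := ℂ) (d i) (EE k t q l i)) (BB k t q d I) := by
  apply Maj.prod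
  intro i _
  refine ((EE_maj hk hq l i).texp (d i)).trans ?_
  apply texp_sum
  intro p hp
  exact maj_loc (aa_nonneg _ _ _) (by positivity)

noncomputable def C2c (k : ℝ) : ℝ := (4 * k ^ 2 * Real.exp (2 * k) + k) ^ 2

omit hq hk in
lemma BB_eq (d : ℕ → ℕ) (I : Finset ℕ) : BB k t q d I = ∏ p ∈ I.biUnion (RR q),
    texp (𝕜 := ℝ) (d (idx q p)) (loc p (aa k t p) (k / p)) := by
  unfold BB
  rw [Finset.prod_biUnion]
  · apply Finset.prod_congr rfl
    intro i _
    apply Finset.prod_congr rfl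
    intro p hp
    unfold RR at hp
    rw [(Finset.mem_filter.1 hp).2]
  · intro i _ j _ hij
    exact RR_disj hij

omit hq hk in
lemma BB_supp (d : ℕ → ℕ) (I : Finset ℕ) : Supp (BB k t q d I) (PS (I.biUnion (RR q))) := by
  rw [BB_eq]
  apply Supp.PS_prod
  intro p hp
  obtain ⟨i, _, hp'⟩ := Finset.mem_biUnion.1 hp
  exact (supp_loc (RR_prime hp') _ _ _).PS_mono (Finset.singleton_subset_iff.2 hp)

noncomputable def z2 : ℝ := ∑' n : ℕ, 1 / (n : ℝ) ^ 2

omit hq in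
lemma BB_N2 {d : ℕ → ℕ} (hd : ∀ i, 1 ≤ d i) (I : Finset ℕ) :
    N2 (BB k t q d I) ≤ Real.exp (∑ p ∈ prs q, ‖cc k t p‖ ^ 2 / p + C2c k * z2) := by
  rw [BB_eq]
  have hpr : ∀ p ∈ I.biUnion (RR q), p.Prime ∧ p ∈ prs q := by
    intro p hp
    obtain ⟨i, _, hp'⟩ := Finset.mem_biUnion.1 hp
    exact ⟨RR_prime hp', RR_sub i hp'⟩
  refine (N2_prod fun p hp => supp_loc (hpr p hp).1 _ _ _).trans ?_
  have h1 : ∀ p ∈ I.biUnion (RR q), N2 (texp (𝕜 := ℝ) (d (idx q p)) (loc p (aa k t p) (k / p))) ≤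
      Real.exp (‖cc k t p‖ ^ 2 / p + C2c k * (1 / (p : ℝ) ^ 2)) := by
    intro p hp
    have ha : aa k t p ≤ k / √p := by
      unfold aa
      have := norm_cc_le hk t (hpr p hp).1.ne_zero
      gcongr
    have := N2_loc_main (hpr p hp).1 hk (aa_nonneg k t p) (by positivity) ha le_rfl (hd (idx q p))
    rw [aa_sq] at this
    rwa [mul_one_div]
  refine (Finset.prod_le_prod (fun p _ => N2_nonneg _) h1).trans ?_
  rw [← Real.exp_sum]
  apply Real.exp_le_exp.2
  rw [Finset.sum_add_distrib]
  apply add_le_add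
  · apply Finset.sum_le_sum_of_subset_of_nonneg
    · intro p hp; exact (hpr p hp).2
    · intro p _ _; positivity
  · rw [← Finset.mul_sum]
    apply mul_le_mul_of_nonneg_left _ (sq_nonneg _)
    apply Summable.sum_le_tsum _ (fun n _ => by positivity)
    exact Real.summable_one_div_nat_pow.2 (by norm_num)

lemma sm_prod [NeZero q] (l : ℕ) {d : ℕ → ℕ} (hd : ∀ i, 1 ≤ d i) (I : Finset ℕ)
    (hlen : ∑ i ∈ I, 2 * (d i : ℝ) * Real.exp (-i) < 1) :
    ∑ χ : DirichletCharacter ℂ q, ‖ev χ (∏ i ∈ I, texp (𝕜 := ℂ) (d i) (EE k t q l i))‖ ^ 2 ≤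
      q.totient * Real.exp (∑ p ∈ prs q, ‖cc k t p‖ ^ 2 / p + C2c k * z2) := by
  refine (second_moment (prod_maj hk hq l d I) ?_).trans ?_
  · have h1 : Supp (∏ i ∈ I, texp (𝕜 := ℂ) (d i) (EE k t q l i)) (LL (∑ i ∈ I, d i * (2 * Xs q i))) := by
      apply Supp.LL_prod
      intro i _
      apply Supp.LL_texp (by have := Xs_pos hq (l := i); positivity)
      exact EE_supp hq l i
    apply h1.mono
    intro n hn
    refine ⟨hn.1, ?_⟩
    have h2 : ∑ i ∈ I, d i * (2 * Xs q i) = Real.log q * ∑ i ∈ I, 2 * (d i : ℝ) * Real.exp (-i) := by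
      rw [Finset.mul_sum]
      apply Finset.sum_congr rfl
      intro i _
      unfold Xs; ring
    have h3 : Real.log n < Real.log q := by
      refine hn.2.trans_lt ?_
      rw [h2]
      nlinarith
    have h4 := (Real.log_lt_log_iff (by exact_mod_cast Nat.pos_of_ne_zero hn.1)
      (by exact_mod_cast Nat.pos_of_ne_zero (NeZero.ne q))).1 h3
    exact_mod_cast h4
  · exact mul_le_mul_of_nonneg_left (BB_N2 hk hd I) (by positivity)

lemma sm_pow [NeZero q] (hk0 : 0 < k) (l l' : ℕ) {d : ℕ → ℕ} (hd : ∀ i, 1 ≤ d i) (I : Finset ℕ) {j m : ℕ} (hj : j ∉ I)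
    (hJ : j ≤ Js q) (hm : 1 ≤ m)
    (hlen : m * Real.exp (-j) + ∑ i ∈ I, 2 * (d i : ℝ) * Real.exp (-i) < 1) :
    ∑ χ : DirichletCharacter ℂ q, ‖ev χ (EE1 k t q l' j ^ m * ∏ i ∈ I, texp (𝕜 := ℂ) (d i) (EE k t q l i))‖ ^ 2 ≤
      q.totient * ((k ^ 2 * Bc * Real.exp 2 * m) ^ m *
        Real.exp (∑ p ∈ prs q, ‖cc k t p‖ ^ 2 / p + C2c k * z2)) := by
  have hB := Bc_pos
  have hm0 : (0 : ℝ) < m := by exact_mod_cast hm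
  set r : ℝ := √(m / (k ^ 2 * Bc)) with hr
  have hr0 : 0 < r := by rw [hr]; positivity
  have hr2 : r ^ 2 = m / (k ^ 2 * Bc) := Real.sq_sqrt (by positivity)
  have hself : ∀ p ∈ RR q j, Maj (MonoidAlgebra.single p (aa k t p)) (MonoidAlgebra.single p (aa k t p)) :=
    fun p _ => Maj.single (by rw [Real.norm_of_nonneg (aa_nonneg _ _ _)])
  have hmaj := (((EE1_maj hq (k := k) (t := t) l' j).pow m).trans (pow_maj hself m hr0)).mul (prod_maj hk hq (t := t) l d I)
  refine (second_moment hmaj ?_).trans ?_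
  · have h1 : Supp (∏ i ∈ I, texp (𝕜 := ℂ) (d i) (EE k t q l i)) (LL (∑ i ∈ I, d i * (2 * Xs q i))) := by
      apply Supp.LL_prod
      intro i _
      apply Supp.LL_texp (by have := Xs_pos hq (l := i); positivity)
      exact EE_supp hq l i
    apply (((EE1_supp hq l' j).LL_pow m).LL_mul h1).mono
    intro n hn
    refine ⟨hn.1, ?_⟩
    have h2 : ∑ i ∈ I, d i * (2 * Xs q i) = Real.log q * ∑ i ∈ I, 2 * (d i : ℝ) * Real.exp (-i) := by
      rw [Finset.mul_sum]
      apply Finset.sum_congr rfl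
      intro i _
      unfold Xs; ring
    have h3 : Real.log n < Real.log q := by
      refine hn.2.trans_lt ?_
      rw [h2]
      unfold Xs
      nlinarith
    have h4 := (Real.log_lt_log_iff (by exact_mod_cast Nat.pos_of_ne_zero hn.1)
      (by exact_mod_cast Nat.pos_of_ne_zero (NeZero.ne q))).1 h3
    exact_mod_cast h4
  · apply mul_le_mul_of_nonneg_left _ (by positivity)
    have hs1 : ∀ p ∈ RR q j, r • (MonoidAlgebra.single p (aa k t p) : MonoidAlgebra ℝ ℕ) =
        MonoidAlgebra.single p (r * aa k t p) := by
      intro p _; rw [MonoidAlgebra.smul_single, smul_eq_mul]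
    have e : ∏ p ∈ RR q j, texp (𝕜 := ℝ) m (r • (MonoidAlgebra.single p (aa k t p) : MonoidAlgebra ℝ ℕ)) =
        ∏ p ∈ RR q j, texp (𝕜 := ℝ) m (MonoidAlgebra.single p (r * aa k t p) : MonoidAlgebra ℝ ℕ) :=
      Finset.prod_congr rfl fun p hp => by rw [hs1 p hp]
    rw [e]
    have hsup : Supp (((m.factorial : ℝ) * r⁻¹ ^ m) • ∏ p ∈ RR q j, texp (𝕜 := ℝ) m (MonoidAlgebra.single p (r * aa k t p) : MonoidAlgebra ℝ ℕ))
        (PS (RR q j)) := by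
      apply Supp.smul
      apply Supp.PS_prod
      intro p hp
      exact (supp_loc' (RR_prime hp) _ _).PS_mono (Finset.singleton_subset_iff.2 hp)
    have hdis : Disjoint (RR q j) (I.biUnion (RR q)) := by
      rw [Finset.disjoint_biUnion_right]
      intro i hi
      exact RR_disj fun h => hj (h ▸ hi)
    refine (N2_mul hdis hsup (BB_supp d I)).trans ?_
    apply mul_le_mul _ (BB_N2 hk hd I) (N2_nonneg _) (by positivity)
    rw [N2_smul]
    have h1 : N2 (∏ p ∈ RR q j, texp (𝕜 := ℝ) m (MonoidAlgebra.single p (r * aa k t p) : MonoidAlgebra ℝ ℕ)) ≤ Real.exp (2 * m) := by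
      refine (N2_prod fun p hp => supp_loc' (RR_prime hp) _ _).trans ?_
      refine (Finset.prod_le_prod (fun p _ => N2_nonneg _) fun p hp => N2_loc_pow (RR_prime hp)
        (mul_nonneg hr0.le (aa_nonneg k t p)) hm).trans ?_
      rw [← Real.exp_sum]
      apply Real.exp_le_exp.2
      calc ∑ p ∈ RR q j, 2 * (r * aa k t p) ^ 2 ≤ ∑ p ∈ RR q j, (2 * r ^ 2 * k ^ 2) * (1 / p) := by
            apply Finset.sum_le_sum
            intro p hp
            rw [mul_pow, aa_sq]
            have h5 := norm_cc_le hk t (RR_prime hp).ne_zero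
            have h6 : ‖cc k t p‖ ^ 2 / p ≤ k ^ 2 * (1 / p) := by rw [mul_one_div]; gcongr
            calc 2 * (r ^ 2 * (‖cc k t p‖ ^ 2 / p)) ≤ 2 * (r ^ 2 * (k ^ 2 * (1 / p))) := by gcongr
              _ = _ := by ring
        _ = (2 * r ^ 2 * k ^ 2) * ∑ p ∈ RR q j, (1 : ℝ) / p := by rw [Finset.mul_sum]
        _ ≤ (2 * r ^ 2 * k ^ 2) * Bc := by
            apply mul_le_mul_of_nonneg_left (RR_recip hq j hJ) (by positivity)
        _ = 2 * m := by rw [hr2]; field_simp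
    have h2 : (m.factorial : ℝ) ≤ (m : ℝ) ^ m := by exact_mod_cast Nat.factorial_le_pow m
    calc ((m.factorial : ℝ) * r⁻¹ ^ m) ^ 2 * N2 _ ≤ ((m : ℝ) ^ m * r⁻¹ ^ m) ^ 2 * Real.exp (2 * m) := by
          gcongr
          exact N2_nonneg _
      _ = ((m : ℝ) ^ 2 * (r ^ 2)⁻¹) ^ m * (Real.exp 2) ^ m := by
          rw [mul_comm 2 (m : ℝ), Real.exp_nat_mul, ← mul_pow, ← pow_mul, mul_comm m 2, pow_mul, mul_pow (m : ℝ) r⁻¹ 2, inv_pow]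
      _ = (k ^ 2 * Bc * Real.exp 2 * m) ^ m := by
          rw [← mul_pow, hr2]
          congr 1
          field_simp
end
end S18


namespace S18

lemma sum_exp_neg_le (s : Finset ℕ) : ∑ i ∈ s, Real.exp (-(i : ℝ)) ≤ 2 := by
  have h : ∀ i : ℕ, Real.exp (-(i : ℝ)) ≤ (1 / 2 : ℝ) ^ i := by
    intro i
    have : Real.exp (-(i : ℝ)) = (Real.exp (-1)) ^ i := by rw [← Real.exp_nat_mul]; ring_nf
    rw [this]
    have := Real.exp_neg_one_lt_d9
    gcongr
    linarith
  calc ∑ i ∈ s, Real.exp (-(i : ℝ)) ≤ ∑ i ∈ s, (1 / 2 : ℝ) ^ i := Finset.sum_le_sum fun i _ => h i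
    _ ≤ ∑' i : ℕ, (1 / 2 : ℝ) ^ i := (summable_geometric_of_lt_one (by norm_num) (by norm_num)).sum_le_tsum _ fun i _ => by positivity
    _ = 2 := tsum_geometric_two

lemma texp_bound {z : ℂ} {Y : ℝ} (hz : ‖z‖ ≤ Y) {d i : ℕ} (hd : 21 * Y + (i + 2) ≤ d) :
    ‖Complex.exp z‖ ≤ Real.exp (Real.exp (-(i : ℝ))) * ‖texp (𝕜 := ℂ) d z‖ := by
  have hY : 0 ≤ Y := (norm_nonneg _).trans hz
  set n := d + 1 with hn
  have hnd : (n : ℝ) = d + 1 := by rw [hn]; push_cast; ring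
  have hi0 : (0 : ℝ) ≤ i := by positivity
  have e : texp (𝕜 := ℂ) d z = ∑ m ∈ Finset.range n, z ^ m / (m.factorial : ℂ) := by
    unfold texp
    apply Finset.sum_congr rfl
    intro j _
    rw [smul_eq_mul, div_eq_inv_mul]
  have h1 : ‖z‖ / (n.succ : ℝ) ≤ 1 / 2 := by
    rw [div_le_iff₀ (by positivity)]
    push_cast
    linarith
  have h2 := Complex.exp_bound' h1
  rw [← e] at h2
  have h3 : ‖z‖ ^ n / (n.factorial : ℝ) ≤ Real.exp (-(2 * n)) := by
    have h4 := Real.pow_div_factorial_le_exp (21 * Y) (by positivity) n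
    have h5 : ‖z‖ ^ n / (n.factorial : ℝ) ≤ Y ^ n / (n.factorial : ℝ) := by gcongr
    have h6 : Y ^ n / (n.factorial : ℝ) = (1 / 21) ^ n * ((21 * Y) ^ n / (n.factorial : ℝ)) := by
      rw [mul_pow, ← mul_div_assoc, ← mul_assoc, ← mul_pow]; norm_num
    have h7 : (1 / 21 : ℝ) ≤ Real.exp (-3) := by
      rw [Real.exp_neg, one_div]
      apply inv_anti₀ (Real.exp_pos _)
      have : Real.exp 3 = Real.exp 1 ^ 3 := by rw [← Real.exp_nat_mul]; norm_num
      rw [this]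
      have := Real.exp_one_lt_d9
      calc Real.exp 1 ^ 3 ≤ 2.75 ^ 3 := by gcongr; linarith
        _ ≤ 21 := by norm_num
    calc ‖z‖ ^ n / (n.factorial : ℝ) ≤ (1 / 21) ^ n * ((21 * Y) ^ n / (n.factorial : ℝ)) := h5.trans h6.le
      _ ≤ (Real.exp (-3)) ^ n * Real.exp (21 * Y) := by gcongr
      _ = Real.exp (-(3 * n) + 21 * Y) := by rw [← Real.exp_nat_mul, ← Real.exp_add]; ring_nf
      _ ≤ _ := Real.exp_le_exp.2 (by linarith)
  have h4 : Real.exp (-(2 * n)) * 2 ≤ Real.exp (-(i : ℝ)) / 2 * Real.exp (-Y) := by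
    have h5 : Real.exp (-(2 * n : ℝ)) ≤ Real.exp (-2) * (Real.exp (-(i : ℝ)) * Real.exp (-Y)) := by
      rw [← Real.exp_add, ← Real.exp_add]
      apply Real.exp_le_exp.2
      linarith
    have h6 : Real.exp (-2) ≤ 1 / 4 := by
      have : Real.exp (-2) = Real.exp (-1) ^ 2 := by rw [← Real.exp_nat_mul]; norm_num
      rw [this]
      have := Real.exp_neg_one_lt_d9
      calc Real.exp (-1) ^ 2 ≤ (1 / 2) ^ 2 := by gcongr; linarith
        _ = 1 / 4 := by norm_num
    have h7 : 0 < Real.exp (-(i : ℝ)) * Real.exp (-Y) := by positivity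
    nlinarith
  have h5 : Real.exp (-Y) ≤ ‖Complex.exp z‖ := by
    rw [Complex.norm_exp]
    apply Real.exp_le_exp.2
    have := (abs_le.1 (Complex.abs_re_le_norm z)).1
    linarith
  set x := Real.exp (-(i : ℝ)) with hx
  have hx0 : 0 < x := Real.exp_pos _
  have hx1 : x ≤ 1 := Real.exp_le_one_iff.2 (by linarith)
  have h6 : ‖Complex.exp z‖ - ‖texp (𝕜 := ℂ) d z‖ ≤ x / 2 * ‖Complex.exp z‖ := by
    calc _ ≤ ‖Complex.exp z - texp (𝕜 := ℂ) d z‖ := norm_sub_norm_le _ _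
      _ ≤ _ := h2
      _ ≤ Real.exp (-(2 * n)) * 2 := by gcongr
      _ ≤ x / 2 * Real.exp (-Y) := h4
      _ ≤ _ := by gcongr
  have h7 : ‖Complex.exp z‖ * (1 - x / 2) ≤ ‖texp (𝕜 := ℂ) d z‖ := by linarith
  have h8 : 1 ≤ Real.exp x * (1 - x / 2) := by
    have := Real.add_one_le_exp x
    nlinarith
  calc ‖Complex.exp z‖ ≤ ‖Complex.exp z‖ * (Real.exp x * (1 - x / 2)) := le_mul_of_one_le_right (norm_nonneg _) h8
    _ = Real.exp x * (‖Complex.exp z‖ * (1 - x / 2)) := by ring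
    _ ≤ _ := by gcongr

lemma ev_texp {q : ℕ} (χ : DirichletCharacter ℂ q) (d : ℕ) (E : MonoidAlgebra ℂ ℕ) :
    ev χ (texp (𝕜 := ℂ) d E) = texp (𝕜 := ℂ) d (ev χ E) := by
  unfold texp
  rw [map_sum]
  apply Finset.sum_congr rfl
  intro j _
  rw [map_smul, map_pow]

noncomputable def VV (i : ℕ) : ℝ := Real.exp (3 / 4 * i)
noncomputable def mm (i : ℕ) : ℕ := ⌊Real.exp i / 4⌋₊

lemma prod_texp_bound {z : ℕ → ℂ} {I : Finset ℕ} {Y : ℕ → ℝ} {d : ℕ → ℕ} (hz : ∀ i ∈ I, ‖z i‖ ≤ Y i)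
    (hd : ∀ i ∈ I, 21 * Y i + (i + 2) ≤ d i) :
    Real.exp (2 * ∑ i ∈ I, (z i).re) ≤ Real.exp 4 * ‖∏ i ∈ I, texp (𝕜 := ℂ) (d i) (z i)‖ ^ 2 := by
  have h1 : Real.exp (∑ i ∈ I, (z i).re) ≤ Real.exp 2 * ‖∏ i ∈ I, texp (𝕜 := ℂ) (d i) (z i)‖ := by
    rw [Real.exp_sum, norm_prod]
    calc ∏ i ∈ I, Real.exp (z i).re ≤ ∏ i ∈ I, (Real.exp (Real.exp (-(i : ℝ))) * ‖texp (𝕜 := ℂ) (d i) (z i)‖) := by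
          apply Finset.prod_le_prod (fun i _ => (Real.exp_pos _).le)
          intro i hi
          rw [← Complex.norm_exp]
          exact texp_bound (hz i hi) (hd i hi)
      _ = Real.exp (∑ i ∈ I, Real.exp (-(i : ℝ))) * ∏ i ∈ I, ‖texp (𝕜 := ℂ) (d i) (z i)‖ := by
          rw [Finset.prod_mul_distrib, Real.exp_sum]
      _ ≤ _ := by
          gcongr
          exact sum_exp_neg_le I
  calc Real.exp (2 * ∑ i ∈ I, (z i).re) = (Real.exp (∑ i ∈ I, (z i).re)) ^ 2 := by rw [← Real.exp_nat_mul]; push_cast; rfl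
    _ ≤ (Real.exp 2 * ‖∏ i ∈ I, texp (𝕜 := ℂ) (d i) (z i)‖) ^ 2 := by gcongr
    _ = _ := by rw [mul_pow, ← Real.exp_nat_mul]; norm_num

lemma pointwise {J j0 : ℕ} (hj0 : j0 ≤ J) (z z1 : ℕ → ℕ → ℂ) {B1 c c' G : ℝ} (hB1 : 0 ≤ B1)
    (hz : ∀ l i, i ≤ J → ‖z l i - z1 l i‖ ≤ B1)
    (hG : ∀ l ≤ J, G ≤ Real.exp (2 * ∑ i ∈ Finset.Icc l J, (z l i).re + (c * Real.exp l + c')))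
    {d : ℕ → ℕ} (hd : ∀ i, 21 * (VV i + B1) + (i + 2) ≤ d i) (hJ : ‖z1 J J‖ ≤ VV J) :
    G ≤ Real.exp (c * Real.exp j0 + c' + 4) * ‖∏ i ∈ Finset.Icc j0 J, texp (𝕜 := ℂ) (d i) (z j0 i)‖ ^ 2 +
      ∑ l ∈ Finset.Icc (j0 + 1) J, ∑ j ∈ Finset.Icc (l - 1) J,
        (Real.exp (c * Real.exp l + c' + 4) * Real.exp (2 * VV j + 2 * B1) * (VV j ^ (2 * mm j))⁻¹) *
          ‖z1 (l - 1) j ^ mm j * ∏ i ∈ (Finset.Icc l J).erase j, texp (𝕜 := ℂ) (d i) (z l i)‖ ^ 2 := by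
  classical
  have hVp : ∀ j, 0 < VV j := fun j => Real.exp_pos _
  set t0 := Real.exp (c * Real.exp j0 + c' + 4) * ‖∏ i ∈ Finset.Icc j0 J, texp (𝕜 := ℂ) (d i) (z j0 i)‖ ^ 2 with ht0
  set t1 : ℕ → ℕ → ℝ := fun l j => (Real.exp (c * Real.exp l + c' + 4) * Real.exp (2 * VV j + 2 * B1) * (VV j ^ (2 * mm j))⁻¹) *
          ‖z1 (l - 1) j ^ mm j * ∏ i ∈ (Finset.Icc l J).erase j, texp (𝕜 := ℂ) (d i) (z l i)‖ ^ 2 with ht1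
  have ht0' : 0 ≤ t0 := by positivity
  have ht1' : ∀ l j, 0 ≤ t1 l j := fun l j => by have := hVp j; positivity
  have hex : ∃ l, j0 ≤ l ∧ l ≤ J ∧ ∀ i ∈ Finset.Icc l J, ‖z1 l i‖ ≤ VV i :=
    ⟨J, hj0, le_rfl, fun i hi => by
      have : i = J := by have := Finset.mem_Icc.1 hi; omega
      rw [this]; exact hJ⟩
  obtain ⟨h1, h2, h3⟩ := Nat.find_spec hex
  have hmin := fun m => Nat.find_min hex (m := m)
  set l := Nat.find hex with hl
  have hzV : ∀ i ∈ Finset.Icc l J, ‖z l i‖ ≤ VV i + B1 := by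
    intro i hi
    have h4 := hz l i (Finset.mem_Icc.1 hi).2
    have h5 := h3 i hi
    have h6 : z l i = z1 l i + (z l i - z1 l i) := by ring
    rw [h6]
    exact (norm_add_le _ _).trans (add_le_add h5 h4)
  have hGl := hG l h2
  rcases h1.eq_or_lt with h | h
  · have h4 := prod_texp_bound (z := z l) hzV (fun i _ => hd i)
    have : G ≤ t0 := by
      refine hGl.trans ?_
      rw [Real.exp_add, ht0, h]
      calc _ ≤ Real.exp 4 * ‖∏ i ∈ Finset.Icc l J, texp (𝕜 := ℂ) (d i) (z l i)‖ ^ 2 * Real.exp (c * Real.exp l + c') := by gcongr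
        _ = _ := by rw [Real.exp_add (c * Real.exp l + c') 4]; ring
    refine this.trans (le_add_of_nonneg_right ?_)
    exact Finset.sum_nonneg fun l _ => Finset.sum_nonneg fun j _ => ht1' l j
  · have hfail := hmin (l - 1) (by omega)
    have : ∃ j ∈ Finset.Icc (l - 1) J, VV j < ‖z1 (l - 1) j‖ := by
      by_contra hcon
      push Not at hcon
      exact hfail ⟨by omega, by omega, hcon⟩
    obtain ⟨j, hj, hVj⟩ := this
    have hsum : ∑ i ∈ Finset.Icc l J, (z l i).re ≤ ∑ i ∈ (Finset.Icc l J).erase j, (z l i).re + (VV j + B1) := by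
      by_cases hjl : j ∈ Finset.Icc l J
      · rw [← Finset.sum_erase_add _ _ hjl]
        gcongr
        exact (Complex.re_le_norm _).trans (hzV j hjl)
      · rw [Finset.erase_eq_of_notMem hjl]
        have := hVp j
        linarith
    have h4 := prod_texp_bound (z := z l) (I := (Finset.Icc l J).erase j) (fun i hi => hzV i (Finset.mem_of_mem_erase hi)) (fun i _ => hd i)
    have h5 : 1 ≤ (VV j ^ (2 * mm j))⁻¹ * (‖z1 (l - 1) j‖ ^ mm j) ^ 2 := by
      rw [← pow_mul, mul_comm (mm j) 2, ← inv_pow, ← mul_pow]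
      apply one_le_pow₀
      rw [inv_mul_eq_div, one_le_div (hVp j)]
      exact hVj.le
    have : G ≤ t1 l j := by
      refine hGl.trans ?_
      calc Real.exp (2 * ∑ i ∈ Finset.Icc l J, (z l i).re + (c * Real.exp l + c'))
          ≤ Real.exp (2 * ∑ i ∈ (Finset.Icc l J).erase j, (z l i).re + (2 * VV j + 2 * B1) + (c * Real.exp l + c')) :=
            Real.exp_le_exp.2 (by linarith)
        _ = Real.exp (2 * ∑ i ∈ (Finset.Icc l J).erase j, (z l i).re) * (Real.exp (2 * VV j + 2 * B1) * Real.exp (c * Real.exp l + c')) := by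
            rw [add_assoc, Real.exp_add, Real.exp_add (2 * VV j + 2 * B1)]
        _ ≤ (Real.exp 4 * ‖∏ i ∈ (Finset.Icc l J).erase j, texp (𝕜 := ℂ) (d i) (z l i)‖ ^ 2) *
              (Real.exp (2 * VV j + 2 * B1) * Real.exp (c * Real.exp l + c')) * 1 := by
            rw [mul_one]; gcongr
        _ ≤ (Real.exp 4 * ‖∏ i ∈ (Finset.Icc l J).erase j, texp (𝕜 := ℂ) (d i) (z l i)‖ ^ 2) *
              (Real.exp (2 * VV j + 2 * B1) * Real.exp (c * Real.exp l + c')) *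
              ((VV j ^ (2 * mm j))⁻¹ * (‖z1 (l - 1) j‖ ^ mm j) ^ 2) := by gcongr
        _ = t1 l j := by
            simp only [ht1]
            rw [Real.exp_add (c * Real.exp l + c') 4, norm_mul, norm_pow, mul_pow]
            ring
    have h6 : t1 l j ≤ ∑ j ∈ Finset.Icc (l - 1) J, t1 l j :=
      Finset.single_le_sum (f := fun j => t1 l j) (fun j _ => ht1' l j) hj
    have h7 : ∑ j ∈ Finset.Icc (l - 1) J, t1 l j ≤ ∑ l ∈ Finset.Icc (j0 + 1) J, ∑ j ∈ Finset.Icc (l - 1) J, t1 l j :=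
      Finset.single_le_sum (f := fun l => ∑ j ∈ Finset.Icc (l - 1) J, t1 l j)
        (fun l _ => Finset.sum_nonneg fun j _ => ht1' l j) (Finset.mem_Icc.2 ⟨h, h2⟩)
    linarith

end S18


namespace S18

noncomputable def dd (B1 : ℝ) (i : ℕ) : ℕ := ⌈21 * (VV i + B1)⌉₊ + i + 2

lemma one_le_VV (i : ℕ) : 1 ≤ VV i := by
  unfold VV; exact Real.one_le_exp (by positivity)

lemma dd_ge (B1 : ℝ) (i : ℕ) : 21 * (VV i + B1) + (i + 2) ≤ (dd B1 i : ℝ) := by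
  unfold dd
  have := Nat.le_ceil (21 * (VV i + B1))
  push_cast
  linarith

lemma dd_one (B1 : ℝ) (i : ℕ) : 1 ≤ dd B1 i := by unfold dd; omega

lemma dd_le {B1 : ℝ} (h : 0 ≤ B1) (i : ℕ) : (dd B1 i : ℝ) ≤ (26 + 21 * B1) * VV i := by
  unfold dd
  have h1 := one_le_VV i
  have := (Nat.ceil_lt_add_one (a := 21 * (VV i + B1)) (by positivity)).le
  have h2 : 3 / 4 * (i : ℝ) + 1 ≤ VV i := Real.add_one_le_exp _
  push_cast
  nlinarith

lemma dd_sum {B1 : ℝ} (h : 0 ≤ B1) : ∃ N : ℕ, ∀ I : Finset ℕ, (∀ i ∈ I, N ≤ i) →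
    ∑ i ∈ I, 2 * (dd B1 i : ℝ) * Real.exp (-(i : ℝ)) < 1 / 2 := by
  have hs : Summable fun i : ℕ => 2 * (dd B1 i : ℝ) * Real.exp (-(i : ℝ)) := by
    have hg : Summable fun i : ℕ => (2 * (26 + 21 * B1)) * (Real.exp (-(1 / 4 : ℝ))) ^ i := by
      apply Summable.mul_left
      apply summable_geometric_of_lt_one (by positivity)
      rw [Real.exp_lt_one_iff]; norm_num
    refine Summable.of_nonneg_of_le (fun i => by positivity) (fun i => ?_) hg
    have h2 : VV i * Real.exp (-(i : ℝ)) = Real.exp (-(1 / 4 : ℝ)) ^ i := by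
      unfold VV
      rw [← Real.exp_add, ← Real.exp_nat_mul]; ring_nf
    rw [← h2]
    have := mul_le_mul_of_nonneg_right (dd_le h i) (Real.exp_pos (-(i : ℝ))).le
    linarith
  obtain ⟨s, hs⟩ := summable_iff_vanishing_norm.1 hs (1 / 2) (by norm_num)
  refine ⟨s.sup id + 1, fun I hI => ?_⟩
  refine lt_of_le_of_lt (le_abs_self _) (hs I ?_)
  rw [Finset.disjoint_left]
  intro a ha has
  have h1 := hI a ha
  have h2 : a ≤ s.sup id := Finset.le_sup (f := id) has
  omega

lemma mm_le (j : ℕ) : (mm j : ℝ) * Real.exp (-(j : ℝ)) ≤ 1 / 4 := by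
  unfold mm
  have := Nat.floor_le (a := Real.exp j / 4) (by positivity)
  calc _ ≤ Real.exp j / 4 * Real.exp (-(j : ℝ)) := by gcongr
    _ = 1 / 4 := by rw [Real.exp_neg]; field_simp

lemma mm_bounds {j : ℕ} (hj : 3 ≤ j) : Real.exp j / 8 ≤ mm j ∧ (mm j : ℝ) ≤ Real.exp j / 4 ∧ 1 ≤ mm j := by
  have h8 : 8 ≤ Real.exp j := by
    have h3 : Real.exp 3 ≤ Real.exp j := Real.exp_le_exp.2 (by exact_mod_cast hj)
    have : Real.exp 3 = Real.exp 1 ^ 3 := by rw [← Real.exp_nat_mul]; norm_num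
    have h2 : (2 : ℝ) ^ 3 ≤ Real.exp 1 ^ 3 := by
      have := Real.exp_one_gt_d9
      gcongr; linarith
    linarith
  have h1 : Real.exp j / 8 ≤ mm j := by
    unfold mm
    have := (Nat.lt_floor_add_one (Real.exp j / 4)).le
    linarith
  refine ⟨h1, Nat.floor_le (by positivity), ?_⟩
  have : (1 : ℝ) ≤ mm j := by linarith
  exact_mod_cast this

lemma scale_bound {c B1 K : ℝ} (hB : 0 ≤ B1) (hK : 0 < K) : ∃ N : ℕ, ∀ j : ℕ, N ≤ j →
    Real.exp (c * Real.exp (j + 1)) * Real.exp (2 * VV j + 2 * B1) * (VV j ^ (2 * mm j))⁻¹ * (K * mm j) ^ mm j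
      ≤ Real.exp (-(2 * j : ℝ)) := by
  refine ⟨max 3 ⌈16 * (c * Real.exp 1 + 4 + 2 * B1 + |Real.log K|)⌉₊, fun j hj => ?_⟩
  have h3 : 3 ≤ j := le_trans (le_max_left _ _) hj
  have hj2 : 16 * (c * Real.exp 1 + 4 + 2 * B1 + |Real.log K|) ≤ j :=
    (Nat.le_ceil _).trans (by exact_mod_cast (le_max_right _ _).trans hj)
  obtain ⟨hm1, hm2, hm0⟩ := mm_bounds h3
  set m := mm j with hm
  have hmp : (0 : ℝ) < m := by exact_mod_cast hm0
  set E := Real.exp j with hE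
  have hj0 : (0 : ℝ) ≤ j := by positivity
  have hEj : (j : ℝ) + 1 ≤ E := Real.add_one_le_exp _
  have e1 : Real.exp (j + 1) = E * Real.exp 1 := Real.exp_add _ _
  have e2 : (VV j ^ (2 * m))⁻¹ = Real.exp (-((2 * m : ℝ) * (3 / 4 * j))) := by
    unfold VV
    rw [← Real.exp_nat_mul, ← Real.exp_neg]; push_cast; ring_nf
  have e3 : (K * m) ^ m = Real.exp (m * (Real.log K + Real.log m)) := by
    rw [← Real.log_mul hK.ne' hmp.ne', Real.exp_nat_mul, Real.exp_log (by positivity)]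
  have hl : Real.log m ≤ j := by
    rw [Real.log_le_iff_le_exp hmp]
    linarith [Real.exp_pos (j : ℝ)]
  have hV : VV j ≤ E := Real.exp_le_exp.2 (by linarith)
  rw [e1, e2, e3, ← Real.exp_add, ← Real.exp_add, ← Real.exp_add]
  apply Real.exp_le_exp.2
  have a1 : m * (Real.log K + Real.log m) ≤ m * (|Real.log K| + j) := by
    gcongr; exact le_abs_self _
  have a2 : (m : ℝ) * |Real.log K| ≤ E * |Real.log K| := by
    gcongr; linarith
  have a3 : E / 8 * j ≤ m * j := by gcongr
  have a4 : E * (16 * (c * Real.exp 1 + 4 + 2 * B1 + |Real.log K|)) ≤ E * j := by gcongr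
  have a5 : 2 * B1 ≤ E * (2 * B1) := by nlinarith
  nlinarith

lemma abs_ev_sub {q : ℕ} [NeZero q] {k : ℝ} (hk : 0 ≤ k) (hq : 1 ≤ Real.log q) (t : Fin 4 → ℝ) (l i : ℕ) (hi : i ≤ Js q)
    (χ : DirichletCharacter ℂ q) : ‖ev χ (EE k t q l i) - ev χ (EE1 k t q l i)‖ ≤ k * Bc := by
  unfold EE EE1
  rw [Finset.sum_add_distrib, map_add, add_sub_cancel_left, map_sum]
  calc _ ≤ ∑ p ∈ RR q i, ‖ev χ (MonoidAlgebra.single (p ^ 2) (al k t (Xs q l) (p ^ 2)))‖ := norm_sum_le _ _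
    _ ≤ ∑ p ∈ RR q i, k * (1 / p) := by
      apply Finset.sum_le_sum
      intro p hp
      rw [ev_single, norm_mul]
      have h1 := norm_al_sq (t := t) hk (Xs_pos hq (l := l)) (RR_prime hp)
      have h2 := χ.norm_le_one ((p ^ 2 : ℕ) : ZMod q)
      calc _ ≤ k / p * 1 := by gcongr
        _ = _ := by ring
    _ ≤ _ := by rw [← Finset.mul_sum]; gcongr; exact RR_recip hq i hi

lemma ev_JJ {q : ℕ} [NeZero q] {k : ℝ} (hk : 0 ≤ k) (hq : 1 ≤ Real.log q) (t : Fin 4 → ℝ) (l : ℕ)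
    (χ : DirichletCharacter ℂ q) : ‖ev χ (EE1 k t q l (Js q))‖ ≤ Real.exp 2 * (k * Bc) := by
  unfold EE1
  rw [map_sum]
  calc _ ≤ ∑ p ∈ RR q (Js q), ‖ev χ (MonoidAlgebra.single p (al k t (Xs q l) p))‖ := norm_sum_le _ _
    _ ≤ ∑ p ∈ RR q (Js q), Real.exp 2 * k * (1 / p) := by
      apply Finset.sum_le_sum
      intro p hp
      rw [ev_single, norm_mul]
      have hpp := RR_prime hp
      have hp0 : (0 : ℝ) < p := by exact_mod_cast hpp.pos
      have h1 := norm_al_prime (k := k) (t := t) (Xs_pos hq (l := l)) hpp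
      have h2 := χ.norm_le_one ((p : ℕ) : ZMod q)
      have h3 := norm_cc_le hk t hpp.ne_zero
      have h4 : √p ≤ Real.exp 2 := by
        rw [Real.sqrt_le_left (by positivity), ← Real.exp_nat_mul]
        have : Real.log p ≤ 4 := by
          have := (RR_le hq hp).trans (Xs_J hq).2
          have := Real.exp_one_lt_d9
          linarith
        rw [← Real.log_le_iff_le_exp hp0]
        push_cast; linarith
      calc _ ≤ ‖cc k t p‖ / √p * 1 := by gcongr
        _ ≤ k / √p := by rw [mul_one]; gcongr
        _ = √p * k * (1 / p) := by
          have : (p : ℝ) = √p * √p := (Real.mul_self_sqrt hp0.le).symm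
          have hs : 0 < √(p : ℝ) := Real.sqrt_pos.2 hp0
          rw [mul_one_div, div_eq_div_iff hs.ne' hp0.ne']
          linear_combination k * this
        _ ≤ _ := by gcongr
    _ ≤ _ := by rw [← Finset.mul_sum, mul_assoc]; gcongr; exact RR_recip hq _ le_rfl

lemma hG_lem {q : ℕ} [NeZero q] (hq : 3 ≤ q) (hq1 : 1 ≤ Real.log q) {χ : DirichletCharacter ℂ q} (hχ : χ ≠ 1) (hp : χ.IsPrimitive)
    (hRH : dirichletRH χ) {k : ℝ} (hk : 0 ≤ k) {t : Fin 4 → ℝ} (ht0 : ∀ i, 0 ≤ t i) (ht : ∀ i, t i ≤ q + 1)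
    {l : ℕ} (hl : l ≤ Js q) :
    ∏ i, ‖DirichletCharacter.LFunction χ (1 / 2 + t i * I)‖ ^ (k / 2) ≤
      Real.exp (2 * ∑ i ∈ Finset.Icc l (Js q), (ev χ (EE k t q l i)).re + (8 * k * M2c * Real.exp l + 2 * C1c k)) := by
  have h := C0_bound hq hχ hp hRH hk ht0 ht (Xs_one_le hq1 hl) (Xs_le hq1)
  rw [log_div_Xs hq1] at h
  rw [sum_RR hq1 hl] at h
  · rw [Complex.re_sum] at h
    refine h.trans (le_of_eq ?_)
    congr 3
    apply Finset.sum_congr rfl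
    intro i _
    unfold EE
    rw [map_sum]
    congr 1
    apply Finset.sum_congr rfl
    intro p _
    rw [map_add, ev_single, ev_single]
  · intro p hp hXp
    have hpp := (mem_prs.1 hp).1
    rw [al_zero (Xs_pos hq1) hXp, al_zero (Xs_pos hq1), zero_mul, zero_mul, add_zero]
    push_cast
    rw [Real.log_pow]
    have : 0 ≤ Real.log p := Real.log_natCast_nonneg p
    push_cast
    linarith

open Classical in
lemma moment {k : ℝ} (hk0 : 0 < k) : ∃ C : ℝ, 0 < C ∧ ∃ q0 : ℕ, ∀ (q : ℕ) [NeZero q], q0 ≤ q →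
      (∀ χ : DirichletCharacter ℂ q, dirichletRH χ) →
      ∀ t : Fin 4 → ℝ, (∀ i, 0 ≤ t i) → (∀ i, t i ≤ q + 1) →
      ∑ χ ∈ Finset.univ.filter (fun χ : DirichletCharacter ℂ q => χ.IsPrimitive),
        ∏ i, ‖DirichletCharacter.LFunction χ (1 / 2 + t i * I)‖ ^ (k / 2)
      ≤ C * q.totient * Real.exp (∑ p ∈ prs q, ‖cc k t p‖ ^ 2 / p) := by
  have hk := hk0.le
  have hBc := Bc_pos
  set B1 := k * Bc with hB1
  have hB0 : 0 ≤ B1 := by positivity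
  set c := 8 * k * M2c with hc
  have hc0 : 0 ≤ c := by have := M2c_nonneg; positivity
  set c' := 2 * C1c k with hc'
  set K := k ^ 2 * Bc * Real.exp 2 with hK
  have hK0 : 0 < K := by positivity
  obtain ⟨N1, hN1⟩ := dd_sum hB0
  obtain ⟨N2, hN2⟩ := scale_bound (c := c) hB0 hK0
  set j0 := max 3 (max N1 N2) with hj0
  have j3 : 3 ≤ j0 := le_max_left _ _
  have jN1 : N1 ≤ j0 := (le_max_left _ _).trans (le_max_right _ _)
  have jN2 : N2 ≤ j0 := (le_max_right _ _).trans (le_max_right _ _)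
  obtain ⟨N3, hN3⟩ : ∃ N3 : ℕ, ∀ j : ℕ, N3 ≤ j → Real.exp 2 * (k * Bc) ≤ VV j := by
    refine ⟨⌈2 * (Real.exp 2 * (k * Bc))⌉₊, fun j hj => ?_⟩
    have h1 : 2 * (Real.exp 2 * (k * Bc)) ≤ j := (Nat.le_ceil _).trans (by exact_mod_cast hj)
    have h2 : 3 / 4 * (j : ℝ) + 1 ≤ VV j := Real.add_one_le_exp _
    linarith
  set N := max j0 N3 with hN
  refine ⟨Real.exp (C2c k * z2) * (Real.exp (c * Real.exp j0 + c' + 4) + 4 * Real.exp (c' + 4)), by positivity,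
    max 3 ⌈Real.exp (Real.exp N)⌉₊, ?_⟩
  intro q _ hq hRH t ht0 ht
  have hq3 : 3 ≤ q := (le_max_left _ _).trans hq
  have hqe : Real.exp (Real.exp N) ≤ q := (Nat.le_ceil _).trans (by exact_mod_cast (le_max_right _ _).trans hq)
  have hlog : Real.exp N ≤ Real.log q := by
    rw [Real.le_log_iff_exp_le (by positivity)]; exact hqe
  have hq1 : 1 ≤ Real.log q := (Real.one_le_exp (by positivity)).trans hlog
  have hJN : N ≤ Js q := by
    unfold Js
    apply Nat.le_floor
    rw [Real.le_log_iff_exp_le (by linarith)]; exact hlog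
  have hJ0 : j0 ≤ Js q := (le_max_left _ _).trans hJN
  have hJ3 : N3 ≤ Js q := (le_max_right _ _).trans hJN
  set J := Js q with hJ
  set Y := Real.exp (∑ p ∈ prs q, ‖cc k t p‖ ^ 2 / p + C2c k * z2) with hY
  -- pointwise bound
  have hpt : ∀ χ ∈ Finset.univ.filter (fun χ : DirichletCharacter ℂ q => χ.IsPrimitive),
      ∏ i, ‖DirichletCharacter.LFunction χ (1 / 2 + t i * I)‖ ^ (k / 2) ≤
      Real.exp (c * Real.exp j0 + c' + 4) * ‖ev χ (∏ i ∈ Finset.Icc j0 J, texp (𝕜 := ℂ) (dd B1 i) (EE k t q j0 i))‖ ^ 2 +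
      ∑ l ∈ Finset.Icc (j0 + 1) J, ∑ j ∈ Finset.Icc (l - 1) J,
        (Real.exp (c * Real.exp l + c' + 4) * Real.exp (2 * VV j + 2 * B1) * (VV j ^ (2 * mm j))⁻¹) *
          ‖ev χ (EE1 k t q (l - 1) j ^ mm j * ∏ i ∈ (Finset.Icc l J).erase j, texp (𝕜 := ℂ) (dd B1 i) (EE k t q l i))‖ ^ 2 := by
    intro χ hχ
    have hχp : χ.IsPrimitive := (Finset.mem_filter.1 hχ).2
    have hχ1 : χ ≠ 1 := by
      rintro rfl
      have h1 : (1 : DirichletCharacter ℂ q).conductor = q := hχp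
      rw [DirichletCharacter.conductor_one] at h1
      omega
    have h := pointwise (J := J) (j0 := j0) (B1 := B1) (c := c) (c' := c') hJ0 (fun l i => ev χ (EE k t q l i)) (fun l i => ev χ (EE1 k t q l i)) hB0
      (fun l i hi => abs_ev_sub hk hq1 t l i hi χ)
      (fun l hl => hG_lem hq3 hq1 hχ1 hχp (hRH χ) hk ht0 ht hl) (d := dd B1) (dd_ge B1)
      ((ev_JJ hk hq1 t J χ).trans (hN3 J hJ3))
    simpa only [map_mul, map_prod, map_pow, ev_texp] using h
  have hnn : ∀ E : MonoidAlgebra ℂ ℕ, ∑ χ ∈ Finset.univ.filter (fun χ : DirichletCharacter ℂ q => χ.IsPrimitive), ‖ev χ E‖ ^ 2 ≤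
      ∑ χ : DirichletCharacter ℂ q, ‖ev χ E‖ ^ 2 := fun E =>
    Finset.sum_le_sum_of_subset_of_nonneg (Finset.filter_subset _ _) fun χ _ _ => by positivity
  refine (Finset.sum_le_sum hpt).trans ?_
  rw [Finset.sum_add_distrib, Finset.sum_comm, ← Finset.mul_sum]
  have hA : ∑ χ ∈ Finset.univ.filter (fun χ : DirichletCharacter ℂ q => χ.IsPrimitive),
      ‖ev χ (∏ i ∈ Finset.Icc j0 J, texp (𝕜 := ℂ) (dd B1 i) (EE k t q j0 i))‖ ^ 2 ≤ q.totient * Y := by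
    refine (hnn _).trans (sm_prod hk hq1 j0 (dd_one B1) _ ?_)
    have := hN1 (Finset.Icc j0 J) (fun i hi => jN1.trans (Finset.mem_Icc.1 hi).1)
    linarith
  have hBd : ∀ l ∈ Finset.Icc (j0 + 1) J, ∑ χ ∈ Finset.univ.filter (fun χ : DirichletCharacter ℂ q => χ.IsPrimitive),
      ∑ j ∈ Finset.Icc (l - 1) J,
        (Real.exp (c * Real.exp l + c' + 4) * Real.exp (2 * VV j + 2 * B1) * (VV j ^ (2 * mm j))⁻¹) *
          ‖ev χ (EE1 k t q (l - 1) j ^ mm j * ∏ i ∈ (Finset.Icc l J).erase j, texp (𝕜 := ℂ) (dd B1 i) (EE k t q l i))‖ ^ 2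
      ≤ Real.exp (-((l - 1 : ℕ) : ℝ)) * (2 * (Real.exp (c' + 4) * (q.totient * Y))) := by
    intro l hl
    have hl' := Finset.mem_Icc.1 hl
    rw [Finset.sum_comm]
    have hj : ∀ j ∈ Finset.Icc (l - 1) J, ∑ χ ∈ Finset.univ.filter (fun χ : DirichletCharacter ℂ q => χ.IsPrimitive),
        (Real.exp (c * Real.exp l + c' + 4) * Real.exp (2 * VV j + 2 * B1) * (VV j ^ (2 * mm j))⁻¹) *
          ‖ev χ (EE1 k t q (l - 1) j ^ mm j * ∏ i ∈ (Finset.Icc l J).erase j, texp (𝕜 := ℂ) (dd B1 i) (EE k t q l i))‖ ^ 2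
        ≤ Real.exp (-((l - 1 : ℕ) : ℝ)) * Real.exp (-(j : ℝ)) * (Real.exp (c' + 4) * (q.totient * Y)) := by
      intro j hj
      have hj' := Finset.mem_Icc.1 hj
      have hjj : j0 ≤ j := by omega
      rw [← Finset.mul_sum]
      have hVp : 0 < VV j := lt_of_lt_of_le one_pos (one_le_VV j)
      have hsm := sm_pow (t := t) hk hq1 hk0 l (l - 1) (dd_one B1) ((Finset.Icc l J).erase j) (j := j) (m := mm j)
        (Finset.notMem_erase _ _) hj'.2 (mm_bounds (j3.trans hjj)).2.2 (by
          have h1 := hN1 ((Finset.Icc l J).erase j) (fun i hi => by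
            have := (Finset.mem_Icc.1 (Finset.mem_of_mem_erase hi)).1
            omega)
          have h2 := mm_le j
          linarith)
      have hsm' := (hnn _).trans hsm
      have hsc := hN2 j (jN2.trans hjj)
      have hlj : Real.exp l ≤ Real.exp ((j : ℝ) + 1) := by
        apply Real.exp_le_exp.2
        have : l ≤ j + 1 := by omega
        exact_mod_cast this
      have e1 : Real.exp (c * Real.exp l + c' + 4) ≤ Real.exp (c * Real.exp (j + 1)) * Real.exp (c' + 4) := by
        rw [← Real.exp_add]
        apply Real.exp_le_exp.2
        have := mul_le_mul_of_nonneg_left hlj hc0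
        linarith
      have e2 : Real.exp (-(2 * j : ℝ)) ≤ Real.exp (-((l - 1 : ℕ) : ℝ)) * Real.exp (-(j : ℝ)) := by
        rw [← Real.exp_add]
        apply Real.exp_le_exp.2
        have : ((l - 1 : ℕ) : ℝ) ≤ j := by exact_mod_cast hj'.1
        linarith
      calc _ ≤ (Real.exp (c * Real.exp l + c' + 4) * Real.exp (2 * VV j + 2 * B1) * (VV j ^ (2 * mm j))⁻¹) *
            (q.totient * ((K * mm j) ^ mm j * Y)) := by gcongr
        _ ≤ (Real.exp (c * Real.exp (j + 1)) * Real.exp (c' + 4) * Real.exp (2 * VV j + 2 * B1) * (VV j ^ (2 * mm j))⁻¹) *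
            (q.totient * ((K * mm j) ^ mm j * Y)) := by gcongr
        _ = (Real.exp (c * Real.exp (j + 1)) * Real.exp (2 * VV j + 2 * B1) * (VV j ^ (2 * mm j))⁻¹ * (K * mm j) ^ mm j) *
            (Real.exp (c' + 4) * (q.totient * Y)) := by ring
        _ ≤ _ := by
          refine mul_le_mul_of_nonneg_right (hsc.trans e2) (by positivity)
    refine (Finset.sum_le_sum hj).trans ?_
    rw [← Finset.sum_mul, ← Finset.mul_sum]
    have := sum_exp_neg_le (Finset.Icc (l - 1) J)
    calc _ ≤ Real.exp (-((l - 1 : ℕ) : ℝ)) * 2 * (Real.exp (c' + 4) * (q.totient * Y)) := by gcongr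
      _ = _ := by ring
  have hB : ∑ l ∈ Finset.Icc (j0 + 1) J, Real.exp (-((l - 1 : ℕ) : ℝ)) ≤ 2 := by
    have : ∑ l ∈ Finset.Icc (j0 + 1) J, Real.exp (-((l - 1 : ℕ) : ℝ)) =
        ∑ i ∈ (Finset.Icc (j0 + 1) J).image (fun l : ℕ => l - 1), Real.exp (-(i : ℝ)) := by
      rw [Finset.sum_image]
      intro a ha b hb h
      have h1 := (Finset.mem_Icc.1 ha).1
      have h2 := (Finset.mem_Icc.1 hb).1
      simp only at h
      omega
    rw [this]
    exact sum_exp_neg_le _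
  have hBB := Finset.sum_le_sum hBd
  rw [← Finset.sum_mul] at hBB
  have hYe : Y = Real.exp (C2c k * z2) * Real.exp (∑ p ∈ prs q, ‖cc k t p‖ ^ 2 / p) := by
    rw [hY, ← Real.exp_add]; ring_nf
  calc _ ≤ Real.exp (c * Real.exp j0 + c' + 4) * (q.totient * Y) + 2 * (2 * (Real.exp (c' + 4) * (q.totient * Y))) := by
        refine add_le_add (mul_le_mul_of_nonneg_left hA (by positivity)) (hBB.trans ?_)
        gcongr
    _ = _ := by rw [hYe]; ring
end S18


namespace S18

lemma jensen {F : ℝ → ℝ} (hF : Continuous F) (h0 : ∀ t, 0 ≤ F t) {p : ℝ} (hp : 1 ≤ p) {u g : ℝ} (hg : 0 < g) :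
    (∫ t in u..(u + g), F t) ^ p ≤ g ^ (p - 1) * ∫ t in u..(u + g), F t ^ p := by
  have hle : u ≤ u + g := by linarith
  have hvol : MeasureTheory.volume (Set.Ioc u (u + g)) = ENNReal.ofReal g := by
    rw [Real.volume_Ioc]; congr 1; ring
  have hcp : Continuous fun t => F t ^ p := hF.rpow_const fun _ => Or.inr (by linarith)
  have h := (convexOn_rpow hp).map_set_average_le (μ := MeasureTheory.volume) (t := Set.Ioc u (u + g)) (f := F)
    (Real.continuous_rpow_const (by linarith)).continuousOn isClosed_Ici
    (by rw [hvol]; simpa using hg) (by rw [hvol]; simp)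
    (Filter.Eventually.of_forall fun x => h0 x)
    (((hF.intervalIntegrable u (u+g)).1))
    ((hcp.intervalIntegrable u (u+g)).1)
  rw [MeasureTheory.setAverage_eq, MeasureTheory.setAverage_eq, MeasureTheory.measureReal_def, hvol, ENNReal.toReal_ofReal hg.le,
    ← intervalIntegral.integral_of_le hle] at h
  rw [← intervalIntegral.integral_of_le hle, smul_eq_mul, smul_eq_mul, Real.mul_rpow (by positivity)
    (intervalIntegral.integral_nonneg hle fun t _ => h0 t), Real.inv_rpow hg.le] at h
  have hgp : 0 < g ^ p := Real.rpow_pos_of_pos hg _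
  rw [inv_mul_le_iff₀ hgp] at h
  rw [Real.rpow_sub hg, Real.rpow_one]
  calc _ ≤ _ := h
    _ = _ := by ring

lemma int_half {δ s e : ℝ} (hδ : 0 < δ) (he : 0 ≤ e) : ∫ t in s..(s + e), 1 / √(δ + |s - t|) ≤ 2 * √e := by
  have hcongr : ∫ t in s..(s + e), 1 / √(δ + |s - t|) = ∫ t in s..(s + e), 1 / √(δ + (t - s)) := by
    apply intervalIntegral.integral_congr
    intro t ht
    rw [Set.uIcc_of_le (by linarith)] at ht
    simp only
    rw [abs_sub_comm, abs_of_nonneg (by linarith [ht.1])]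
  rw [hcongr]
  have hd : ∀ t ∈ Set.uIcc s (s + e), HasDerivAt (fun t => 2 * √(δ + (t - s))) (1 / √(δ + (t - s))) t := by
    intro t ht
    rw [Set.uIcc_of_le (by linarith)] at ht
    have hpos : 0 < δ + (t - s) := by linarith [ht.1]
    have h1 : HasDerivAt (fun t => δ + (t - s)) 1 t := ((hasDerivAt_id t).sub_const s).const_add δ
    have h2 := (h1.sqrt hpos.ne').const_mul 2
    have h3 : 2 * (1 / (2 * √(δ + (t - s)))) = 1 / √(δ + (t - s)) := by ring
    rw [h3] at h2
    exact h2
  rw [intervalIntegral.integral_eq_sub_of_hasDerivAt hd]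
  · have h1 : √(δ + (s + e - s)) ≤ √δ + √e := by
      rw [Real.sqrt_le_left (by positivity)]
      have := Real.sq_sqrt hδ.le
      have := Real.sq_sqrt he
      nlinarith [Real.sqrt_nonneg δ, Real.sqrt_nonneg e, mul_nonneg (Real.sqrt_nonneg δ) (Real.sqrt_nonneg e)]
    have h2 : √(δ + (s - s)) = √δ := by simp
    rw [h2]; linarith
  · apply ContinuousOn.intervalIntegrable
    intro t ht
    rw [Set.uIcc_of_le (by linarith)] at ht
    have hpos : 0 < δ + (t - s) := by linarith [ht.1]
    apply ContinuousAt.continuousWithinAt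
    have : √(δ + (t - s)) ≠ 0 := (Real.sqrt_pos.2 hpos).ne'
    fun_prop (disch := assumption)

lemma cont_hh {δ s : ℝ} (hδ : 0 < δ) : Continuous fun t : ℝ => 1 / √(δ + |s - t|) := by
  have : ∀ t : ℝ, √(δ + |s - t|) ≠ 0 := fun t => (Real.sqrt_pos.2 (by positivity)).ne'
  fun_prop (disch := assumption)

lemma int_hh {δ s u g : ℝ} (hδ : 0 < δ) (h1 : u ≤ s) (h2 : s ≤ u + g) :
    ∫ t in u..(u + g), 1 / √(δ + |s - t|) ≤ 4 * √g := by
  have hg : 0 ≤ g := by linarith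
  have hc := cont_hh (s := s) hδ
  rw [← intervalIntegral.integral_add_adjacent_intervals (hc.intervalIntegrable u s) (hc.intervalIntegrable s (u + g))]
  have a1 : ∫ t in s..(u + g), 1 / √(δ + |s - t|) ≤ 2 * √g := by
    have := int_half (s := s) (e := u + g - s) hδ (by linarith)
    rw [show s + (u + g - s) = u + g by ring] at this
    have h3 : √(u + g - s) ≤ √g := Real.sqrt_le_sqrt (by linarith)
    linarith
  have a2 : ∫ t in u..s, 1 / √(δ + |s - t|) ≤ 2 * √g := by
    have := int_half (s := -s) (e := s - u) hδ (by linarith)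
    have e1 : ∫ t in u..s, 1 / √(δ + |s - t|) = ∫ t in (-s)..(-u), 1 / √(δ + |-s - t|) := by
      rw [← intervalIntegral.integral_comp_neg (fun t => 1 / √(δ + |-s - t|))]
      apply intervalIntegral.integral_congr
      intro t _
      simp only
      rw [show -s - -t = -(s - t) by ring, abs_neg]
    rw [e1, show -u = -s + (s - u) by ring]
    have h3 : √(s - u) ≤ √g := Real.sqrt_le_sqrt (by linarith)
    linarith
  linarith

lemma sum_int_le {ι : Type*} (s : Finset ι) (w : ι → ℝ) {f : ι → ℝ → ℝ} (hf : ∀ x ∈ s, Continuous (f x)) {R : ℝ → ℝ}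
    (hR : Continuous R) {u v : ℝ} (huv : u ≤ v) (h : ∀ t ∈ Set.Icc u v, ∑ x ∈ s, w x * f x t ≤ R t) :
    ∑ x ∈ s, w x * ∫ t in u..v, f x t ≤ ∫ t in u..v, R t := by
  have e : ∑ x ∈ s, w x * ∫ t in u..v, f x t = ∫ t in u..v, ∑ x ∈ s, w x * f x t := by
    rw [intervalIntegral.integral_finsetSum]
    · apply Finset.sum_congr rfl
      intro x _
      rw [intervalIntegral.integral_const_mul]
    · intro x hx
      exact ((hf x hx).const_mul (w x)).intervalIntegrable _ _
  rw [e]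
  apply intervalIntegral.integral_mono_on huv _ (hR.intervalIntegrable _ _) h
  exact (continuous_finsetSum s fun x hx => (hf x hx).const_mul (w x)).intervalIntegrable _ _

/-- four-fold integration -/
lemma four_int {ι : Type*} (s : Finset ι) {f : ι → ℝ → ℝ} (hf : ∀ x ∈ s, Continuous (f x)) {u v g K δ : ℝ}
    (hg : 0 < g) (hK : 0 ≤ K) (hδ : 0 < δ)
    (h : ∀ a ∈ Set.Icc u (u + g), ∀ b ∈ Set.Icc u (u + g), ∀ c ∈ Set.Icc v (v + g), ∀ d ∈ Set.Icc v (v + g),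
      ∑ x ∈ s, f x a * f x b * f x c * f x d ≤ K * (1 / √(δ + |a - b|)) * (1 / √(δ + |c - d|))) :
    ∑ x ∈ s, (∫ t in u..(u + g), f x t) ^ 2 * (∫ t in v..(v + g), f x t) ^ 2 ≤ 16 * K * g ^ 3 := by
  have hu : u ≤ u + g := by linarith
  have hv : v ≤ v + g := by linarith
  set A : ι → ℝ := fun x => ∫ t in u..(u + g), f x t with hA
  set B : ι → ℝ := fun x => ∫ t in v..(v + g), f x t with hB
  have hsg : √g * √g = g := Real.mul_self_sqrt hg.le
  have s1 : ∀ a ∈ Set.Icc u (u + g), ∀ b ∈ Set.Icc u (u + g), ∀ c ∈ Set.Icc v (v + g),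
      ∑ x ∈ s, (f x a * f x b * B x) * f x c ≤ K * (1 / √(δ + |a - b|)) * (4 * √g) := by
    intro a ha b hb c hc
    have := sum_int_le s (fun x => f x a * f x b * f x c) hf
      (R := fun d => K * (1 / √(δ + |a - b|)) * (1 / √(δ + |c - d|))) ((cont_hh hδ).const_mul _) hv (h a ha b hb c hc)
    rw [intervalIntegral.integral_const_mul] at this
    calc _ = ∑ x ∈ s, f x a * f x b * f x c * B x := Finset.sum_congr rfl fun x _ => by ring
      _ ≤ _ := this
      _ ≤ _ := mul_le_mul_of_nonneg_left (int_hh hδ hc.1 hc.2) (by positivity)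
  have s2 : ∀ a ∈ Set.Icc u (u + g), ∀ b ∈ Set.Icc u (u + g),
      ∑ x ∈ s, (f x a * B x ^ 2) * f x b ≤ K * (4 * √g) * g * (1 / √(δ + |a - b|)) := by
    intro a ha b hb
    have := sum_int_le s (fun x => f x a * f x b * B x) hf
      (R := fun d => K * (1 / √(δ + |a - b|)) * (4 * √g)) continuous_const hv (s1 a ha b hb)
    rw [intervalIntegral.integral_const, smul_eq_mul] at this
    calc _ = ∑ x ∈ s, f x a * f x b * B x * B x := Finset.sum_congr rfl fun x _ => by ring
      _ ≤ _ := this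
      _ = _ := by ring
  have s3 : ∀ a ∈ Set.Icc u (u + g), ∑ x ∈ s, (A x * B x ^ 2) * f x a ≤ 16 * K * g ^ 2 := by
    intro a ha
    have := sum_int_le s (fun x => f x a * B x ^ 2) hf
      (R := fun b => K * (4 * √g) * g * (1 / √(δ + |a - b|))) ((cont_hh hδ).const_mul _) hu (s2 a ha)
    rw [intervalIntegral.integral_const_mul] at this
    calc _ = ∑ x ∈ s, f x a * B x ^ 2 * A x := Finset.sum_congr rfl fun x _ => by ring
      _ ≤ _ := this
      _ ≤ K * (4 * √g) * g * (4 * √g) := mul_le_mul_of_nonneg_left (int_hh hδ ha.1 ha.2) (by positivity)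
      _ = 16 * K * g * (√g * √g) := by ring
      _ = _ := by rw [hsg]; ring
  have := sum_int_le s (fun x => A x * B x ^ 2) hf (R := fun _ => 16 * K * g ^ 2) continuous_const hu s3
  rw [intervalIntegral.integral_const, smul_eq_mul] at this
  calc _ = ∑ x ∈ s, A x * B x ^ 2 * A x := Finset.sum_congr rfl fun x _ => by ring
    _ ≤ _ := this
    _ = _ := by ring
end S18


namespace S18

def HH {ι : Type*} (s : Finset ι) (F : ι → ℝ → ℝ) (k A L n : ℝ) : Prop :=
  ∀ t : Fin 4 → ℝ, (∀ i, t i ∈ Set.Icc n (n + 1)) →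
    ∑ x ∈ s, ∏ i, F x (t i) ^ (k / 2) ≤ A * Real.exp (k ^ 2 / 16 * ∑ i, ∑ j, Real.log (1 / (1 / L + |t i - t j|)))

section
variable {ι : Type*} {s : Finset ι} {F : ι → ℝ → ℝ} {k A L n : ℝ}

lemma diag_bound (hH : HH s F k A L n) (hc : ∀ x ∈ s, Continuous (F x)) (h0 : ∀ x ∈ s, ∀ t, 0 ≤ F x t) (hk : 2 < k)
    (hL : 1 ≤ L) {u g : ℝ} (hg : 0 < g) (hu : n ≤ u) (hug : u + g ≤ n + 1) :
    ∑ x ∈ s, (∫ t in u..(u + g), F x t) ^ (2 * k) ≤ A * L ^ (k ^ 2) * g ^ (2 * k) := by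
  have hpt : ∀ t ∈ Set.Icc u (u + g), ∑ x ∈ s, (1 : ℝ) * F x t ^ (2 * k) ≤ A * L ^ (k ^ 2) := by
    intro t ht
    have h := hH (fun _ => t) (fun _ => ⟨by linarith [ht.1], by linarith [ht.2]⟩)
    calc _ = ∑ x ∈ s, ∏ i : Fin 4, F x t ^ (k / 2) := by
          apply Finset.sum_congr rfl
          intro x hx
          rw [one_mul, Finset.prod_const, Finset.card_univ, Fintype.card_fin, ← Real.rpow_mul_natCast (h0 x hx t)]
          congr 1; push_cast; ring
      _ ≤ _ := h
      _ = _ := by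
        rw [Real.rpow_def_of_pos (by linarith)]
        simp
        left; ring
  have h1 := sum_int_le s (fun _ => 1) (f := fun x t => F x t ^ (2 * k))
    (fun x hx => (hc x hx).rpow_const fun _ => Or.inr (by linarith)) (R := fun _ => A * L ^ (k ^ 2)) continuous_const
    (show u ≤ u + g by linarith) hpt
  rw [intervalIntegral.integral_const, smul_eq_mul] at h1
  calc _ ≤ ∑ x ∈ s, g ^ (2 * k - 1) * (1 * ∫ t in u..(u + g), F x t ^ (2 * k)) := by
        apply Finset.sum_le_sum
        intro x hx
        rw [one_mul]
        exact jensen (hc x hx) (h0 x hx) (by linarith) hg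
    _ ≤ g ^ (2 * k - 1) * ((u + g - u) * (A * L ^ (k ^ 2))) := by
        rw [← Finset.mul_sum]
        gcongr
    _ = _ := by
      rw [Real.rpow_sub hg, Real.rpow_one]; field_simp; ring

lemma pair_bound (hH : HH s F k A L n) (hA : 0 ≤ A) (hc : ∀ x ∈ s, Continuous (F x)) (h0 : ∀ x ∈ s, ∀ t, 0 ≤ F x t) (hk : 2 < k)
    (hL : 1 ≤ L) {u v g : ℝ} (hg : 0 < g) (hu : n ≤ u) (huv : u + 2 * g ≤ v) (hvg : v + g ≤ n + 1) :
    ∑ x ∈ s, ((∫ t in u..(u + g), F x t) * (∫ t in v..(v + g), F x t)) ^ k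
      ≤ 16 * A * L ^ (k ^ 2 / 2 - 1) * g ^ (2 * k - 1 - k ^ 2 / 2) := by
  have hL0 : 0 < L := by linarith
  have hδ : 0 < 1 / L := by positivity
  have hlL : Real.log (1 / (1 / L)) = Real.log L := by simp
  set K := A * L ^ (k ^ 2 / 2 - 1) * g ^ (-(k ^ 2 / 2)) with hK
  have hlog : ∀ x : ℝ, Real.log (1 / (1 / L + |x|)) ≤ Real.log L := by
    intro x
    rw [← hlL]
    apply Real.log_le_log (by positivity)
    apply one_div_le_one_div_of_le hδ
    linarith [abs_nonneg x]
  have hsq : ∀ x : ℝ, Real.exp (Real.log (1 / (1 / L + |x|)) / 2) = 1 / √(1 / L + |x|) := by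
    intro x
    rw [Real.exp_half, Real.exp_log (by positivity), Real.sqrt_div (by norm_num), Real.sqrt_one]
  have hcr : ∀ x : ℝ, g ≤ |x| → Real.log (1 / (1 / L + |x|)) ≤ -Real.log g := by
    intro x hx
    rw [one_div, Real.log_inv]
    have := Real.log_le_log hg (show g ≤ 1 / L + |x| by linarith)
    linarith
  have h4 := four_int s (f := fun x t => F x t ^ (k / 2)) (u := u) (v := v) (g := g) (K := K) (δ := 1 / L)
    (fun x hx => (hc x hx).rpow_const fun _ => Or.inr (by linarith)) hg (by positivity) hδ (by
    intro a ha b hb c hc d hd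
    have h := hH ![a, b, c, d] (by
      intro i
      fin_cases i
      · exact ⟨by simpa using hu.trans ha.1, by simp; linarith [ha.2]⟩
      · exact ⟨by simpa using hu.trans hb.1, by simp; linarith [hb.2]⟩
      · exact ⟨by simp; linarith [hc.1], by simp; linarith [hc.2]⟩
      · exact ⟨by simp; linarith [hd.1], by simp; linarith [hd.2]⟩)
    have hlhs : ∑ x ∈ s, F x a ^ (k / 2) * F x b ^ (k / 2) * F x c ^ (k / 2) * F x d ^ (k / 2) =
        ∑ x ∈ s, ∏ i, F x (![a, b, c, d] i) ^ (k / 2) := by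
      apply Finset.sum_congr rfl
      intro x _
      rw [Fin.prod_univ_four]; rfl
    rw [hlhs]
    refine h.trans ?_
    have hS : ∑ i, ∑ j, Real.log (1 / (1 / L + |![a, b, c, d] i - ![a, b, c, d] j|)) ≤
        4 * Real.log L - 8 * Real.log g + 2 * Real.log (1 / (1 / L + |a - b|)) + 2 * Real.log (1 / (1 / L + |c - d|)) := by
      have hab := congrArg (fun y => Real.log (1 / (1 / L + y))) (abs_sub_comm b a)
      have hcd := congrArg (fun y => Real.log (1 / (1 / L + y))) (abs_sub_comm d c)
      have cr : ∀ x ∈ Set.Icc u (u + g), ∀ y ∈ Set.Icc v (v + g),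
          Real.log (1 / (1 / L + |x - y|)) ≤ -Real.log g ∧ Real.log (1 / (1 / L + |y - x|)) ≤ -Real.log g := by
        intro x hx y hy
        have h2 : g ≤ |y - x| := by
          rw [abs_of_nonneg (by linarith [hx.2, hy.1])]; linarith [hx.2, hy.1]
        exact ⟨hcr _ (by rwa [abs_sub_comm]), hcr _ h2⟩
      have d0 : ∀ x : ℝ, Real.log (1 / (1 / L + |x - x|)) = Real.log L := by intro x; simp
      simp only [Fin.sum_univ_four]
      change Real.log (1 / (1 / L + |a - a|)) + Real.log (1 / (1 / L + |a - b|)) + Real.log (1 / (1 / L + |a - c|)) + Real.log (1 / (1 / L + |a - d|)) +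
        (Real.log (1 / (1 / L + |b - a|)) + Real.log (1 / (1 / L + |b - b|)) + Real.log (1 / (1 / L + |b - c|)) + Real.log (1 / (1 / L + |b - d|))) +
        (Real.log (1 / (1 / L + |c - a|)) + Real.log (1 / (1 / L + |c - b|)) + Real.log (1 / (1 / L + |c - c|)) + Real.log (1 / (1 / L + |c - d|))) +
        (Real.log (1 / (1 / L + |d - a|)) + Real.log (1 / (1 / L + |d - b|)) + Real.log (1 / (1 / L + |d - c|)) + Real.log (1 / (1 / L + |d - d|))) ≤ _
      rw [d0, d0, d0, d0, hab, hcd]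
      linarith [(cr a ha c hc).1, (cr a ha c hc).2, (cr a ha d hd).1, (cr a ha d hd).2,
        (cr b hb c hc).1, (cr b hb c hc).2, (cr b hb d hd).1, (cr b hb d hd).2]
    have hk4 : 4 ≤ k ^ 2 := by nlinarith
    have hE : k ^ 2 / 16 * ∑ i, ∑ j, Real.log (1 / (1 / L + |![a, b, c, d] i - ![a, b, c, d] j|)) ≤
        Real.log L * (k ^ 2 / 2 - 1) + Real.log g * (-(k ^ 2 / 2)) + Real.log (1 / (1 / L + |a - b|)) / 2 +
          Real.log (1 / (1 / L + |c - d|)) / 2 := by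
      have h1 := mul_le_mul_of_nonneg_left hS (show 0 ≤ k ^ 2 / 16 by positivity)
      have h2 := mul_le_mul_of_nonneg_left (hlog (a - b)) (show 0 ≤ k ^ 2 / 8 - 1 / 2 by linarith)
      have h3 := mul_le_mul_of_nonneg_left (hlog (c - d)) (show 0 ≤ k ^ 2 / 8 - 1 / 2 by linarith)
      linarith
    calc _ ≤ A * Real.exp (Real.log L * (k ^ 2 / 2 - 1) + Real.log g * (-(k ^ 2 / 2)) + Real.log (1 / (1 / L + |a - b|)) / 2 +
          Real.log (1 / (1 / L + |c - d|)) / 2) := by gcongr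
      _ = _ := by
        rw [Real.exp_add, Real.exp_add, Real.exp_add, hsq, hsq, hK, Real.rpow_def_of_pos hL0, Real.rpow_def_of_pos hg]
        ring)
  have hx : ∀ x ∈ s, ((∫ t in u..(u + g), F x t) * (∫ t in v..(v + g), F x t)) ^ k ≤ g ^ (2 * k - 4) *
      ((∫ t in u..(u + g), F x t ^ (k / 2)) ^ 2 * (∫ t in v..(v + g), F x t ^ (k / 2)) ^ 2) := by
    intro x hx
    have p1 : ∀ w : ℝ, 0 ≤ ∫ t in w..(w + g), F x t := fun w =>
      intervalIntegral.integral_nonneg (by linarith) fun t _ => h0 x hx t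
    have e1 : ∀ w : ℝ, (∫ t in w..(w + g), F x t) ^ k ≤ (g ^ (k / 2 - 1) * ∫ t in w..(w + g), F x t ^ (k / 2)) ^ 2 := by
      intro w
      have h1 := jensen (hc x hx) (h0 x hx) (p := k / 2) (u := w) (by linarith) hg
      calc _ = ((∫ t in w..(w + g), F x t) ^ (k / 2)) ^ 2 := by
            rw [← Real.rpow_mul_natCast (p1 w)]; congr 1; push_cast; ring
        _ ≤ _ := by
          have := Real.rpow_nonneg (p1 w) (k / 2)
          gcongr
    rw [Real.mul_rpow (p1 u) (p1 v)]
    have hg4 : g ^ (2 * k - 4) = (g ^ (k / 2 - 1)) ^ 4 := by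
      rw [← Real.rpow_mul_natCast hg.le]; congr 1; push_cast; ring
    calc _ ≤ (g ^ (k / 2 - 1) * ∫ t in u..(u + g), F x t ^ (k / 2)) ^ 2 * (g ^ (k / 2 - 1) * ∫ t in v..(v + g), F x t ^ (k / 2)) ^ 2 :=
          mul_le_mul (e1 u) (e1 v) (Real.rpow_nonneg (p1 v) _) (by positivity)
      _ = _ := by rw [hg4]; ring
  refine (Finset.sum_le_sum hx).trans ?_
  rw [← Finset.mul_sum]
  refine (mul_le_mul_of_nonneg_left h4 (by positivity)).trans (le_of_eq ?_)
  have : g ^ (2 * k - 1 - k ^ 2 / 2) = g ^ (2 * k - 4) * g ^ (-(k ^ 2 / 2)) * g ^ 3 := by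
    rw [← Real.rpow_natCast g 3, ← Real.rpow_add hg, ← Real.rpow_add hg]; congr 1; push_cast; ring
  rw [this, hK]; ring
end
end S18


namespace S18

lemma sum_range_two_mul' (f : ℕ → ℝ) (N : ℕ) : ∑ b ∈ Finset.range (2 * N), f b = ∑ a ∈ Finset.range N, (f (2 * a) + f (2 * a + 1)) := by
  induction N with
  | zero => simp
  | succ N ih => rw [show 2 * (N + 1) = 2 * N + 1 + 1 by ring, Finset.sum_range_succ, Finset.sum_range_succ, ih, Finset.sum_range_succ]; ring

lemma shift_le {y : ℕ → ℝ} {N : ℕ} (h0 : ∀ a, 0 ≤ y a) (hz : ∀ a, N ≤ a → y a = 0) (c : ℕ) :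
    ∑ a ∈ Finset.range N, y (a + c) ≤ ∑ a ∈ Finset.range N, y a := by
  have h1 : ∑ a ∈ Finset.range (c + N), y a = ∑ a ∈ Finset.range c, y a + ∑ a ∈ Finset.range N, y (a + c) := by
    rw [Finset.sum_range_add]; simp only [add_comm]
  have h2 : ∑ a ∈ Finset.range (N + c), y a = ∑ a ∈ Finset.range N, y a := by
    rw [Finset.sum_range_add, Finset.sum_eq_zero (s := Finset.range c), add_zero]
    intro a _
    exact hz _ (by omega)
  rw [add_comm N c] at h2
  have : 0 ≤ ∑ a ∈ Finset.range c, y a := Finset.sum_nonneg fun a _ => h0 a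
  linarith

lemma prod_le_half {y z m : ℝ} (hy : 0 ≤ y) (hz : 0 ≤ z) (hm : 0 ≤ m) (h : y * z ≤ m ^ 2) : y * z ≤ m * ((y + z) / 2) := by
  have h1 : √(y * z) ≤ m := by rw [Real.sqrt_le_left hm]; exact h
  have h2 : √(y * z) ≤ (y + z) / 2 := by
    rw [Real.sqrt_le_left (by positivity)]; nlinarith [sq_nonneg (y - z)]
  calc y * z = √(y * z) * √(y * z) := (Real.mul_self_sqrt (by positivity)).symm
    _ ≤ _ := by gcongr

lemma chain {x : ℕ → ℕ → ℝ} (h0 : ∀ j a, 0 ≤ x j a) (hz : ∀ j a, 2 ^ j ≤ a → x j a = 0)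
    (hr : ∀ j a, x j a = x (j + 1) (2 * a) + x (j + 1) (2 * a + 1)) {J : ℕ} {D : ℝ} {m : ℕ → ℝ}
    (hD : ∀ a, x J a ≤ D) (hm0 : ∀ j, 0 ≤ m j) (hm2 : ∀ j ≤ J, ∀ a, x j a * x j (a + 2) ≤ m j ^ 2)
    (hm3 : ∀ j ≤ J, ∀ a, x j a * x j (a + 3) ≤ m j ^ 2) :
    x 0 0 ≤ 3 * D + 4 * ∑ j ∈ Finset.range J, m (j + 1) := by
  set M := x 0 0 with hM
  have hT : ∀ j, ∑ a ∈ Finset.range (2 ^ j), x j a = M := by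
    intro j
    induction j with
    | zero => simp [hM]
    | succ j ih => rw [pow_succ', sum_range_two_mul', ← ih]; exact Finset.sum_congr rfl fun a _ => (hr j a).symm
  set S : ℕ → ℝ := fun j => ∑ a ∈ Finset.range (2 ^ j), (x j a ^ 2 + 2 * (x j a * x j (a + 1))) with hS
  have hstep : ∀ j, j < J → S j ≤ S (j + 1) + 4 * m (j + 1) * M := by
    intro j hj
    have key : ∀ c, (∀ a, x (j + 1) a * x (j + 1) (a + c) ≤ m (j + 1) ^ 2) →
        ∑ b ∈ Finset.range (2 ^ (j + 1)), x (j + 1) b * x (j + 1) (b + c) ≤ m (j + 1) * M := by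
      intro c hc
      calc _ ≤ ∑ b ∈ Finset.range (2 ^ (j + 1)), m (j + 1) * ((x (j + 1) b + x (j + 1) (b + c)) / 2) :=
            Finset.sum_le_sum fun b _ => prod_le_half (h0 _ _) (h0 _ _) (hm0 _) (hc b)
        _ = m (j + 1) * ((∑ b ∈ Finset.range (2 ^ (j + 1)), x (j + 1) b + ∑ b ∈ Finset.range (2 ^ (j + 1)), x (j + 1) (b + c)) / 2) := by
            rw [← Finset.mul_sum, ← Finset.sum_div, Finset.sum_add_distrib]
        _ ≤ m (j + 1) * ((M + M) / 2) := by
            have h1 := shift_le (h0 (j + 1)) (hz (j + 1)) c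
            rw [hT] at h1 ⊢
            have := hm0 (j + 1)
            gcongr
        _ = _ := by ring
    have k2 := key 2 (hm2 (j + 1) hj)
    have k3 := key 3 (hm3 (j + 1) hj)
    have e : S j ≤ S (j + 1) + 2 * (∑ b ∈ Finset.range (2 ^ (j + 1)), x (j + 1) b * x (j + 1) (b + 2)
        + ∑ b ∈ Finset.range (2 ^ (j + 1)), x (j + 1) b * x (j + 1) (b + 3)) := by
      simp only [hS]
      rw [pow_succ', sum_range_two_mul', sum_range_two_mul', sum_range_two_mul', ← Finset.sum_add_distrib, Finset.mul_sum,
        ← Finset.sum_add_distrib]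
      apply Finset.sum_le_sum
      intro a _
      rw [hr j a, hr j (a + 1)]
      have hp := mul_nonneg (h0 (j + 1) (2 * a + 1)) (h0 (j + 1) (2 * a + 1 + 3))
      rw [show 2 * (a + 1) = 2 * a + 2 by ring, show 2 * a + 2 + 1 = 2 * a + 3 by ring, show 2 * a + 1 + 1 = 2 * a + 2 by ring,
        show 2 * a + 1 + 2 = 2 * a + 3 by ring]
      nlinarith
    linarith
  have hall : ∀ i ≤ J, S 0 ≤ S i + 4 * (∑ j ∈ Finset.range i, m (j + 1)) * M := by
    intro i
    induction i with
    | zero => intro _; simp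
    | succ i ih =>
      intro hi
      have h1 := ih (by omega)
      have h2 := hstep i (by omega)
      rw [Finset.sum_range_succ]
      linarith
  have hSJ : S J ≤ 3 * D * M := by
    simp only [hS]
    rw [← hT J, Finset.mul_sum]
    apply Finset.sum_le_sum
    intro a _
    have h1 := mul_le_mul_of_nonneg_left (hD a) (h0 J a)
    have h2 := mul_le_mul_of_nonneg_left (hD (a + 1)) (h0 J a)
    nlinarith
  have hS0 : S 0 = M ^ 2 := by
    simp only [hS]
    simp [hz 0 1 (by norm_num), hM]
  have hfin := hall J le_rfl
  rw [hS0] at hfin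
  have hsum : 0 ≤ ∑ j ∈ Finset.range J, m (j + 1) := Finset.sum_nonneg fun j _ => hm0 _
  have hD0 : 0 ≤ D := (h0 J 0).trans (hD 0)
  rcases (h0 0 0).eq_or_lt with h | h
  · rw [hM, ← h]; positivity
  · rw [← hM] at h
    by_contra hcon
    push Not at hcon
    nlinarith
end S18


namespace S18

lemma geo_le {r : ℝ} (h0 : 0 ≤ r) (h1 : r < 1) (N : ℕ) : ∑ j ∈ Finset.range N, r ^ (N - 1 - j) ≤ (1 - r)⁻¹ := by
  rw [Finset.sum_range_reflect (fun j => r ^ j) N, ← tsum_geometric_of_lt_one h0 h1]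
  exact (summable_geometric_of_lt_one h0 h1).sum_le_tsum _ fun i _ => by positivity

noncomputable def cell (F : ℝ → ℝ) (n : ℝ) (j a : ℕ) : ℝ :=
  if a < 2 ^ j then ∫ t in (n + a / 2 ^ j)..(n + a / 2 ^ j + 1 / 2 ^ j), F t else 0

lemma cell_nonneg {F : ℝ → ℝ} (h0 : ∀ t, 0 ≤ F t) (n : ℝ) (j a : ℕ) : 0 ≤ cell F n j a := by
  unfold cell
  split_ifs
  · exact intervalIntegral.integral_nonneg (by rw [le_add_iff_nonneg_right]; positivity) fun t _ => h0 t
  · exact le_rfl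

lemma cell_split {F : ℝ → ℝ} (hc : Continuous F) (n : ℝ) (j a : ℕ) :
    cell F n j a = cell F n (j + 1) (2 * a) + cell F n (j + 1) (2 * a + 1) := by
  unfold cell
  have hp : 2 ^ (j + 1) = 2 * 2 ^ j := pow_succ' 2 j
  by_cases h : a < 2 ^ j
  · rw [if_pos h, if_pos (by omega), if_pos (by omega)]
    have e1 : n + ((2 * a : ℕ) : ℝ) / 2 ^ (j + 1) = n + a / 2 ^ j := by
      rw [pow_succ]; push_cast; field_simp
    have e2 : n + ((2 * a + 1 : ℕ) : ℝ) / 2 ^ (j + 1) = n + a / 2 ^ j + 1 / 2 ^ (j + 1) := by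
      rw [pow_succ]; push_cast; field_simp; ring
    rw [e1, e2, intervalIntegral.integral_add_adjacent_intervals (hc.intervalIntegrable _ _) (hc.intervalIntegrable _ _)]
    congr 1
    rw [pow_succ]; field_simp; ring
  · rw [if_neg h, if_neg (by omega), if_neg (by omega), add_zero]

lemma partD {k : ℝ} (hk : 2 < k) : ∃ C : ℝ, 0 < C ∧ ∀ {ι : Type} (s : Finset ι) (F : ι → ℝ → ℝ) (A L n : ℝ),
    HH s F k A L n → 0 ≤ A → (∀ x ∈ s, Continuous (F x)) → (∀ x ∈ s, ∀ t, 0 ≤ F x t) → 1 ≤ L →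
    ∑ x ∈ s, (∫ t in n..(n + 1), F x t) ^ (2 * k) ≤ C * A * L ^ ((k - 1) ^ 2) := by
  set κ := (k - 2) ^ 2 / 2 with hκ
  have hκ0 : 0 < κ := by have : 0 < k - 2 := by linarith
                         positivity
  set r : ℝ := 2 ^ (-(κ / 2)) with hr
  have hr0 : 0 < r := by positivity
  have hr1 : r < 1 := Real.rpow_lt_one_of_one_lt_of_neg (by norm_num) (by linarith)
  have hP : 0 < 2 * k := by linarith
  set ρ : ℝ := r ^ (1 / (2 * k)) with hρ
  have hρ0 : 0 < ρ := by positivity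
  have hρ1 : ρ < 1 := Real.rpow_lt_one hr0.le hr1 (by positivity)
  have hρP : ∀ i : ℕ, (ρ ^ i) ^ (2 * k) = r ^ i := by
    intro i
    rw [hρ, ← Real.rpow_mul_natCast hr0.le, ← Real.rpow_mul hr0.le, ← Real.rpow_natCast]
    congr 1; field_simp
  have hρ1' : 0 < 1 - ρ := by linarith
  have hr1' : 0 < 1 - r := by linarith
  set C1 : ℝ := 3 + 4 * (1 - ρ)⁻¹ with hC1
  have hC10 : 0 < C1 := by positivity
  refine ⟨C1 ^ (2 * k) * (2 ^ (2 * k - 1) + 32 * (1 - r)⁻¹), by positivity, ?_⟩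
  intro ι s F A L n hH hA hc h0 hL
  have hL0 : 0 < L := by linarith
  -- choose J
  obtain ⟨J, hJ1, hJ2⟩ : ∃ J : ℕ, (2 : ℝ) ^ J ≤ L ∧ L < 2 ^ (J + 1) := exists_nat_pow_near hL (by norm_num)
  set x : ι → ℕ → ℕ → ℝ := fun χ j a => cell (F χ) n j a with hx
  have hx0 : ∀ χ ∈ s, ∀ j a, 0 ≤ x χ j a := fun χ hχ j a => cell_nonneg (h0 χ hχ) n j a
  have hxz : ∀ χ j a, 2 ^ j ≤ a → x χ j a = 0 := by
    intro χ j a h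
    simp only [hx, cell]
    rw [if_neg (by omega)]
  set Q1 : ι → ℝ := fun χ => ∑ a ∈ Finset.range (2 ^ J), x χ J a ^ (2 * k) with hQ1
  set Q2 : ι → ℕ → ℝ := fun χ j => ∑ a ∈ Finset.range (2 ^ j), ((x χ j a * x χ j (a + 2)) ^ k + (x χ j a * x χ j (a + 3)) ^ k) with hQ2
  set Q : ι → ℝ := fun χ => Q1 χ + ∑ j ∈ Finset.range (J + 1), (r⁻¹) ^ (J - j) * Q2 χ j with hQ
  have hQ10 : ∀ χ ∈ s, 0 ≤ Q1 χ := fun χ hχ => Finset.sum_nonneg fun a _ => Real.rpow_nonneg (hx0 χ hχ _ _) _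
  have hQ20 : ∀ χ ∈ s, ∀ j, 0 ≤ Q2 χ j := fun χ hχ j => Finset.sum_nonneg fun a _ =>
    add_nonneg (Real.rpow_nonneg (mul_nonneg (hx0 χ hχ _ _) (hx0 χ hχ _ _)) _)
      (Real.rpow_nonneg (mul_nonneg (hx0 χ hχ _ _) (hx0 χ hχ _ _)) _)
  have hQ0 : ∀ χ ∈ s, 0 ≤ Q χ := fun χ hχ => add_nonneg (hQ10 χ hχ) (Finset.sum_nonneg fun j _ =>
    mul_nonneg (by positivity) (hQ20 χ hχ j))
  have hQ2Q : ∀ χ ∈ s, ∀ j ≤ J, Q2 χ j ≤ r ^ (J - j) * Q χ := by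
    intro χ hχ j hj
    have h1 : (r⁻¹) ^ (J - j) * Q2 χ j ≤ Q χ := by
      have := Finset.single_le_sum (f := fun j => (r⁻¹) ^ (J - j) * Q2 χ j) (s := Finset.range (J + 1))
        (fun i _ => mul_nonneg (by positivity) (hQ20 χ hχ i)) (Finset.mem_range.2 (Nat.lt_succ_of_le hj))
      simp only [hQ]
      linarith [hQ10 χ hχ]
    rwa [inv_pow, inv_mul_le_iff₀ (by positivity)] at h1
  -- pointwise
  have hpt : ∀ χ ∈ s, (∫ t in n..(n + 1), F χ t) ^ (2 * k) ≤ C1 ^ (2 * k) * Q χ := by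
    intro χ hχ
    set T := Q χ ^ (1 / (2 * k)) with hT
    have hT0 : 0 ≤ T := Real.rpow_nonneg (hQ0 χ hχ) _
    have hTP : T ^ (2 * k) = Q χ := by
      rw [hT, ← Real.rpow_mul (hQ0 χ hχ), one_div_mul_cancel hP.ne', Real.rpow_one]
    have hxx : ∀ c, (∀ j a, a < 2 ^ j → (x χ j a * x χ j (a + c)) ^ k ≤ Q2 χ j) → ∀ j ≤ J, ∀ a,
        x χ j a * x χ j (a + c) ≤ (ρ ^ (J - j) * T) ^ 2 := by
      intro c hcc j hj a
      by_cases ha : a < 2 ^ j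
      · have h1 := (hcc j a ha).trans (hQ2Q χ hχ j hj)
        rw [← hTP, ← hρP, ← Real.mul_rpow (by positivity) hT0, Real.rpow_mul (by positivity), Real.rpow_two] at h1
        exact (Real.rpow_le_rpow_iff (mul_nonneg (hx0 χ hχ _ _) (hx0 χ hχ _ _)) (by positivity) (by linarith)).1 h1
      · rw [hxz χ j a (by omega), zero_mul]; positivity
    have hterm : ∀ j a, a < 2 ^ j → (x χ j a * x χ j (a + 2)) ^ k + (x χ j a * x χ j (a + 3)) ^ k ≤ Q2 χ j := by
      intro j a ha
      exact Finset.single_le_sum (f := fun a => (x χ j a * x χ j (a + 2)) ^ k + (x χ j a * x χ j (a + 3)) ^ k)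
        (fun a _ => add_nonneg (Real.rpow_nonneg (mul_nonneg (hx0 χ hχ _ _) (hx0 χ hχ _ _)) _)
          (Real.rpow_nonneg (mul_nonneg (hx0 χ hχ _ _) (hx0 χ hχ _ _)) _)) (Finset.mem_range.2 ha)
    have hch := chain (x := x χ) (J := J) (D := T) (m := fun j => ρ ^ (J - j) * T) (hx0 χ hχ) (hxz χ)
      (cell_split (hc χ hχ) n) (by
        intro a
        by_cases ha : a < 2 ^ J
        · have h1 : x χ J a ^ (2 * k) ≤ Q χ := by
            have := Finset.single_le_sum (f := fun a => x χ J a ^ (2 * k)) (s := Finset.range (2 ^ J))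
              (fun i _ => Real.rpow_nonneg (hx0 χ hχ _ _) _) (Finset.mem_range.2 ha)
            have h3 : 0 ≤ ∑ j ∈ Finset.range (J + 1), (r⁻¹) ^ (J - j) * Q2 χ j :=
              Finset.sum_nonneg fun j _ => mul_nonneg (by positivity) (hQ20 χ hχ j)
            simp only [hQ]
            linarith
          rw [← hTP] at h1
          exact (Real.rpow_le_rpow_iff (hx0 χ hχ _ _) hT0 hP).1 h1
        · rw [hxz χ J a (by omega)]; exact hT0)
      (fun j => by positivity)
      (hxx 2 fun j a ha => (le_add_of_nonneg_right (Real.rpow_nonneg (mul_nonneg (hx0 χ hχ _ _) (hx0 χ hχ _ _)) _)).trans (hterm j a ha))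
      (hxx 3 fun j a ha => (le_add_of_nonneg_left (Real.rpow_nonneg (mul_nonneg (hx0 χ hχ _ _) (hx0 χ hχ _ _)) _)).trans (hterm j a ha))
    have hM : x χ 0 0 = ∫ t in n..(n + 1), F χ t := by simp [hx, cell]
    rw [hM] at hch
    have hgeo : ∑ j ∈ Finset.range J, ρ ^ (J - (j + 1)) * T ≤ (1 - ρ)⁻¹ * T := by
      rw [← Finset.sum_mul]
      have := geo_le hρ0.le hρ1 J
      have e : ∑ j ∈ Finset.range J, ρ ^ (J - (j + 1)) = ∑ j ∈ Finset.range J, ρ ^ (J - 1 - j) :=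
        Finset.sum_congr rfl fun j _ => by congr 1; omega
      rw [e]; gcongr
    have hfin : ∫ t in n..(n + 1), F χ t ≤ C1 * T := by
      rw [hC1]; linarith
    have hI0 : 0 ≤ ∫ t in n..(n + 1), F χ t := by rw [← hM]; exact hx0 χ hχ _ _
    calc _ ≤ (C1 * T) ^ (2 * k) := Real.rpow_le_rpow hI0 hfin hP.le
      _ = _ := by rw [Real.mul_rpow hC10.le hT0, hTP]
  -- sum over the family
  have hcellx : ∀ χ j a, a < 2 ^ j → x χ j a = ∫ t in (n + a / 2 ^ j)..(n + a / 2 ^ j + 1 / 2 ^ j), F χ t := by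
    intro χ j a ha
    simp only [hx, cell]
    rw [if_pos ha]
  have hend : ∀ j a : ℕ, a < 2 ^ j → n + (a : ℝ) / 2 ^ j + 1 / 2 ^ j ≤ n + 1 := by
    intro j a ha
    have h1 : (a : ℝ) + 1 ≤ 2 ^ j := by exact_mod_cast ha
    have : (a : ℝ) / 2 ^ j + 1 / 2 ^ j ≤ 1 := by
      rw [← add_div, div_le_one (by positivity)]; exact h1
    linarith
  have hS1 : ∑ χ ∈ s, Q1 χ ≤ 2 ^ (2 * k - 1) * A * L ^ ((k - 1) ^ 2) := by
    simp only [hQ1]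
    rw [Finset.sum_comm]
    have hb : ∀ a ∈ Finset.range (2 ^ J), ∑ χ ∈ s, x χ J a ^ (2 * k) ≤ A * L ^ (k ^ 2) * (1 / 2 ^ J) ^ (2 * k) := by
      intro a ha
      have ha := Finset.mem_range.1 ha
      have := diag_bound hH hc h0 hk hL (u := n + a / 2 ^ J) (g := 1 / 2 ^ J) (by positivity)
        (by rw [le_add_iff_nonneg_right]; positivity) (hend J a ha)
      simpa only [hcellx _ J a ha] using this
    refine (Finset.sum_le_sum hb).trans ?_
    rw [Finset.sum_const, Finset.card_range, nsmul_eq_mul]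
    have h2 : L / 2 ≤ 2 ^ J := by rw [pow_succ] at hJ2; linarith
    have h3 : ((2 ^ J : ℕ) : ℝ) * (1 / 2 ^ J) ^ (2 * k) = ((2 : ℝ) ^ J) ^ (1 - 2 * k) := by
      rw [one_div, Real.inv_rpow (by positivity), Real.rpow_sub (by positivity), Real.rpow_one]
      push_cast; rfl
    have h4 : ((2 : ℝ) ^ J) ^ (1 - 2 * k) ≤ (L / 2) ^ (1 - 2 * k) :=
      Real.rpow_le_rpow_of_nonpos (by positivity) h2 (by linarith)
    have h5 : (L / 2) ^ (1 - 2 * k) = L ^ (1 - 2 * k) * 2 ^ (2 * k - 1) := by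
      rw [Real.div_rpow hL0.le (by norm_num), div_eq_mul_inv, ← Real.rpow_neg (by norm_num)]
      congr 2; ring
    have h6 : L ^ ((k - 1) ^ 2) = L ^ (k ^ 2) * L ^ (1 - 2 * k) := by
      rw [← Real.rpow_add hL0]; congr 1; ring
    calc _ = A * L ^ (k ^ 2) * (((2 ^ J : ℕ) : ℝ) * (1 / 2 ^ J) ^ (2 * k)) := by ring
      _ ≤ A * L ^ (k ^ 2) * (L ^ (1 - 2 * k) * 2 ^ (2 * k - 1)) := by
        rw [h3, ← h5]; gcongr
      _ = _ := by rw [h6]; ring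
  have hS2 : ∀ j ∈ Finset.range (J + 1), ∑ χ ∈ s, (r⁻¹) ^ (J - j) * Q2 χ j ≤ (32 * A * L ^ ((k - 1) ^ 2)) * r ^ (J + 1 - 1 - j) := by
    intro j hj
    have hj : j ≤ J := by have := Finset.mem_range.1 hj; omega
    rw [← Finset.mul_sum]
    simp only [hQ2]
    rw [Finset.sum_comm]
    set B := 16 * A * L ^ (k ^ 2 / 2 - 1) * (1 / 2 ^ j) ^ (2 * k - 1 - k ^ 2 / 2) with hB
    have hB0 : 0 ≤ B := by positivity
    have hb : ∀ c : ℕ, 2 ≤ c → ∀ a ∈ Finset.range (2 ^ j), ∑ χ ∈ s, (x χ j a * x χ j (a + c)) ^ k ≤ B := by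
      intro c hc2 a ha
      have ha := Finset.mem_range.1 ha
      by_cases hac : a + c < 2 ^ j
      · have := pair_bound hH hA hc h0 hk hL (u := n + a / 2 ^ j) (v := n + ((a + c : ℕ) : ℝ) / 2 ^ j) (g := 1 / 2 ^ j) (by positivity)
          (by rw [le_add_iff_nonneg_right]; positivity) (by
            have h1 : (2 : ℝ) / 2 ^ j ≤ c / 2 ^ j := by
              gcongr; exact_mod_cast hc2
            push_cast
            rw [add_div, mul_one_div]; linarith) (hend j _ hac)
        simpa only [hcellx _ j a ha, hcellx _ j _ hac] using this
      · refine le_trans (le_of_eq ?_) hB0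
        apply Finset.sum_eq_zero
        intro χ _
        rw [hxz χ j (a + c) (by omega), mul_zero, Real.zero_rpow (by linarith)]
    have hb2 : ∀ a ∈ Finset.range (2 ^ j), ∑ χ ∈ s, ((x χ j a * x χ j (a + 2)) ^ k + (x χ j a * x χ j (a + 3)) ^ k) ≤ 2 * B := by
      intro a ha
      rw [Finset.sum_add_distrib]
      linarith [hb 2 le_rfl a ha, hb 3 (by norm_num) a ha]
    have hb3 := Finset.sum_le_sum hb2
    rw [Finset.sum_const, Finset.card_range, nsmul_eq_mul] at hb3
    have hGp : (0 : ℝ) < 2 ^ j := by positivity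
    have e1 : ((2 ^ j : ℕ) : ℝ) * (1 / 2 ^ j) ^ (2 * k - 1 - k ^ 2 / 2) = ((2 : ℝ) ^ j) ^ κ := by
      rw [one_div, Real.inv_rpow hGp.le, ← Real.rpow_neg hGp.le]
      push_cast
      nth_rewrite 1 [← Real.rpow_one ((2 : ℝ) ^ j)]
      rw [← Real.rpow_add hGp]
      congr 1; rw [hκ]; ring
    have e2 : L ^ (k ^ 2 / 2 - 1) = L ^ ((k - 1) ^ 2) * L ^ (-κ) := by
      rw [← Real.rpow_add hL0]; congr 1; rw [hκ]; ring
    have e3 : L ^ (-κ) ≤ ((2 : ℝ) ^ J) ^ (-κ) := Real.rpow_le_rpow_of_nonpos (by positivity) hJ1 (by linarith)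
    have e4 : ((2 : ℝ) ^ J) ^ (-κ) * ((2 : ℝ) ^ j) ^ κ = r ^ (J - j) * r ^ (J - j) := by
      have hJj : (2 : ℝ) ^ J = 2 ^ (J - j) * 2 ^ j := by rw [← pow_add]; congr 1; omega
      rw [hJj, Real.mul_rpow (by positivity) (by positivity), mul_assoc, ← Real.rpow_add hGp, neg_add_cancel, Real.rpow_zero, mul_one,
        ← pow_add, hr, ← Real.rpow_natCast, ← Real.rpow_mul (by norm_num), ← Real.rpow_mul_natCast (by norm_num)]
      congr 1; push_cast; ring
    have hrp : 0 < r ^ (J - j) := by positivity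
    calc _ ≤ (r⁻¹) ^ (J - j) * (((2 ^ j : ℕ) : ℝ) * (2 * B)) := by gcongr
      _ = (r⁻¹) ^ (J - j) * (32 * A * L ^ (k ^ 2 / 2 - 1) * (((2 ^ j : ℕ) : ℝ) * (1 / 2 ^ j) ^ (2 * k - 1 - k ^ 2 / 2))) := by rw [hB]; ring
      _ = (r⁻¹) ^ (J - j) * (32 * A * L ^ ((k - 1) ^ 2) * (L ^ (-κ) * ((2 : ℝ) ^ j) ^ κ)) := by rw [e1, e2]; ring
      _ ≤ (r⁻¹) ^ (J - j) * (32 * A * L ^ ((k - 1) ^ 2) * (((2 : ℝ) ^ J) ^ (-κ) * ((2 : ℝ) ^ j) ^ κ)) := by gcongr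
      _ = _ := by
        rw [e4, inv_pow, Nat.add_sub_cancel]; field_simp
  calc _ ≤ ∑ χ ∈ s, C1 ^ (2 * k) * Q χ := Finset.sum_le_sum hpt
    _ = C1 ^ (2 * k) * (∑ χ ∈ s, Q1 χ + ∑ j ∈ Finset.range (J + 1), ∑ χ ∈ s, (r⁻¹) ^ (J - j) * Q2 χ j) := by
      rw [← Finset.mul_sum]
      simp only [hQ]
      rw [Finset.sum_add_distrib, Finset.sum_comm (s := s) (t := Finset.range (J + 1))]
    _ ≤ C1 ^ (2 * k) * (2 ^ (2 * k - 1) * A * L ^ ((k - 1) ^ 2) + (32 * A * L ^ ((k - 1) ^ 2)) * (1 - r)⁻¹) := by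
      have h1 := Finset.sum_le_sum hS2
      rw [← Finset.mul_sum] at h1
      have h2 := geo_le hr0.le hr1 (J + 1)
      have h3 := h1.trans (mul_le_mul_of_nonneg_left h2 (by positivity))
      gcongr
    _ = _ := by ring
end S18


namespace S18
end S18

open Classical in
theorem stmt18 (k : ℝ) (hk : 2 < k) :
    ∃ C : ℝ, 0 < C ∧ ∃ q0 : ℕ, ∀ (q : ℕ) [NeZero q], q0 ≤ q →
      (∀ χ : DirichletCharacter ℂ q, dirichletRH χ) →
      ∀ n : ℕ, n ≤ q →
      ∑ χ ∈ Finset.univ.filter (fun χ : DirichletCharacter ℂ q => χ.IsPrimitive),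
        (∫ t in (n : ℝ)..((n : ℝ) + 1), ‖DirichletCharacter.LFunction χ
          (1 / 2 + t * Complex.I)‖) ^ (2 * k)
      ≤ C * (Nat.totient q) * Real.log q ^ ((k - 1) ^ 2) := by
  obtain ⟨Cm, hCm, q1, hm⟩ := S18.moment (k := k) (by linarith)
  obtain ⟨Cp, hp⟩ := S18.psum_bound (k := k) (by linarith)
  obtain ⟨CD, hCD, hD⟩ := S18.partD hk
  refine ⟨CD * (Cm * Real.exp Cp), by positivity, max 3 q1, ?_⟩
  intro q _ hq hRH n hn
  have hq3 : 3 ≤ q := (le_max_left _ _).trans hq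
  have hL : 1 ≤ Real.log q := by
    rw [Real.le_log_iff_exp_le (by positivity)]
    have h1 := Real.exp_one_lt_d9
    have h2 : (3 : ℝ) ≤ q := by exact_mod_cast hq3
    linarith
  have h := hD (Finset.univ.filter (fun χ : DirichletCharacter ℂ q => χ.IsPrimitive))
    (fun χ t => ‖DirichletCharacter.LFunction χ (1 / 2 + t * Complex.I)‖) (Cm * q.totient * Real.exp Cp) (Real.log q) n
    (by
      intro t ht
      have ht0 : ∀ i, 0 ≤ t i := fun i => (Nat.cast_nonneg n).trans (ht i).1
      have ht1 : ∀ i, t i ≤ q + 1 := fun i => (ht i).2.trans (by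
        have : (n : ℝ) ≤ q := by exact_mod_cast hn
        linarith)
      refine (hm q ((le_max_right _ _).trans hq) hRH t ht0 ht1).trans ?_
      have h2 := hp q hq3 t (fun i j => by
        rw [abs_le]; constructor <;> linarith [(ht i).1, (ht i).2, (ht j).1, (ht j).2])
      rw [mul_assoc _ (Real.exp Cp), ← Real.exp_add]
      gcongr)
    (by positivity)
    (by
      intro χ hχ
      have hχp : χ.IsPrimitive := (Finset.mem_filter.1 hχ).2
      have hχ1 : χ ≠ 1 := by
        rintro rfl
        have h1 : (1 : DirichletCharacter ℂ q).conductor = q := hχp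
        rw [DirichletCharacter.conductor_one] at h1
        omega
      have hd : Continuous (DirichletCharacter.LFunction χ) := (DirichletCharacter.differentiable_LFunction hχ1).continuous
      fun_prop)
    (fun χ _ t => norm_nonneg _) hL
  refine h.trans (le_of_eq ?_)
  ring
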